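/- Let n ≥ 1, let p ∈ [1,∞] (with the convention 1/∞ = 0), let 0 < q < 1, and let c(x,y) := ‖x − y‖_p^q on ℝⁿ, where ‖z‖_p = (Σ_{i=1}^n |z_i|^p)^{1/p} and ‖z‖_∞ = max_i |z_i|. Let V_{m,p} := 2^m · Γ(1 + 1/p)^m / Γ(1 + m/p) denote the volume of the unit ℓ_p ball in ℝ^m. Then r*_c(P(ℝⁿ)) < (7.56/(1 − q)) · ( 2.47 · n^{1{p>2}·(1 − 1/p)} · V_{n−1,p}/V_{n,p} )^q, and consequently r*_c(P(ℝⁿ)) < (10.55/(1 − q)) · n^{q·max{1/p, 1 − 1/p}}. -/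

import Mathlib

open MeasureTheory ENNReal

noncomputable section

/-- The optimal transport cost `C*_c(P,Q)` between two Borel measures for the cost `c`:
the infimum of `∫ c dγ` over couplings `γ` of `(P, Q)`. -/
def Cstar {X : Type*} [MeasurableSpace X] (c : X → X → ℝ) (P Q : Measure X) : ℝ≥0∞ :=
  ⨅ γ ∈ {γ : Measure (X × X) |
      IsProbabilityMeasure γ ∧ γ.map Prod.fst = P ∧ γ.map Prod.snd = Q},
    ∫⁻ z, ENNReal.ofReal (c z.1 z.2) ∂γ

/-- The standard probability space: `[0,1]` with Lebesgue measure. -/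
def stdSpace : Measure ℝ := volume.restrict (Set.Icc (0 : ℝ) 1)

/-- `f` is a coupling of the family of probability measures `P` on the standard
probability space `([0,1], Lebesgue)`: each `f a` is measurable with law `P a`. -/
structure IsCoupling {X A : Type*} [MeasurableSpace X]
    (P : A → Measure X) (f : A → ℝ → X) : Prop where
  measurable : ∀ a, Measurable (f a)
  law : ∀ a, stdSpace.map (f a) = P a

/-- The pairwise coupling ratio `r_c({X_α})` of a coupling `f` of the family `P`:
the least `r ≥ 1` such that `E[c(X_a, X_b)] ≤ r ⬝ C*_c(P_a, P_b)` for all `a, b`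
(`∞` if no such `r` exists). -/
def couplingRatio {X A : Type*} [MeasurableSpace X]
    (c : X → X → ℝ) (P : A → Measure X) (f : A → ℝ → X) : ℝ≥0∞ :=
  sInf {r : ℝ≥0∞ | 1 ≤ r ∧ ∀ a b : A,
    ∫⁻ u, ENNReal.ofReal (c (f a u) (f b u)) ∂stdSpace ≤ r * Cstar c (P a) (P b)}

/-- The optimal pairwise coupling ratio `r*_c({P_α})` of a family of probability
measures: the infimum of `r_c({X_α})` over all couplings of the family. -/
def optRatio {X A : Type*} [MeasurableSpace X]
    (c : X → X → ℝ) (P : A → Measure X) : ℝ≥0∞ :=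
  ⨅ (f : A → ℝ → X) (_ : IsCoupling P f), couplingRatio c P f

open Classical in
/-- The `ℓ_p` norm on `ℝⁿ` for an extended real exponent `p ∈ [1,∞]`:
`‖z‖_p = (∑ i |z i|^p)^{1/p}` for finite `p`, and `‖z‖_∞ = max_i |z i|`. -/
def lpNorm (p : ℝ≥0∞) {n : ℕ} (z : Fin n → ℝ) : ℝ :=
  if p = ⊤ then ⨆ i, |z i| else (∑ i, |z i| ^ p.toReal) ^ (1 / p.toReal)

/-- `V_{m,p} = 2^m Γ(1 + 1/p)^m / Γ(1 + m/p)`: the volume of the unit `ℓ_p` ball in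
`ℝ^m` (with the convention `1/p = 0` for `p = ∞`). -/
def unitBallVolume (p : ℝ≥0∞) (m : ℕ) : ℝ :=
  2 ^ m * Real.Gamma (1 + (p⁻¹).toReal) ^ m / Real.Gamma (1 + m * (p⁻¹).toReal)

/-- The optimal pairwise coupling ratio `r*_c(P(ℝⁿ))` of the family of all Borel
probability measures on `ℝⁿ` for the cost `c(x,y) = ‖x − y‖_p^q`. -/
def lpOptRatio (n : ℕ) (p : ℝ≥0∞) (q : ℝ) : ℝ≥0∞ :=
  optRatio (fun x y : Fin n → ℝ => lpNorm p (x - y) ^ q)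
    (fun P : ProbabilityMeasure (Fin n → ℝ) => (P : Measure (Fin n → ℝ)))

set_option linter.unusedSectionVars false

/-- The uniform measure on the unit interval. -/
def unitUniform : Measure ℝ := volume.restrict (Set.Icc (0 : ℝ) 1)

instance : IsProbabilityMeasure unitUniform := ⟨by simp [unitUniform]⟩

lemma unitUniform_lt {b : ℝ≥0∞} (hb : b ≤ 1) : unitUniform {r | ENNReal.ofReal r < b} = b := by
  have hbt : b ≠ ∞ := ne_top_of_le_ne_top one_ne_top hb
  have hm : MeasurableSet {r : ℝ | ENNReal.ofReal r < b} :=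
    measurableSet_lt ENNReal.measurable_ofReal measurable_const
  rw [unitUniform, Measure.restrict_apply hm]
  have : {r : ℝ | ENNReal.ofReal r < b} ∩ Set.Icc 0 1 = Set.Ico 0 b.toReal := by
    ext r
    have hb1 : b.toReal ≤ 1 := by simpa using ENNReal.toReal_mono one_ne_top hb
    simp only [Set.mem_inter_iff, Set.mem_ofPred_eq, Set.mem_Icc, Set.mem_Ico]
    constructor
    · rintro ⟨h1, h2, h3⟩
      exact ⟨h2, (ENNReal.ofReal_lt_iff_lt_toReal h2 hbt).1 h1⟩
    · rintro ⟨h1, h2⟩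
      exact ⟨(ENNReal.ofReal_lt_iff_lt_toReal h1 hbt).2 h2, h1, by linarith⟩
  rw [this, Real.volume_Ico, sub_zero, ENNReal.ofReal_toReal hbt]

lemma unitUniform_le_lt {a b : ℝ≥0∞} (ha : a ≤ 1) (hb : b ≤ 1) :
    unitUniform {r | a ≤ ENNReal.ofReal r ∧ ENNReal.ofReal r < b} ≤ b - a := by
  rcases le_total b a with h | h
  · have : {r : ℝ | a ≤ ENNReal.ofReal r ∧ ENNReal.ofReal r < b} = ∅ := by
      ext r
      simp only [Set.mem_ofPred_eq, Set.mem_empty_iff_false, iff_false, not_and, not_lt]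
      exact fun h' => h.trans h'
    simp [this]
  · have : {r : ℝ | a ≤ ENNReal.ofReal r ∧ ENNReal.ofReal r < b} =
        {r | ENNReal.ofReal r < b} \ {r | ENNReal.ofReal r < a} := by
      ext r
      simp [and_comm]
    have hsub : {r : ℝ | ENNReal.ofReal r < a} ⊆ {r | ENNReal.ofReal r < b} :=
      fun r (hr : ENNReal.ofReal r < a) => lt_of_lt_of_le hr h
    rw [this, measure_sdiff hsub
      (measurableSet_lt ENNReal.measurable_ofReal measurable_const).nullMeasurableSet
      (measure_ne_top _ _), unitUniform_lt hb, unitUniform_lt ha]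

/-- The absolute difference of two extended nonnegative numbers. -/
def absDiff (a b : ℝ≥0∞) : ℝ≥0∞ := (a - b) + (b - a)

section Trials

variable {F : Type*} [Fintype F] [Nonempty F] [MeasurableSpace F] [MeasurableSingletonClass F]

variable (F) in
/-- A single proposal: a uniform symbol with an independent uniform level. -/
def trialMeasure : Measure (F × ℝ) :=
  ((Fintype.card F : ℝ≥0∞)⁻¹ • Measure.count).prod unitUniform

instance : IsProbabilityMeasure (trialMeasure F) := ⟨by
  rw [trialMeasure, Measure.prod_apply MeasurableSet.univ]
  simp only [Set.preimage_univ, measure_univ, lintegral_const, one_mul, Measure.smul_apply,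
    smul_eq_mul]
  rw [Measure.count_univ]
  simp [ENat.card_eq_coe_fintype_card]
  exact ENNReal.inv_mul_cancel (by simp) (by simp)⟩

lemma trialMeasure_apply {s : Set (F × ℝ)} (hs : MeasurableSet s) :
    trialMeasure F s = (Fintype.card F : ℝ≥0∞)⁻¹ * ∑ z, unitUniform {r | (z, r) ∈ s} := by
  have : SFinite ((Fintype.card F : ℝ≥0∞)⁻¹ • (Measure.count : Measure F)) := inferInstance
  rw [trialMeasure, Measure.prod_apply hs, lintegral_smul_measure, lintegral_count,
    tsum_fintype]
  rfl

variable (F) in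
/-- Infinitely many independent proposals. -/
def trialsMeasure : Measure (ℕ → F × ℝ) := Measure.infinitePi fun _ => trialMeasure F

instance : IsProbabilityMeasure (trialsMeasure F) := by
  unfold trialsMeasure; infer_instance

lemma trialsMeasure_first {A C : Set (F × ℝ)} (hA : MeasurableSet A) (hC : MeasurableSet C)
    (i : ℕ) : trialsMeasure F {ω | (∀ j < i, ω j ∈ A) ∧ ω i ∈ C}
      = trialMeasure F A ^ i * trialMeasure F C := by
  have : {ω : ℕ → F × ℝ | (∀ j < i, ω j ∈ A) ∧ ω i ∈ C}
      = (↑(Finset.range (i+1)) : Set ℕ).pi (fun j => if j < i then A else C) := by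
    ext ω
    simp only [Set.mem_ofPred_eq, Set.mem_pi, Finset.coe_range, Set.mem_Iio]
    constructor
    · rintro ⟨h1, h2⟩ j hj
      split_ifs with h
      · exact h1 j h
      · obtain rfl : j = i := by omega
        exact h2
    · intro h
      refine ⟨fun j hj => by simpa [hj] using h j (by omega), by simpa using h i (by omega)⟩
  rw [this, trialsMeasure, Measure.infinitePi_pi]
  · rw [Finset.prod_range_succ]
    simp only [lt_irrefl, if_false]
    congr 1
    rw [Finset.prod_congr rfl (g := fun _ => trialMeasure F A)]
    · simp
    · intro x hx
      simp [Finset.mem_range.1 hx]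
  · intro j _
    split_ifs <;> assumption

lemma trialsMeasure_le {D C : Set (F × ℝ)} (hD : MeasurableSet D) (hC : MeasurableSet C)
    (hD0 : trialMeasure F D ≠ 0) (E : Set (ℕ → F × ℝ))
    (hE : ∀ ω ∈ E, (∀ j, ω j ∉ D) ∨ ∃ i, (∀ j < i, ω j ∉ D) ∧ ω i ∈ C) :
    trialsMeasure F E ≤ trialMeasure F C / trialMeasure F D := by
  have hDc : trialMeasure F Dᶜ = 1 - trialMeasure F D := prob_compl_eq_one_sub hD
  have hlt : trialMeasure F Dᶜ < 1 := by
    rw [hDc]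
    exact ENNReal.sub_lt_self one_ne_top one_ne_zero hD0
  have h0 : trialsMeasure F {ω | ∀ j, ω j ∈ Dᶜ} = 0 := by
    refine le_antisymm ?_ zero_le
    refine ge_of_tendsto' (ENNReal.tendsto_pow_atTop_nhds_zero_of_lt_one hlt) fun i => ?_
    calc _ ≤ trialsMeasure F {ω | (∀ j < i, ω j ∈ Dᶜ) ∧ ω i ∈ Set.univ} :=
          measure_mono fun ω (h : ∀ j, ω j ∈ Dᶜ) => ⟨fun j _ => h j, trivial⟩
      _ = _ := by rw [trialsMeasure_first hD.compl MeasurableSet.univ]; simp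
  calc trialsMeasure F E ≤ trialsMeasure F ({ω | ∀ j, ω j ∈ Dᶜ} ∪
        ⋃ i, {ω | (∀ j < i, ω j ∈ Dᶜ) ∧ ω i ∈ C}) := by
        refine measure_mono fun ω h => ?_
        rcases hE ω h with h | ⟨i, h1, h2⟩
        · exact Or.inl h
        · exact Or.inr (Set.mem_iUnion.2 ⟨i, h1, h2⟩)
    _ ≤ 0 + ∑' i, trialMeasure F Dᶜ ^ i * trialMeasure F C := by
        refine (measure_union_le _ _).trans (add_le_add h0.le ?_)
        refine (measure_iUnion_le _).trans (ENNReal.tsum_le_tsum fun i => ?_)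
        rw [trialsMeasure_first hD.compl hC]
    _ = _ := by
        rw [zero_add, ENNReal.tsum_mul_right, ENNReal.tsum_geometric, hDc,
          ENNReal.sub_sub_cancel one_ne_top prob_le_one, mul_comm, div_eq_mul_inv]

/-- A proposal is accepted by `π` if its level lies below the weight of its symbol. -/
def Accepts (π : F → ℝ≥0∞) (t : F × ℝ) : Prop := ENNReal.ofReal t.2 < π t.1


/-- A symbol of `s` when there is one. -/
def someSymbol (s : F → Prop) : F := open Classical in
  if h : ∃ z, s z then h.choose else Classical.arbitrary F

lemma someSymbol_spec {s : F → Prop} (h : ∃ z, s z) : s (someSymbol s) := by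
  rw [someSymbol, dif_pos h]
  exact h.choose_spec

open Classical in
/-- The first accepted symbol of a sequence of proposals. -/
def pick (π : F → ℝ≥0∞) (ω : ℕ → F × ℝ) : F :=
  if h : ∃ i, Accepts π (ω i) then (ω (Nat.find h)).1 else someSymbol fun z => π z ≠ 0

lemma pick_eq_of_accepts {π : F → ℝ≥0∞} {ω : ℕ → F × ℝ} {i : ℕ}
    (h : ∀ j < i, ¬ Accepts π (ω j)) (hi : Accepts π (ω i)) : pick π ω = (ω i).1 := by
  classical
  have hex : ∃ i, Accepts π (ω i) := ⟨i, hi⟩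
  rw [pick, dif_pos hex]
  congr 2
  exact (Nat.find_eq_iff hex).2 ⟨hi, h⟩

lemma pick_ne_zero {π : F → ℝ≥0∞} (hπ : ∃ z, π z ≠ 0) (ω : ℕ → F × ℝ) : π (pick π ω) ≠ 0 := by
  classical
  by_cases h : ∃ i, Accepts π (ω i)
  · rw [pick, dif_pos h]
    exact (lt_of_le_of_lt zero_le (Nat.find_spec h)).ne'
  · rw [pick, dif_neg h]
    exact someSymbol_spec hπ

lemma measurableSet_accepts (π : F → ℝ≥0∞) : MeasurableSet {t | Accepts π t} :=
  measurableSet_lt (ENNReal.measurable_ofReal.comp measurable_snd)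
    ((measurable_of_finite π).comp measurable_fst)

lemma trialMeasure_accepts {π : F → ℝ≥0∞} (hπ : ∑ z, π z = 1) :
    trialMeasure F {t | Accepts π t} = (Fintype.card F : ℝ≥0∞)⁻¹ := by
  have hle : ∀ z, π z ≤ 1 := fun z => hπ ▸ Finset.single_le_sum (fun _ _ => zero_le) (Finset.mem_univ z)
  rw [trialMeasure_apply (measurableSet_accepts π)]
  have : ∀ z, unitUniform {r | (z, r) ∈ {t | Accepts π t}} = π z := fun z =>
    unitUniform_lt (hle z)
  simp_rw [this, hπ, mul_one]

lemma card_inv_ne_zero : (Fintype.card F : ℝ≥0∞)⁻¹ ≠ 0 := by simp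

lemma card_inv_ne_top : (Fintype.card F : ℝ≥0∞)⁻¹ ≠ ∞ := by simp

lemma exists_ne_zero_of_sum_eq_one {π : F → ℝ≥0∞} (hπ : ∑ z, π z = 1) : ∃ z, π z ≠ 0 := by
  by_contra! h
  simp [h] at hπ

lemma measurable_pick : Measurable fun p : (F → ℝ≥0∞) × (ℕ → F × ℝ) => pick p.1 p.2 := by
  classical
  have hacc : ∀ i, MeasurableSet {p : (F → ℝ≥0∞) × (ℕ → F × ℝ) | Accepts p.1 (p.2 i)} := by
    intro i
    have : {p : (F → ℝ≥0∞) × (ℕ → F × ℝ) | Accepts p.1 (p.2 i)}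
      = ⋃ z, ({p | (p.2 i).1 = z} ∩ {p | ENNReal.ofReal (p.2 i).2 < p.1 z}) := by
      ext p
      simp [Accepts]
    rw [this]
    refine MeasurableSet.iUnion fun z => MeasurableSet.inter ?_ ?_
    · exact (measurable_fst.comp ((measurable_pi_apply i).comp measurable_snd))
        (measurableSet_singleton z)
    · exact measurableSet_lt (ENNReal.measurable_ofReal.comp
        (measurable_snd.comp ((measurable_pi_apply i).comp measurable_snd)))
        ((measurable_pi_apply z).comp measurable_fst)
  have hsel : Measurable fun π : F → ℝ≥0∞ => someSymbol fun z => π z ≠ 0 := by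
    have : (fun π : F → ℝ≥0∞ => someSymbol fun z => π z ≠ 0)
      = (fun s : F → Bool => someSymbol fun z => s z = true) ∘
        fun π z => decide (π z ≠ 0) := by
      ext π; simp
    rw [this]
    refine (measurable_of_finite _).comp (measurable_pi_lambda _ fun z => ?_)
    refine measurable_to_bool ?_
    have : (fun π : F → ℝ≥0∞ => decide (π z ≠ 0)) ⁻¹' {true} = {π | π z = 0}ᶜ := by
      ext π; simp
    rw [this]
    exact ((measurable_pi_apply z) (measurableSet_singleton 0)).compl
  refine measurable_to_countable' fun z => ?_
  have : (fun p : (F → ℝ≥0∞) × (ℕ → F × ℝ) => pick p.1 p.2) ⁻¹' {z}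
      = (⋃ i, ((⋂ j, ⋂ (_ : j < i), {p | Accepts p.1 (p.2 j)}ᶜ) ∩
        ({p | Accepts p.1 (p.2 i)} ∩ {p | (p.2 i).1 = z}))) ∪
        ((⋂ i, {p | Accepts p.1 (p.2 i)}ᶜ) ∩ {p | (someSymbol fun z => p.1 z ≠ 0) = z}) := by
    ext p
    simp only [Set.mem_preimage, Set.mem_singleton_iff, Set.mem_union, Set.mem_iUnion,
      Set.mem_inter_iff, Set.mem_iInter, Set.mem_compl_iff, Set.mem_ofPred_eq]
    by_cases h : ∃ i, Accepts p.1 (p.2 i)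
    · have h1 : ¬ ∀ i, ¬ Accepts p.1 (p.2 i) := by push Not; exact h
      simp only [h1, false_and, or_false]
      constructor
      · intro hz
        exact ⟨Nat.find h, fun j hj => Nat.find_min h hj, Nat.find_spec h, by
          rw [pick, dif_pos h] at hz; exact hz⟩
      · rintro ⟨i, h2, h3, h4⟩
        rw [pick_eq_of_accepts h2 h3, h4]
    · rw [pick, dif_neg h]
      push Not at h
      simp [h]
  rw [this]
  refine MeasurableSet.union (MeasurableSet.iUnion fun i => MeasurableSet.inter
    (MeasurableSet.iInter fun j => MeasurableSet.iInter fun _ => (hacc j).compl)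
    ((hacc i).inter ?_)) (MeasurableSet.inter (MeasurableSet.iInter fun j => (hacc j).compl) ?_)
  · exact (measurable_fst.comp ((measurable_pi_apply i).comp measurable_snd))
        (measurableSet_singleton z)
  · exact (hsel.comp measurable_fst) (measurableSet_singleton z)

lemma measurable_pick_right (π : F → ℝ≥0∞) : Measurable (pick π) :=
  measurable_pick.comp (measurable_const.prodMk measurable_id)

lemma trialsMeasure_pick {π : F → ℝ≥0∞} (hπ : ∑ z, π z = 1) (z : F) :
    trialsMeasure F {ω | pick π ω = z} = π z := by
  classical
  have hle : ∀ z, π z ≤ 1 := fun z => hπ ▸ Finset.single_le_sum (fun _ _ => zero_le) (Finset.mem_univ z)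
  have hmeas : ∀ z, MeasurableSet {ω | pick π ω = z} := fun z =>
    measurable_pick_right π (measurableSet_singleton z)
  have hub : ∀ z, trialsMeasure F {ω | pick π ω = z} ≤ π z := by
    intro z
    have hC : MeasurableSet {t : F × ℝ | Accepts π t ∧ t.1 = z} :=
      (measurableSet_accepts π).inter (measurable_fst (measurableSet_singleton z))
    refine (trialsMeasure_le (measurableSet_accepts π) hC
      (by rw [trialMeasure_accepts hπ]; exact card_inv_ne_zero) _ ?_).trans ?_
    · intro ω (h : pick π ω = z)
      by_cases hex : ∃ i, Accepts π (ω i)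
      · right
        rw [pick, dif_pos hex] at h
        exact ⟨Nat.find hex, fun j hj => Nat.find_min hex hj, Nat.find_spec hex, h⟩
      · left
        push Not at hex
        exact hex
    · rw [trialMeasure_accepts hπ, trialMeasure_apply hC, mul_comm, ENNReal.mul_div_cancel_right
        card_inv_ne_zero card_inv_ne_top]
      rw [Finset.sum_eq_single z]
      · refine (measure_mono ?_).trans (unitUniform_lt (hle z)).le
        exact fun r hr => hr.1
      · intro y _ hy
        have : {r : ℝ | (y, r) ∈ {t : F × ℝ | Accepts π t ∧ t.1 = z}} = ∅ := by
          ext r; simp [hy]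
        rw [this, measure_empty]
      · simp
  have hsum : ∑ z, trialsMeasure F {ω | pick π ω = z} = 1 := by
    rw [← measure_biUnion_finset]
    · convert (measure_univ (μ := trialsMeasure F))
      ext ω; simp
    · intro a _ b _ hab
      refine Set.disjoint_left.2 fun ω (h1 : pick π ω = a) (h2 : pick π ω = b) => hab (h1 ▸ h2)
    · exact fun z _ => hmeas z
  by_contra hne
  have hlt : ∑ z, trialsMeasure F {ω | pick π ω = z} < ∑ z, π z := by
    rw [← Finset.add_sum_erase _ _ (Finset.mem_univ z), ← Finset.add_sum_erase _ π (Finset.mem_univ z)]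
    refine ENNReal.add_lt_add_of_lt_of_le ?_ (lt_of_le_of_ne (hub z) hne)
      (Finset.sum_le_sum fun y _ => hub y)
    exact (ENNReal.sum_lt_top.2 fun y _ => measure_lt_top _ _).ne
  rw [hsum, hπ] at hlt
  exact lt_irrefl _ hlt

lemma trialsMeasure_pick_ne {π π' : F → ℝ≥0∞} (hπ : ∑ z, π z = 1) (hπ' : ∑ z, π' z = 1) :
    trialsMeasure F {ω | pick π ω ≠ pick π' ω} ≤ ∑ z, absDiff (π z) (π' z) := by
  classical
  have hle : ∀ z, π z ≤ 1 := fun z => hπ ▸ Finset.single_le_sum (fun _ _ => zero_le) (Finset.mem_univ z)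
  have hle' : ∀ z, π' z ≤ 1 := fun z => hπ' ▸ Finset.single_le_sum (fun _ _ => zero_le) (Finset.mem_univ z)
  have hA := measurableSet_accepts π
  have hA' := measurableSet_accepts π'
  set D : Set (F × ℝ) := {t | Accepts π t} ∪ {t | Accepts π' t} with hD
  set C : Set (F × ℝ) := ({t | Accepts π t} \ {t | Accepts π' t}) ∪
    ({t | Accepts π' t} \ {t | Accepts π t}) with hC
  have hDm : MeasurableSet D := hA.union hA'
  have hCm : MeasurableSet C := (hA.diff hA').union (hA'.diff hA)
  have hDge : (Fintype.card F : ℝ≥0∞)⁻¹ ≤ trialMeasure F D := by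
    rw [← trialMeasure_accepts hπ]
    exact measure_mono Set.subset_union_left
  have hD0 : trialMeasure F D ≠ 0 := fun h => card_inv_ne_zero (F := F) (le_antisymm (h ▸ hDge) zero_le)
  refine (trialsMeasure_le hDm hCm hD0 _ ?_).trans ?_
  · intro ω (h : pick π ω ≠ pick π' ω)
    by_cases hex : ∃ i, ω i ∈ D
    · right
      refine ⟨Nat.find hex, fun j hj => Nat.find_min hex hj, ?_⟩
      by_contra hnC
      have hs := Nat.find_spec hex
      have hb : Accepts π (ω (Nat.find hex)) ∧ Accepts π' (ω (Nat.find hex)) := by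
        simp only [hC, hD, Set.mem_union, Set.mem_sdiff, Set.mem_ofPred_eq] at hnC hs
        tauto
      have hn : ∀ j < Nat.find hex, ¬ Accepts π (ω j) ∧ ¬ Accepts π' (ω j) := by
        intro j hj
        have := Nat.find_min hex hj
        simp only [hD, Set.mem_union, Set.mem_ofPred_eq] at this
        tauto
      exact h ((pick_eq_of_accepts (fun j hj => (hn j hj).1) hb.1).trans
        (pick_eq_of_accepts (fun j hj => (hn j hj).2) hb.2).symm)
    · left
      push Not at hex
      exact hex
  · refine (ENNReal.div_le_div_left hDge _).trans ?_
    rw [trialMeasure_apply hCm, mul_comm, ENNReal.mul_div_cancel_right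
        card_inv_ne_zero card_inv_ne_top]
    refine Finset.sum_le_sum fun z _ => ?_
    refine (measure_mono (t := {r | π' z ≤ ENNReal.ofReal r ∧ ENNReal.ofReal r < π z} ∪
      {r | π z ≤ ENNReal.ofReal r ∧ ENNReal.ofReal r < π' z}) ?_).trans ?_
    · intro r hr
      simp only [hC, Set.mem_union, Set.mem_sdiff, Set.mem_ofPred_eq, Accepts, not_lt] at hr ⊢
      tauto
    · exact (measure_union_le _ _).trans (add_le_add (unitUniform_le_lt (hle' z) (hle z))
        (unitUniform_le_lt (hle z) (hle' z)))

end Trials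

/-- A multiscale random code on a metric space: at every level `k : ℤ` a point `x` receives the
symbol `z` with probability `N k x z`; far levels do not distinguish `x` from `x0`, and the symbols
at the levels above `k` localize the point up to distance `D k` and cost `w k`. -/
structure ScaleCode (X F : Type*) [MetricSpace X] [MeasurableSpace X] [Fintype F]
    (c : X → X → ℝ≥0∞) where
  N : ℤ → X → F → ℝ≥0∞
  x0 : X
  β : ℝ≥0∞
  c0 : ℕ
  D : ℤ → ℝ
  w : ℤ → ℝ≥0∞
  measurable_N : ∀ k z, Measurable fun x => N k x z
  sum_N : ∀ k x, ∑ z, N k x z = 1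
  β_ne_zero : β ≠ 0
  β_le : ∀ k z, N k x0 z ≠ 0 → β ≤ N k x0 z
  exists_base : ∀ x, ∃ J : ℤ, ∀ j ≥ J, N j x = N j x0
  base_of_consistent : ∀ (K : ℤ) (x : X) (y : ℤ → F),
    (∀ j > K, N j x (y j) ≠ 0 ∧ N j x0 (y j) ≠ 0) → ∀ j > K + c0, N j x = N j x0
  loc : ∀ (k : ℤ) (x x' : X) (y : ℤ → F),
    (∀ j > k, N j x (y j) ≠ 0 ∧ N j x' (y j) ≠ 0) → dist x x' ≤ D k ∧ c x x' ≤ w k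
  D_pos : ∀ k, 0 < D k
  tendsto_D : Filter.Tendsto D Filter.atBot (nhds 0)

namespace ScaleCode

variable {X F : Type*} [MetricSpace X] [MeasurableSpace X] [Fintype F]
  [MeasurableSpace F] [MeasurableSingletonClass F] {c : X → X → ℝ≥0∞} (S : ScaleCode X F c)

lemma N_le_one (k : ℤ) (x : X) (z : F) : S.N k x z ≤ 1 :=
  S.sum_N k x ▸ Finset.single_le_sum (fun _ _ => zero_le) (Finset.mem_univ z)

/-- The reference weights. -/
def b (k : ℤ) (z : F) : ℝ≥0∞ := open Classical in if S.N k S.x0 z = 0 then 1 else S.N k S.x0 z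

lemma b_ne_zero (k : ℤ) (z : F) : S.b k z ≠ 0 := by
  unfold b; split_ifs with h <;> simp [h]

lemma b_le_one (k : ℤ) (z : F) : S.b k z ≤ 1 := by
  unfold b; split_ifs with h <;> simp [S.N_le_one]

lemma b_ne_top (k : ℤ) (z : F) : S.b k z ≠ ∞ := ne_top_of_le_ne_top one_ne_top (S.b_le_one k z)

lemma N_le_b (k : ℤ) (z : F) : S.N k S.x0 z ≤ S.b k z := by
  unfold b; split_ifs with h <;> simp [h]

lemma b_eq {k : ℤ} {z : F} (h : S.N k S.x0 z ≠ 0) : S.b k z = S.N k S.x0 z := by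
  simp [b, h]

/-- The likelihood ratio of a symbol with respect to the reference weights. -/
def ratio (k : ℤ) (x : X) (z : F) : ℝ≥0∞ := S.N k x z / S.b k z

lemma b_mul_ratio (k : ℤ) (x : X) (z : F) : S.b k z * S.ratio k x z = S.N k x z :=
  ENNReal.mul_div_cancel (S.b_ne_zero k z) (S.b_ne_top k z)

lemma ratio_ne_top (k : ℤ) (x : X) (z : F) : S.ratio k x z ≠ ∞ :=
  ENNReal.div_ne_top (ne_top_of_le_ne_top one_ne_top (S.N_le_one k x z)) (S.b_ne_zero k z)

/-- The likelihood of the symbols above level `k`. -/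
def W (k : ℤ) (y : ℤ → F) (x : X) : ℝ≥0∞ :=
  Filter.limsup (fun m : ℕ => ∏ i ∈ Finset.range m, S.ratio (k + 1 + i) x (y (k + 1 + i)))
    Filter.atTop

lemma W_sub_one (k : ℤ) (y : ℤ → F) (x : X) :
    S.W (k - 1) y x = S.ratio k x (y k) * S.W k y x := by
  rw [W, W, ← ENNReal.limsup_const_mul_of_ne_top (S.ratio_ne_top _ _ _),
    ← Filter.limsup_nat_add _ 1]
  congr 1
  ext m
  rw [Finset.prod_range_succ', mul_comm]
  congr 1
  · simp
  · refine Finset.prod_congr rfl fun i _ => ?_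
    have h : k - 1 + 1 + ((i + 1 : ℕ) : ℤ) = k + 1 + i := by push_cast; ring
    rw [h]

lemma W_congr {k : ℤ} {y y' : ℤ → F} (h : ∀ j > k, y j = y' j) (x : X) :
    S.W k y x = S.W k y' x := by
  unfold W
  congr 1
  ext m
  refine Finset.prod_congr rfl fun i _ => ?_
  rw [h _ (by omega)]

lemma W_eq_prod_mul (k : ℤ) (y : ℤ → F) (x : X) (m : ℕ) :
    S.W k y x = (∏ i ∈ Finset.range m, S.ratio (k + 1 + i) x (y (k + 1 + i))) * S.W (k + m) y x := by
  induction m with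
  | zero => simp
  | succ m ih =>
    rw [ih, Finset.prod_range_succ, mul_assoc]
    congr 1
    have := S.W_sub_one (k + 1 + m) y x
    rw [show k + 1 + (m : ℤ) - 1 = k + m by ring] at this
    rw [this]
    congr 2
    push_cast; ring

lemma N_ne_zero_of_W_ne_zero {k : ℤ} {y : ℤ → F} {x : X} (h : S.W k y x ≠ 0) {j : ℤ}
    (hj : k < j) : S.N j x (y j) ≠ 0 := by
  intro h0
  apply h
  obtain ⟨i, rfl⟩ : ∃ i : ℕ, j = k + 1 + i := ⟨(j - k - 1).toNat, by omega⟩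
  rw [S.W_eq_prod_mul k y x (i + 1), Finset.prod_range_succ]
  simp [ratio, h0]

lemma W_eq_one {k : ℤ} {y : ℤ → F} {x : X} (hy : ∀ j > k, S.N j S.x0 (y j) ≠ 0)
    (hx : ∀ j > k, S.N j x = S.N j S.x0) : S.W k y x = 1 := by
  have : ∀ m : ℕ, ∏ i ∈ Finset.range m, S.ratio (k + 1 + i) x (y (k + 1 + i)) = 1 := by
    refine fun m => Finset.prod_eq_one fun i _ => ?_
    have h1 := hy (k + 1 + i) (by omega)
    rw [ratio, hx _ (by omega), S.b_eq h1, ENNReal.div_self h1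
      (ne_top_of_le_ne_top one_ne_top (S.N_le_one _ _ _))]
  simp [W, this]

/-- A bound for the likelihoods of reference histories. -/
def bound : ℝ≥0∞ := S.β⁻¹ ^ S.c0

lemma bound_ne_top : S.bound ≠ ∞ := ENNReal.pow_ne_top (by simp [S.β_ne_zero])

lemma β_le_b [Nonempty F] (k : ℤ) (z : F) : S.β ≤ S.b k z := by
  by_cases h : S.N k S.x0 z = 0
  · have h1 : S.b k z = 1 := by simp [b, h]
    obtain ⟨z', hz'⟩ := exists_ne_zero_of_sum_eq_one (S.sum_N k S.x0)
    rw [h1]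
    exact (S.β_le k z' hz').trans (S.N_le_one _ _ _)
  · rw [S.b_eq h]
    exact S.β_le k z h

lemma ratio_le [Nonempty F] (k : ℤ) (x : X) (z : F) : S.ratio k x z ≤ S.β⁻¹ := by
  rw [ratio, div_eq_mul_inv]
  calc _ ≤ 1 * S.β⁻¹ := mul_le_mul' (S.N_le_one _ _ _) (ENNReal.inv_le_inv.2 (S.β_le_b k z))
    _ = _ := one_mul _

lemma W_le_bound [Nonempty F] {k : ℤ} {y : ℤ → F} (hy : ∀ j > k, S.N j S.x0 (y j) ≠ 0) (x : X) :
    S.W k y x ≤ S.bound := by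
  by_cases h : S.W k y x = 0
  · simp [h]
  · have hx := S.base_of_consistent k x y fun j hj => ⟨S.N_ne_zero_of_W_ne_zero h hj, hy j hj⟩
    rw [S.W_eq_prod_mul k y x S.c0, S.W_eq_one (fun j hj => hy j (by omega)) hx, mul_one]
    calc _ ≤ ∏ i ∈ Finset.range S.c0, S.β⁻¹ := Finset.prod_le_prod' fun i _ => S.ratio_le _ _ _
      _ = _ := by simp [bound]

lemma measurable_ratio (k : ℤ) :
    Measurable fun p : (ℤ → F) × X => S.ratio k p.2 (p.1 k) := by
  have h : Measurable fun p : F × X => S.ratio k p.2 p.1 := by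
    refine measurable_from_prod_countable_right fun z => ?_
    have := (S.measurable_N k z).div_const (S.b k z)
    exact this
  have h' : Measurable fun p : (ℤ → F) × X => (p.1 k, p.2) := by fun_prop
  exact h.comp h'

lemma measurable_W (k : ℤ) : Measurable fun p : (ℤ → F) × X => S.W k p.1 p.2 := by
  unfold W
  refine Measurable.limsup fun m => ?_
  refine Finset.measurable_fun_prod _ fun i _ => ?_
  exact S.measurable_ratio _

attribute [irreducible] W

lemma measurable_W_right (k : ℤ) (y : ℤ → F) : Measurable (S.W k y) :=
  (S.measurable_W k).comp (measurable_prodMk_left (x := y))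

lemma measurable_W_left (k : ℤ) (x : X) : Measurable fun y => S.W k y x :=
  (S.measurable_W k).comp (measurable_prodMk_right (y := x))

lemma W_update_self (k : ℤ) (y : ℤ → F) (z : F) (x : X) :
    S.W (k - 1) (Function.update y k z) x = S.ratio k x z * S.W k y x := by
  rw [W_sub_one, Function.update_self]
  congr 1
  exact S.W_congr (fun j hj => Function.update_of_ne (by omega) _ _) x

lemma b_mul_W_update (k : ℤ) (y : ℤ → F) (z : F) (x : X) :
    S.b k z * S.W (k - 1) (Function.update y k z) x = S.N k x z * S.W k y x := by
  rw [W_update_self, ← mul_assoc, b_mul_ratio]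

/-- The integral of `f` against the unnormalized posterior of `P` given the symbols above `k`. -/
def post (P : Measure X) (k : ℤ) (f : X → ℝ≥0∞) (y : ℤ → F) : ℝ≥0∞ := ∫⁻ x, S.W k y x * f x ∂P

/-- The mass of the unnormalized posterior. -/
def M (P : Measure X) (k : ℤ) (y : ℤ → F) : ℝ≥0∞ := ∫⁻ x, S.W k y x ∂P

lemma measurable_post (P : Measure X) [SFinite P] (k : ℤ) {f : X → ℝ≥0∞} (hf : Measurable f) :
    Measurable (S.post P k f) :=
  Measurable.lintegral_prod_right' ((S.measurable_W k).mul (hf.comp measurable_snd))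

lemma measurable_M (P : Measure X) [SFinite P] (k : ℤ) : Measurable (S.M P k) :=
  Measurable.lintegral_prod_right' (S.measurable_W k)

lemma sum_b_mul_post (P : Measure X) (k : ℤ) {f : X → ℝ≥0∞} (hf : Measurable f) (y : ℤ → F) :
    ∑ z, S.b k z * S.post P (k - 1) f (Function.update y k z) = S.post P k f y := by
  have : ∀ z, S.b k z * S.post P (k - 1) f (Function.update y k z)
      = ∫⁻ x, S.N k x z * (S.W k y x * f x) ∂P := by
    intro z
    rw [post, ← lintegral_const_mul _ ((S.measurable_W_right _ _).fun_mul hf)]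
    refine lintegral_congr fun x => ?_
    rw [← mul_assoc, b_mul_W_update, mul_assoc]
  simp_rw [this]
  rw [← lintegral_finsetSum _ fun z _ => (S.measurable_N k z).fun_mul ((S.measurable_W_right _ _).fun_mul hf)]
  refine lintegral_congr fun x => ?_
  rw [← Finset.sum_mul, S.sum_N, one_mul]

lemma post_one (P : Measure X) (k : ℤ) : S.post P k (fun _ => 1) = S.M P k := by
  ext y; simp [post, M]

lemma sum_b_mul_M (P : Measure X) (k : ℤ) (y : ℤ → F) :
    ∑ z, S.b k z * S.M P (k - 1) (Function.update y k z) = S.M P k y := by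
  have := S.sum_b_mul_post P k (measurable_const (a := 1)) y
  simpa only [post_one] using this

/-- The predictive distribution of the symbol at level `k` given the symbols above. -/
def pred (P : Measure X) (k : ℤ) (y : ℤ → F) (z : F) : ℝ≥0∞ :=
  S.b k z * S.M P (k - 1) (Function.update y k z) / S.M P k y

lemma measurable_pred (P : Measure X) [SFinite P] (k : ℤ) : Measurable (S.pred P k) := by
  refine measurable_pi_lambda _ fun z => ?_
  exact ((((S.measurable_M P (k - 1)).comp measurable_update_left).const_mul _).div
    (S.measurable_M P k))

lemma sum_pred {P : Measure X} {k : ℤ} {y : ℤ → F} (h0 : S.M P k y ≠ 0) (h1 : S.M P k y ≠ ∞) :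
    ∑ z, S.pred P k y z = 1 := by
  simp_rw [pred, div_eq_mul_inv]
  rw [← Finset.sum_mul, S.sum_b_mul_M, ENNReal.mul_inv_cancel h0 h1]

lemma M_update_ne_zero {P : Measure X} {k : ℤ} {y : ℤ → F} {z : F} (h : S.pred P k y z ≠ 0) :
    S.M P (k - 1) (Function.update y k z) ≠ 0 := by
  intro h0
  simp [pred, h0] at h

lemma M_update_ne_top {P : Measure X} {k : ℤ} {y : ℤ → F} (z : F) (h : S.M P k y ≠ ∞) :
    S.M P (k - 1) (Function.update y k z) ≠ ∞ := by
  intro h0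
  apply h
  rw [← S.sum_b_mul_M P k y, ENNReal.sum_eq_top]
  exact ⟨z, Finset.mem_univ z, by rw [h0, ENNReal.mul_top (S.b_ne_zero k z)]⟩

end ScaleCode

lemma measurePreserving_update {T : Type*} [MeasurableSpace T] (ν : Measure T)
    [IsProbabilityMeasure ν] (k : ℤ) :
    MeasurePreserving (fun p : (ℤ → T) × T => Function.update p.1 k p.2)
      ((Measure.infinitePi fun _ : ℤ => ν).prod ν) (Measure.infinitePi fun _ : ℤ => ν) := by
  classical
  refine ⟨measurable_update', Measure.eq_infinitePi _ fun s t ht => ?_⟩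
  rw [Measure.map_apply measurable_update' (MeasurableSet.pi s.countable_toSet fun i _ => ht i)]
  have : (fun p : (ℤ → T) × T => Function.update p.1 k p.2) ⁻¹' ((s : Set ℤ).pi t)
      = ((s.erase k : Finset ℤ) : Set ℤ).pi t ×ˢ (if k ∈ s then t k else Set.univ) := by
    ext ⟨ω, w⟩
    simp only [Set.mem_preimage, Set.mem_pi, Set.mem_prod, Finset.coe_erase, Finset.mem_coe,
      Set.mem_sdiff, Set.mem_singleton_iff]
    constructor
    · intro h
      refine ⟨fun i hi => by simpa [hi.2] using h i hi.1, ?_⟩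
      split_ifs with hk
      · simpa using h k hk
      · trivial
    · rintro ⟨h1, h2⟩ i hi
      by_cases hik : i = k
      · subst hik
        simpa [hi] using h2
      · simpa [hik] using h1 i ⟨hi, hik⟩
  rw [this, Measure.prod_prod, Measure.infinitePi_pi _ fun i _ => ht i]
  split_ifs with hk
  · rw [mul_comm, Finset.mul_prod_erase s (fun i => ν (t i)) hk]
  · rw [measure_univ, mul_one, Finset.erase_eq_of_notMem hk]

lemma lintegral_resample {T : Type*} [MeasurableSpace T] (ν : Measure T)
    [IsProbabilityMeasure ν] (k : ℤ) {f : (ℤ → T) → ℝ≥0∞} (hf : Measurable f) :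
    ∫⁻ ω, f ω ∂(Measure.infinitePi fun _ : ℤ => ν)
      = ∫⁻ ω, ∫⁻ w, f (Function.update ω k w) ∂ν ∂(Measure.infinitePi fun _ : ℤ => ν) := by
  conv_lhs => rw [← (measurePreserving_update ν k).map_eq, lintegral_map hf measurable_update']
  rw [lintegral_prod]
  exact (hf.comp measurable_update').aemeasurable

namespace ScaleCode

variable {X F : Type*} [MetricSpace X] [MeasurableSpace X] [Fintype F] [Nonempty F]
  [MeasurableSpace F] [MeasurableSingletonClass F] {c : X → X → ℝ≥0∞} (S : ScaleCode X F c)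

variable (F) in
/-- The sample space: independent proposals at every level. -/
abbrev Seeds := ℤ → ℕ → F × ℝ

variable (F) in
/-- The law of the seeds. -/
def seeds : Measure (Seeds F) := Measure.infinitePi fun _ => trialsMeasure F

instance : IsProbabilityMeasure (seeds F) := by unfold seeds; infer_instance

/-- The reference symbol at level `j`. -/
def Z (j : ℤ) (ω : Seeds F) : F := pick (S.N j S.x0) (ω j)

lemma N_Z_ne_zero (j : ℤ) (ω : Seeds F) : S.N j S.x0 (S.Z j ω) ≠ 0 :=
  pick_ne_zero (exists_ne_zero_of_sum_eq_one (S.sum_N j S.x0)) _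

/-- The history that uses reference symbols above level `K`. -/
def start (K : ℤ) (ω : Seeds F) (j : ℤ) : F :=
  if K < j then S.Z j ω else Classical.arbitrary F

/-- The history obtained from the reference history above `K` by picking `i` further symbols
according to the predictive distributions of `P`. -/
def hist (P : Measure X) (K : ℤ) : ℕ → Seeds F → ℤ → F
  | 0, ω => S.start K ω
  | i + 1, ω => Function.update (hist P K i ω) (K - i)
      (pick (S.pred P (K - i) (hist P K i ω)) (ω (K - i)))

lemma measurable_Z (j : ℤ) : Measurable (S.Z j) :=
  (measurable_pick_right _).comp (measurable_pi_apply j)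

lemma measurable_start (K : ℤ) : Measurable (S.start K) := by
  refine measurable_pi_lambda _ fun j => ?_
  unfold start
  split_ifs
  · exact S.measurable_Z j
  · exact measurable_const

lemma measurable_hist (P : Measure X) [SFinite P] (K : ℤ) (i : ℕ) :
    Measurable (S.hist P K i) := by
  induction i with
  | zero => exact S.measurable_start K
  | succ i ih =>
    have h1 : Measurable fun ω : Seeds F =>
        (S.pred P (K - i) (S.hist P K i ω), ω (K - i)) :=
      ((S.measurable_pred P (K - i)).comp ih).prodMk (measurable_pi_apply _)
    exact measurable_update'.comp (ih.prodMk (measurable_pick.comp h1))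

lemma start_update {K k : ℤ} (hk : k ≤ K) (ω : Seeds F) (w : ℕ → F × ℝ) :
    S.start K (Function.update ω k w) = S.start K ω := by
  ext j
  unfold start Z
  split_ifs with h
  · rw [Function.update_of_ne (by omega)]
  · rfl

lemma hist_update (P : Measure X) {K k : ℤ} {i : ℕ} (hk : k ≤ K - i) (ω : Seeds F)
    (w : ℕ → F × ℝ) : S.hist P K i (Function.update ω k w) = S.hist P K i ω := by
  induction i with
  | zero => exact S.start_update (by simpa using hk) ω w
  | succ i ih =>
    push_cast at hk
    rw [hist, hist, ih (by omega), Function.update_of_ne (by omega)]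

/-- The mass of the points that `P` gives to the points indistinguishable from the base point
above level `K`. -/
def mass (P : Measure X) (K : ℤ) : ℝ≥0∞ := P {x | ∀ j > K, S.N j x = S.N j S.x0}

lemma measurableSet_mass (K : ℤ) : MeasurableSet {x | ∀ j > K, S.N j x = S.N j S.x0} := by
  have : {x | ∀ j > K, S.N j x = S.N j S.x0}
      = ⋂ j : ℤ, ⋂ (_ : j > K), ⋂ z, {x | S.N j x z = S.N j S.x0 z} := by
    ext x
    simp [funext_iff]
  rw [this]
  exact MeasurableSet.iInter fun j => MeasurableSet.iInter fun _ => MeasurableSet.iInter fun z =>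
    S.measurable_N j z (measurableSet_singleton _)

lemma N_start_ne_zero (K : ℤ) (ω : Seeds F) {j : ℤ} (hj : j > K) :
    S.N j S.x0 (S.start K ω j) ≠ 0 := by
  rw [start, if_pos hj]
  exact S.N_Z_ne_zero j ω

lemma mass_le_M (P : Measure X) (K : ℤ) (ω : Seeds F) :
    S.mass P K ≤ S.M P K (S.start K ω) := by
  rw [mass, M, ← lintegral_indicator_one (S.measurableSet_mass K)]
  refine lintegral_mono fun x => Set.indicator_le' (fun x hx => ?_) (fun _ _ => zero_le) x
  rw [S.W_eq_one (fun j hj => S.N_start_ne_zero K ω hj) hx]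
  rfl

lemma M_start_le (P : Measure X) [IsProbabilityMeasure P] (K : ℤ) (ω : Seeds F) :
    S.M P K (S.start K ω) ≤ S.bound := by
  refine (lintegral_mono fun x => S.W_le_bound (fun j hj => S.N_start_ne_zero K ω hj) x).trans ?_
  simp

lemma M_hist {P : Measure X} [IsProbabilityMeasure P] {K : ℤ} (hm : S.mass P K ≠ 0) (i : ℕ)
    (ω : Seeds F) : S.M P (K - i) (S.hist P K i ω) ≠ 0 ∧ S.M P (K - i) (S.hist P K i ω) ≠ ∞ := by
  induction i with
  | zero =>
    simp only [Nat.cast_zero, sub_zero, hist]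
    exact ⟨fun h => hm (le_antisymm (h ▸ S.mass_le_M P K ω) zero_le),
      ne_top_of_le_ne_top S.bound_ne_top (S.M_start_le P K ω)⟩
  | succ i ih =>
    have : K - ((i + 1 : ℕ) : ℤ) = K - i - 1 := by push_cast; ring
    rw [this, hist]
    refine ⟨S.M_update_ne_zero ?_, S.M_update_ne_top _ ih.2⟩
    exact pick_ne_zero (exists_ne_zero_of_sum_eq_one (S.sum_pred ih.1 ih.2)) _

lemma lintegral_pick {π : F → ℝ≥0∞} (hπ : ∑ z, π z = 1) (G : F → ℝ≥0∞) :
    ∫⁻ w, G (pick π w) ∂(trialsMeasure F) = ∑ z, π z * G z := by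
  rw [← lintegral_map (f := G) (measurable_of_finite _) (measurable_pick_right π), lintegral_fintype]
  refine Finset.sum_congr rfl fun z _ => ?_
  rw [Measure.map_apply (measurable_pick_right π) (measurableSet_singleton z), mul_comm]
  congr 1
  exact trialsMeasure_pick hπ z

lemma lintegral_hist_succ {P : Measure X} [IsProbabilityMeasure P] {K : ℤ}
    (hm : S.mass P K ≠ 0) (i : ℕ) {G : (ℤ → F) → ℝ≥0∞} (hG : Measurable G) :
    ∫⁻ ω, G (S.hist P K (i + 1) ω) ∂(seeds F)
      = ∫⁻ ω, ∑ z, S.pred P (K - i) (S.hist P K i ω) z *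
          G (Function.update (S.hist P K i ω) (K - i) z) ∂(seeds F) := by
  have h := lintegral_resample (trialsMeasure F) (K - i)
    (f := fun ω => G (S.hist P K (i + 1) ω)) (hG.comp (S.measurable_hist P K (i + 1)))
  refine h.trans (lintegral_congr fun ω => ?_)
  simp only [hist]
  simp_rw [S.hist_update P le_rfl, Function.update_self]
  obtain ⟨h0, h1⟩ := S.M_hist hm i ω
  exact lintegral_pick (S.sum_pred h0 h1)
    (fun z => G (Function.update (S.hist P K i ω) (K - i) z))

lemma measure_split_le {P Q : Measure X} [IsProbabilityMeasure P] [IsProbabilityMeasure Q] {K : ℤ}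
    (hP : S.mass P K ≠ 0) (hQ : S.mass Q K ≠ 0) (i : ℕ) :
    seeds F {ω | S.hist P K i ω = S.hist Q K i ω ∧ S.hist P K (i + 1) ω ≠ S.hist Q K (i + 1) ω}
      ≤ ∫⁻ ω in {ω | S.hist P K i ω = S.hist Q K i ω},
          ∑ z, absDiff (S.pred P (K - i) (S.hist P K i ω) z)
            (S.pred Q (K - i) (S.hist P K i ω) z) ∂(seeds F) := by
  have hE : ∀ i, MeasurableSet {ω | S.hist P K i ω = S.hist Q K i ω} := fun i => by
    have : {ω | S.hist P K i ω = S.hist Q K i ω}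
        = ⋂ j, {ω | S.hist P K i ω j = S.hist Q K i ω j} := by
      ext ω; simp [funext_iff]
    rw [this]
    exact MeasurableSet.iInter fun j => measurableSet_eq_fun
      ((measurable_pi_apply j).comp (S.measurable_hist P K i))
      ((measurable_pi_apply j).comp (S.measurable_hist Q K i))
  have hE' : MeasurableSet {ω | S.hist P K i ω = S.hist Q K i ω ∧
      S.hist P K (i + 1) ω ≠ S.hist Q K (i + 1) ω} := (hE i).inter (hE (i + 1)).compl
  rw [← lintegral_indicator_one hE', seeds, lintegral_resample _ (K - i)
    (measurable_one.indicator hE'), ← lintegral_indicator (hE i)]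
  refine lintegral_mono fun ω => ?_
  by_cases h : S.hist P K i ω = S.hist Q K i ω
  · rw [Set.indicator_of_mem (show ω ∈ {ω | S.hist P K i ω = S.hist Q K i ω} from h)]
    have h1 := S.M_hist hP i ω
    have h2 := S.M_hist hQ i ω
    rw [← h] at h2
    refine le_trans ?_ (trialsMeasure_pick_ne (S.sum_pred h1.1 h1.2) (S.sum_pred h2.1 h2.2))
    rw [← lintegral_indicator_one]
    · refine lintegral_mono fun w => ?_
      by_cases hw : pick (S.pred P (K - i) (S.hist P K i ω)) w
          = pick (S.pred Q (K - i) (S.hist P K i ω)) w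
      · rw [Set.indicator_of_notMem]
        · exact zero_le
        · simp [hist, S.hist_update P le_rfl, S.hist_update Q le_rfl, ← h, hw]
      · refine (Set.indicator_le_self _ _ _).trans (le_of_eq ?_)
        rw [Set.indicator_of_mem]
        · rfl
        · exact hw
    · exact (measurableSet_eq_fun (measurable_pick_right _) (measurable_pick_right _)).compl
  · rw [Set.indicator_of_notMem (show ω ∉ {ω | S.hist P K i ω = S.hist Q K i ω} from h)]
    refine le_of_eq ?_
    rw [← lintegral_zero (μ := trialsMeasure F)]
    refine lintegral_congr fun w => ?_
    rw [Set.indicator_of_notMem]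
    simp [S.hist_update P le_rfl, S.hist_update Q le_rfl, h]

end ScaleCode

lemma absDiff_comm (a b : ℝ≥0∞) : absDiff a b = absDiff b a := add_comm _ _

lemma absDiff_self (a : ℝ≥0∞) : absDiff a a = 0 := by simp [absDiff]

lemma absDiff_triangle (a b c : ℝ≥0∞) : absDiff a c ≤ absDiff a b + absDiff b c := by
  unfold absDiff
  calc (a - c) + (c - a) ≤ ((a - b) + (b - c)) + ((c - b) + (b - a)) :=
        add_le_add (tsub_le_tsub_add_tsub) (tsub_le_tsub_add_tsub)
    _ = _ := by ring

lemma mul_tsub_le' (a b c : ℝ≥0∞) : a * b - a * c ≤ a * (b - c) := by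
  rw [tsub_le_iff_left, ← mul_add]
  gcongr
  exact le_add_tsub

lemma absDiff_mul_left_le (a b c : ℝ≥0∞) : absDiff (a * b) (a * c) ≤ a * absDiff b c := by
  unfold absDiff
  rw [mul_add]
  exact add_le_add (mul_tsub_le' _ _ _) (mul_tsub_le' _ _ _)

lemma absDiff_mul_le (a b a' b' : ℝ≥0∞) :
    absDiff (a * b) (a' * b') ≤ a * absDiff b b' + b' * absDiff a a' := by
  refine (absDiff_triangle _ (a * b') _).trans (add_le_add (absDiff_mul_left_le _ _ _) ?_)
  rw [mul_comm a b', mul_comm a' b']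
  exact absDiff_mul_left_le _ _ _

lemma absDiff_le_add (a b : ℝ≥0∞) : absDiff a b ≤ a + b :=
  add_le_add tsub_le_self tsub_le_self

lemma Measurable.absDiff {α : Type*} [MeasurableSpace α] {f g : α → ℝ≥0∞} (hf : Measurable f)
    (hg : Measurable g) : Measurable fun x => absDiff (f x) (g x) :=
  (hf.sub hg).add (hg.sub hf)

lemma absDiff_lintegral_le {α : Type*} [MeasurableSpace α] {μ : Measure α} {f g : α → ℝ≥0∞}
    (hf : Measurable f) (hg : Measurable g) :
    absDiff (∫⁻ x, f x ∂μ) (∫⁻ x, g x ∂μ) ≤ ∫⁻ x, absDiff (f x) (g x) ∂μ := by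
  unfold absDiff
  rw [lintegral_add_left (hf.fun_sub hg)]
  exact add_le_add (lintegral_sub_le _ _ hg) (lintegral_sub_le _ _ hf)

/-- Comparison of normalized with unnormalized weights. -/
lemma mul_sum_absDiff_div_le {F : Type*} [Fintype F] {p p' : F → ℝ≥0∞} {m m' : ℝ≥0∞}
    (hp' : ∑ z, p' z = m') (hm : m ≠ ∞) (hm' : m' ≠ ∞) (hle : m ≤ m') :
    m * ∑ z, absDiff (p z / m) (p' z / m') ≤ ∑ z, absDiff (p z) (p' z) + absDiff m m' := by
  rcases eq_or_ne m 0 with h0 | h0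
  · simp [h0]
  have h0' : m' ≠ 0 := fun h => h0 (le_antisymm (h ▸ hle) zero_le)
  have hmul : m / m' ≤ 1 := ENNReal.div_le_of_le_mul (by simpa using hle)
  have hterm : ∀ z, m * absDiff (p z / m) (p' z / m') ≤
      absDiff (p z) (p' z) + (p' z - m / m' * p' z) := by
    intro z
    have e1 : m * (p z / m) = p z := ENNReal.mul_div_cancel h0 hm
    have e2 : m * (p' z / m') = m / m' * p' z := by
      simp only [div_eq_mul_inv]; ring
    have h1 : m * (p z / m - p' z / m') = p z - m / m' * p' z := by
      rw [ENNReal.mul_sub (fun _ _ => hm), e1, e2]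
    have h2 : m * (p' z / m' - p z / m) = m / m' * p' z - p z := by
      rw [ENNReal.mul_sub (fun _ _ => hm), e1, e2]
    rw [absDiff, mul_add, h1, h2, absDiff]
    have hle1 : m / m' * p' z ≤ p' z := (mul_le_mul_left hmul _).trans_eq (one_mul _)
    calc _ ≤ ((p z - p' z) + (p' z - m / m' * p' z)) + (p' z - p z) :=
          add_le_add tsub_le_tsub_add_tsub (tsub_le_tsub_right hle1 _)
      _ = _ := by ring
  have hsum : ∑ z, (p' z - m / m' * p' z) = m' - m := by
    have : ∑ z, (p' z - m / m' * p' z) + m = m' := by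
      have hm2 : m = ∑ z, m / m' * p' z := by
        rw [← Finset.mul_sum, hp', ENNReal.div_mul_cancel h0' hm']
      conv_lhs => rw [hm2]
      rw [← Finset.sum_add_distrib, ← hp']
      refine Finset.sum_congr rfl fun z _ => ?_
      rw [hp', ← hm2]
      exact tsub_add_cancel_of_le ((mul_le_mul_left hmul _).trans_eq (one_mul _))
    exact ENNReal.eq_sub_of_add_eq hm this
  rw [Finset.mul_sum]
  refine (Finset.sum_le_sum fun z _ => hterm z).trans ?_
  rw [Finset.sum_add_distrib, hsum]
  exact add_le_add le_rfl le_add_self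

namespace ScaleCode

variable {X F : Type*} [MetricSpace X] [MeasurableSpace X] [Fintype F] [Nonempty F]
  [MeasurableSpace F] [MeasurableSingletonClass F] {c : X → X → ℝ≥0∞} (S : ScaleCode X F c)

/-- The reference measure on histories down to level `K - i`, against which the likelihoods are
densities. -/
def ref (K : ℤ) : ℕ → Measure (ℤ → F)
  | 0 => (seeds F).map (S.start K)
  | i + 1 => ∑ z, S.b (K - i) z • (ref K i).map fun y => Function.update y (K - i) z

instance (K : ℤ) (i : ℕ) : IsFiniteMeasure (S.ref K i) := by
  induction i with
  | zero =>
    rw [ref]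
    infer_instance
  | succ i ih =>
    rw [ref]
    refine ⟨?_⟩
    rw [Measure.finsetSum_apply]
    refine ENNReal.sum_lt_top.2 fun z _ => ?_
    rw [Measure.smul_apply, smul_eq_mul]
    exact ENNReal.mul_lt_top (S.b_ne_top _ _).lt_top (measure_lt_top _ _)

lemma lintegral_ref_zero (K : ℤ) {G : (ℤ → F) → ℝ≥0∞} (hG : Measurable G) :
    ∫⁻ y, G y ∂(S.ref K 0) = ∫⁻ ω, G (S.start K ω) ∂(seeds F) :=
  lintegral_map hG (S.measurable_start K)

lemma lintegral_ref_succ (K : ℤ) (i : ℕ) {G : (ℤ → F) → ℝ≥0∞} (hG : Measurable G) :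
    ∫⁻ y, G y ∂(S.ref K (i + 1))
      = ∫⁻ y, ∑ z, S.b (K - i) z * G (Function.update y (K - i) z) ∂(S.ref K i) := by
  have hm : ∀ z, Measurable fun y : ℤ → F => G (Function.update y (K - i) z) := fun z =>
    hG.comp measurable_update_left
  rw [ref, lintegral_finsetSum_measure, lintegral_finsetSum _ fun z _ => (hm z).const_mul _]
  refine Finset.sum_congr rfl fun z _ => ?_
  rw [lintegral_smul_measure, lintegral_map hG measurable_update_left,
    lintegral_const_mul _ (hm z), smul_eq_mul]

lemma ref_le (K : ℤ) (i : ℕ) {G : (ℤ → F) → ℝ≥0∞} (hG : Measurable G) :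
    ∫⁻ y, G y ∂(S.ref K i) ≤ ∫⁻ y, G y ∂(S.ref (K + 1) (i + 1)) := by
  induction i generalizing G with
  | zero =>
    have hT : Measurable fun y : ℤ → F =>
        ∑ z, S.b (K + 1 - (0 : ℕ)) z * G (Function.update y (K + 1 - (0 : ℕ)) z) :=
      Finset.measurable_sum _ fun z _ => (hG.comp measurable_update_left).const_mul _
    rw [S.lintegral_ref_succ _ _ hG, S.lintegral_ref_zero _ hG, S.lintegral_ref_zero _ hT]
    simp only [Nat.cast_zero, sub_zero]
    have h := lintegral_resample (trialsMeasure F) (K + 1)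
      (f := fun ω => G (S.start K ω)) (hG.comp (S.measurable_start K))
    refine h.trans_le (lintegral_mono fun ω => ?_)
    have hst : ∀ w, S.start K (Function.update ω (K + 1) w)
        = Function.update (S.start (K + 1) ω) (K + 1) (pick (S.N (K + 1) S.x0) w) := by
      intro w
      ext j
      rcases eq_or_ne j (K + 1) with rfl | hj
      · simp [start, Z]
      · rw [Function.update_of_ne hj, start, start, Z, Z, Function.update_of_ne hj]
        have : K < j ↔ K + 1 < j := by omega
        simp only [this]
    simp_rw [hst]
    rw [lintegral_pick (S.sum_N _ _)
      (fun z => G (Function.update (S.start (K + 1) ω) (K + 1) z))]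
    exact Finset.sum_le_sum fun z _ => mul_le_mul_left (S.N_le_b _ _) _
  | succ i ih =>
    rw [S.lintegral_ref_succ _ _ hG, S.lintegral_ref_succ _ _ hG]
    have e : K + 1 - ((i + 1 : ℕ) : ℤ) = K - i := by push_cast; ring
    rw [e]
    exact ih (Finset.measurable_sum _ fun z _ => (hG.comp measurable_update_left).const_mul _)

lemma ref_le_add (K : ℤ) (i m : ℕ) {G : (ℤ → F) → ℝ≥0∞} (hG : Measurable G) :
    ∫⁻ y, G y ∂(S.ref K i) ≤ ∫⁻ y, G y ∂(S.ref (K + m) (i + m)) := by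
  induction m with
  | zero => simp
  | succ m ih =>
    refine ih.trans ((S.ref_le _ _ hG).trans_eq ?_)
    rw [show K + m + 1 = K + ((m + 1 : ℕ) : ℤ) by push_cast; ring, ← add_assoc]

lemma lintegral_hist_le {P : Measure X} [IsProbabilityMeasure P] {K : ℤ}
    (hm : S.mass P K ≠ 0) (i : ℕ) {G : (ℤ → F) → ℝ≥0∞} (hG : Measurable G) :
    ∫⁻ ω, G (S.hist P K i ω) ∂(seeds F)
      ≤ (S.mass P K)⁻¹ * ∫⁻ y, S.M P (K - i) y * G y ∂(S.ref K i) := by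
  have hmt : S.mass P K ≠ ∞ := measure_ne_top _ _
  induction i generalizing G with
  | zero =>
    rw [S.lintegral_ref_zero _ ((S.measurable_M P _).fun_mul hG), ← lintegral_const_mul]
    · refine lintegral_mono fun ω => ?_
      simp only [Nat.cast_zero, sub_zero, hist]
      calc G (S.start K ω) = (S.mass P K)⁻¹ * S.mass P K * G (S.start K ω) := by
            rw [ENNReal.inv_mul_cancel hm hmt, one_mul]
        _ ≤ (S.mass P K)⁻¹ * S.M P K (S.start K ω) * G (S.start K ω) := by
            gcongr
            exact S.mass_le_M P K ω
        _ = _ := mul_assoc _ _ _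
    · exact ((S.measurable_M P _).fun_mul hG).comp (S.measurable_start K)
  | succ i ih =>
    have hG' : Measurable fun y => ∑ z, S.pred P (K - i) y z * G (Function.update y (K - i) z) :=
      Finset.measurable_sum _ fun z _ =>
        ((measurable_pi_apply z).comp (S.measurable_pred P _)).mul (hG.comp measurable_update_left)
    rw [S.lintegral_hist_succ hm i hG]
    refine (ih hG').trans (mul_le_mul_right ?_ _)
    rw [S.lintegral_ref_succ _ _ ((S.measurable_M P _).fun_mul hG)]
    refine lintegral_mono fun y => ?_
    have e : K - ((i + 1 : ℕ) : ℤ) = K - i - 1 := by push_cast; ring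
    rw [Finset.mul_sum, e]
    refine Finset.sum_le_sum fun z _ => ?_
    rw [← mul_assoc, ← mul_assoc, pred]
    exact mul_le_mul_left ENNReal.mul_div_le _

lemma measurableSet_agree (P Q : Measure X) [SFinite P] [SFinite Q] (K : ℤ) (i : ℕ) :
    MeasurableSet {ω | S.hist P K i ω = S.hist Q K i ω} := by
  have : {ω | S.hist P K i ω = S.hist Q K i ω}
      = ⋂ j, {ω | S.hist P K i ω j = S.hist Q K i ω j} := by
    ext ω; simp [funext_iff]
  rw [this]
  exact MeasurableSet.iInter fun j => measurableSet_eq_fun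
    ((measurable_pi_apply j).comp (S.measurable_hist P K i))
    ((measurable_pi_apply j).comp (S.measurable_hist Q K i))

/-- The normalization factor that both initial masses are compared with. -/
def factor (P Q : Measure X) (K : ℤ) : ℝ≥0∞ := max (S.mass P K)⁻¹ (S.mass Q K)⁻¹

lemma lintegral_agree_le {P Q : Measure X} [IsProbabilityMeasure P] [IsProbabilityMeasure Q]
    {K : ℤ} (hP : S.mass P K ≠ 0) (hQ : S.mass Q K ≠ 0) (i : ℕ) {G : (ℤ → F) → ℝ≥0∞}
    (hG : Measurable G) :
    ∫⁻ ω in {ω | S.hist P K i ω = S.hist Q K i ω}, G (S.hist P K i ω) ∂(seeds F)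
      ≤ S.factor P Q K *
        ∫⁻ y, min (S.M P (K - i) y) (S.M Q (K - i) y) * G y ∂(S.ref K i) := by
  set A : Set (ℤ → F) := {y | S.M P (K - i) y ≤ S.M Q (K - i) y} with hA
  have hAm : MeasurableSet A := measurableSet_le (S.measurable_M P _) (S.measurable_M Q _)
  have h1 := S.lintegral_hist_le hP i (hG.indicator hAm)
  have h2 := S.lintegral_hist_le hQ i (hG.indicator hAm.compl)
  calc _ ≤ ∫⁻ ω, (A.indicator G (S.hist P K i ω) + Aᶜ.indicator G (S.hist Q K i ω)) ∂(seeds F) := by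
        rw [← lintegral_indicator (S.measurableSet_agree P Q K i)]
        refine lintegral_mono fun ω => ?_
        refine Set.indicator_le' (f := fun ω => G (S.hist P K i ω)) (g := fun ω =>
          A.indicator G (S.hist P K i ω) + Aᶜ.indicator G (S.hist Q K i ω)) (fun ω hω => ?_)
          (fun _ _ => zero_le) ω
        have hω' : S.hist P K i ω = S.hist Q K i ω := hω
        simp only [← hω']
        by_cases h : S.hist P K i ω ∈ A <;> simp [h]
    _ ≤ S.factor P Q K * ∫⁻ y, S.M P (K - i) y * A.indicator G y ∂(S.ref K i) +
        S.factor P Q K * ∫⁻ y, S.M Q (K - i) y * Aᶜ.indicator G y ∂(S.ref K i) := by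
        rw [lintegral_add_left ((hG.indicator hAm).fun_comp (S.measurable_hist P K i))]
        refine add_le_add (h1.trans (mul_le_mul_left (le_max_left _ _) _))
          (h2.trans (mul_le_mul_left (le_max_right _ _) _))
    _ = _ := by
        rw [← mul_add, ← lintegral_add_left ((S.measurable_M P _).fun_mul (hG.indicator hAm))]
        congr 1
        refine lintegral_congr fun y => ?_
        by_cases h : y ∈ A
        · have h' : S.M P (K - i) y ≤ S.M Q (K - i) y := h
          simp [h, min_eq_left h']
        · have h' : S.M Q (K - i) y ≤ S.M P (K - i) y := (lt_of_not_ge h).le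
          simp [h, min_eq_right h']

end ScaleCode

namespace ScaleCode

variable {X F : Type*} [MetricSpace X] [MeasurableSpace X] [Fintype F] [Nonempty F]
  [MeasurableSpace F] [MeasurableSingletonClass F] {c : X → X → ℝ≥0∞} (S : ScaleCode X F c)

/-- The distance of the symbol distributions of two points at level `k`. -/
def gap (k : ℤ) (x x' : X) : ℝ≥0∞ := ∑ z, absDiff (S.N k x z) (S.N k x' z)

/-- A bound for the distance of the symbol distributions at the levels from `k` on. -/
def totalGap (k : ℤ) (x x' : X) : ℝ≥0∞ := min 2 (∑' j : ℕ, S.gap (k + j) x x')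

/-- The distance of the likelihoods of two points under the reference measure. -/
def likeGap (K : ℤ) (i : ℕ) (k : ℤ) (x x' : X) : ℝ≥0∞ :=
  ∫⁻ y, absDiff (S.W k y x) (S.W k y x') ∂(S.ref K i)

lemma lintegral_W_succ (K : ℤ) (i : ℕ) (x : X) :
    ∫⁻ y, S.W (K - (i + 1 : ℕ)) y x ∂(S.ref K (i + 1)) = ∫⁻ y, S.W (K - i) y x ∂(S.ref K i) := by
  have e : K - ((i + 1 : ℕ) : ℤ) = K - i - 1 := by push_cast; ring
  rw [S.lintegral_ref_succ _ _ (S.measurable_W_left _ x), e]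
  refine lintegral_congr fun y => ?_
  simp_rw [b_mul_W_update]
  rw [← Finset.sum_mul, S.sum_N, one_mul]

lemma lintegral_W_le_one (K : ℤ) (i : ℕ) (x : X) :
    ∫⁻ y, S.W (K - i) y x ∂(S.ref K i) ≤ 1 := by
  obtain ⟨J, hJ⟩ := S.exists_base x
  set m : ℕ := (J - K).toNat
  refine (S.ref_le_add K i m (S.measurable_W_left _ x)).trans ?_
  have h : ∀ i : ℕ, ∫⁻ y, S.W (K + m - i) y x ∂(S.ref (K + m) i) = 1 := by
    intro i
    induction i with
    | zero =>
      rw [S.lintegral_ref_zero _ (S.measurable_W_left _ x)]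
      simp only [Nat.cast_zero, sub_zero]
      have : ∀ ω, S.W (K + m) (S.start (K + m) ω) x = 1 := fun ω =>
        S.W_eq_one (fun j hj => S.N_start_ne_zero _ ω hj) fun j hj => hJ j (by omega)
      simp [this]
    | succ i ih => rw [S.lintegral_W_succ, ih]
  have := h (i + m)
  rw [show K + m - ((i + m : ℕ) : ℤ) = K - i by push_cast; ring] at this
  exact this.le

lemma likeGap_succ_le (K : ℤ) (i : ℕ) (x x' : X) :
    S.likeGap K (i + 1) (K - (i + 1 : ℕ)) x x'
      ≤ S.likeGap K i (K - i) x x' + S.gap (K - i) x x' := by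
  have e : K - ((i + 1 : ℕ) : ℤ) = K - i - 1 := by push_cast; ring
  have hm : Measurable fun y => absDiff (S.W (K - i) y x) (S.W (K - i) y x') :=
    (S.measurable_W_left _ x).absDiff (S.measurable_W_left _ x')
  rw [likeGap, S.lintegral_ref_succ _ _
    ((S.measurable_W_left _ x).absDiff (S.measurable_W_left _ x')), e]
  calc _ ≤ ∫⁻ y, (absDiff (S.W (K - i) y x) (S.W (K - i) y x')
          + S.W (K - i) y x' * S.gap (K - i) x x') ∂(S.ref K i) := by
        refine lintegral_mono fun y => ?_
        calc _ ≤ ∑ z, (S.N (K - i) x z * absDiff (S.W (K - i) y x) (S.W (K - i) y x') +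
                S.W (K - i) y x' * absDiff (S.N (K - i) x z) (S.N (K - i) x' z)) := by
              refine Finset.sum_le_sum fun z _ => ?_
              rw [W_update_self, W_update_self]
              refine (mul_le_mul_right (absDiff_mul_le _ _ _ _) _).trans ?_
              rw [mul_add, ← mul_assoc, b_mul_ratio, mul_left_comm]
              refine add_le_add le_rfl (mul_le_mul_right ?_ _)
              rw [← b_mul_ratio, ← b_mul_ratio]
              unfold absDiff
              rw [mul_add, ENNReal.mul_sub fun _ _ => S.b_ne_top _ _,
                ENNReal.mul_sub fun _ _ => S.b_ne_top _ _]
          _ = _ := by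
              rw [Finset.sum_add_distrib, ← Finset.sum_mul, S.sum_N, one_mul, ← Finset.mul_sum]
              rfl
    _ ≤ _ := by
        rw [lintegral_add_left hm, lintegral_mul_const _ (S.measurable_W_left _ x')]
        refine add_le_add le_rfl ((mul_le_mul_left (S.lintegral_W_le_one K i x') _).trans_eq ?_)
        rw [one_mul]

lemma likeGap_le (K : ℤ) (i : ℕ) (x x' : X) :
    S.likeGap K i (K - i) x x'
      ≤ ∑ l ∈ Finset.range i, S.gap (K - l) x x' + S.likeGap K 0 K x x' := by
  induction i with
  | zero => simp
  | succ i ih =>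
    refine (S.likeGap_succ_le K i x x').trans ?_
    rw [Finset.sum_range_succ]
    calc _ ≤ _ := add_le_add ih le_rfl
      _ = _ := by ring

lemma likeGap_le_totalGap (K : ℤ) (i : ℕ) (x x' : X) :
    S.likeGap K i (K - i) x x' ≤ S.totalGap (K - i + 1) x x' := by
  refine le_min ?_ ?_
  · calc _ ≤ ∫⁻ y, (S.W (K - i) y x + S.W (K - i) y x') ∂(S.ref K i) :=
          lintegral_mono fun y => absDiff_le_add _ _
      _ ≤ 1 + 1 := by
          rw [lintegral_add_left (S.measurable_W_left _ x)]
          exact add_le_add (S.lintegral_W_le_one K i x) (S.lintegral_W_le_one K i x')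
      _ = 2 := one_add_one_eq_two
  · obtain ⟨J, hJ⟩ := S.exists_base x
    obtain ⟨J', hJ'⟩ := S.exists_base x'
    set m : ℕ := (max J J' - K).toNat
    have h1 := S.ref_le_add K i m ((S.measurable_W_left (K - i) x).absDiff
      (S.measurable_W_left (K - i) x'))
    have h2 := S.likeGap_le (K + m) (i + m) x x'
    rw [show K + m - ((i + m : ℕ) : ℤ) = K - i by push_cast; ring] at h2
    have h3 : S.likeGap (K + m) 0 (K + m) x x' = 0 := by
      rw [likeGap, S.lintegral_ref_zero _
        ((S.measurable_W_left _ x).absDiff (S.measurable_W_left _ x'))]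
      have h4 : ∀ ω, S.W (K + m) (S.start (K + m) ω) x = 1 := fun ω =>
        S.W_eq_one (fun j hj => S.N_start_ne_zero _ ω hj) fun j hj => hJ j (by omega)
      have h5 : ∀ ω, S.W (K + m) (S.start (K + m) ω) x' = 1 := fun ω =>
        S.W_eq_one (fun j hj => S.N_start_ne_zero _ ω hj) fun j hj => hJ' j (by omega)
      simp [h4, h5, absDiff_self]
    rw [h3, add_zero, ← Finset.sum_range_reflect] at h2
    refine (h1.trans h2).trans ?_
    calc _ = ∑ j ∈ Finset.range (i + m), S.gap (K - i + 1 + j) x x' := by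
          refine Finset.sum_congr rfl fun j hj => ?_
          have := Finset.mem_range.1 hj
          congr 1
          omega
      _ ≤ _ := ENNReal.sum_le_tsum _

lemma lintegral_absDiff_M_le {P Q : Measure X} {γ : Measure (X × X)} [SFinite γ]
    (hP : γ.map Prod.fst = P) (hQ : γ.map Prod.snd = Q) (K : ℤ) (i : ℕ) :
    ∫⁻ y, absDiff (S.M P (K - i) y) (S.M Q (K - i) y) ∂(S.ref K i)
      ≤ ∫⁻ z, S.totalGap (K - i + 1) z.1 z.2 ∂γ := by
  have hM : ∀ y, S.M P (K - i) y = ∫⁻ z, S.W (K - i) y z.1 ∂γ := fun y => by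
    rw [M, ← hP, lintegral_map (S.measurable_W_right _ _) measurable_fst]
  have hM' : ∀ y, S.M Q (K - i) y = ∫⁻ z, S.W (K - i) y z.2 ∂γ := fun y => by
    rw [M, ← hQ, lintegral_map (S.measurable_W_right _ _) measurable_snd]
  simp_rw [hM, hM']
  calc _ ≤ ∫⁻ y, ∫⁻ z, absDiff (S.W (K - i) y z.1) (S.W (K - i) y z.2) ∂γ ∂(S.ref K i) :=
        lintegral_mono fun y => absDiff_lintegral_le
          ((S.measurable_W_right _ _).comp measurable_fst)
          ((S.measurable_W_right _ _).comp measurable_snd)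
    _ = ∫⁻ z, S.likeGap K i (K - i) z.1 z.2 ∂γ := by
        rw [lintegral_lintegral_swap]
        · rfl
        · have h1 : Measurable fun p : (ℤ → F) × X × X => S.W (K - i) p.1 p.2.1 :=
            (S.measurable_W _).comp (f := fun p : (ℤ → F) × X × X => (p.1, p.2.1)) (by fun_prop)
          have h2 : Measurable fun p : (ℤ → F) × X × X => S.W (K - i) p.1 p.2.2 :=
            (S.measurable_W _).comp (f := fun p : (ℤ → F) × X × X => (p.1, p.2.2)) (by fun_prop)
          exact (h1.absDiff h2).aemeasurable
    _ ≤ _ := lintegral_mono fun z => S.likeGap_le_totalGap K i _ _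

lemma ae_M_ne_top (P : Measure X) [IsProbabilityMeasure P] (K : ℤ) (i : ℕ) :
    ∀ᵐ y ∂(S.ref K i), S.M P (K - i) y ≠ ∞ := by
  have : ∫⁻ y, S.M P (K - i) y ∂(S.ref K i) ≠ ∞ := by
    refine ne_top_of_le_ne_top one_ne_top ?_
    unfold M
    rw [lintegral_lintegral_swap (S.measurable_W _).aemeasurable]
    refine (lintegral_mono fun x => S.lintegral_W_le_one K i x).trans ?_
    simp
  filter_upwards [ae_lt_top (S.measurable_M P _) this] with y hy using hy.ne

lemma min_mul_sum_absDiff_pred_le {P Q : Measure X} {k : ℤ} {y : ℤ → F}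
    (hP : S.M P k y ≠ ∞) (hQ : S.M Q k y ≠ ∞) :
    min (S.M P k y) (S.M Q k y) * ∑ z, absDiff (S.pred P k y z) (S.pred Q k y z)
      ≤ ∑ z, S.b k z * absDiff (S.M P (k - 1) (Function.update y k z))
          (S.M Q (k - 1) (Function.update y k z)) + absDiff (S.M P k y) (S.M Q k y) := by
  wlog hle : S.M P k y ≤ S.M Q k y generalizing P Q
  · have h := this hQ hP (le_of_not_ge hle)
    simp_rw [absDiff_comm (S.M Q _ _), absDiff_comm (S.pred Q _ _ _)] at h
    rwa [min_comm]
  rw [min_eq_left hle]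
  refine (mul_sum_absDiff_div_le (S.sum_b_mul_M Q k y) hP hQ hle).trans ?_
  exact add_le_add (Finset.sum_le_sum fun z _ => absDiff_mul_left_le _ _ _) le_rfl

lemma measure_split_le_totalGap {P Q : Measure X} [IsProbabilityMeasure P]
    [IsProbabilityMeasure Q] {γ : Measure (X × X)} [SFinite γ]
    (hP : γ.map Prod.fst = P) (hQ : γ.map Prod.snd = Q) {K : ℤ}
    (hPm : S.mass P K ≠ 0) (hQm : S.mass Q K ≠ 0) (i : ℕ) :
    seeds F {ω | S.hist P K i ω = S.hist Q K i ω ∧ S.hist P K (i + 1) ω ≠ S.hist Q K (i + 1) ω}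
      ≤ S.factor P Q K * (∫⁻ z, S.totalGap (K - i) z.1 z.2 ∂γ +
          ∫⁻ z, S.totalGap (K - i + 1) z.1 z.2 ∂γ) := by
  have hG : Measurable fun y => ∑ z, absDiff (S.pred P (K - i) y z) (S.pred Q (K - i) y z) :=
    Finset.measurable_sum _ fun z _ => ((measurable_pi_apply z).comp (S.measurable_pred P _)).absDiff
      ((measurable_pi_apply z).comp (S.measurable_pred Q _))
  refine (S.measure_split_le hPm hQm i).trans
    ((S.lintegral_agree_le hPm hQm i hG).trans (mul_le_mul_right ?_ _))
  have hA : Measurable fun y => absDiff (S.M P (K - (i + 1 : ℕ)) y) (S.M Q (K - (i + 1 : ℕ)) y) :=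
    (S.measurable_M P _).absDiff (S.measurable_M Q _)
  have hB : Measurable fun y => absDiff (S.M P (K - i) y) (S.M Q (K - i) y) :=
    (S.measurable_M P _).absDiff (S.measurable_M Q _)
  have h1 := S.lintegral_absDiff_M_le hP hQ K (i + 1)
  have h2 := S.lintegral_absDiff_M_le hP hQ K i
  rw [S.lintegral_ref_succ _ _ hA] at h1
  have e : K - ((i + 1 : ℕ) : ℤ) = K - i - 1 := by push_cast; ring
  rw [e, sub_add_cancel] at h1
  refine le_trans ?_ (add_le_add h1 h2)
  rw [← lintegral_add_right _ hB]
  refine lintegral_mono_ae ?_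
  filter_upwards [S.ae_M_ne_top P K i, S.ae_M_ne_top Q K i] with y h3 h4
  exact S.min_mul_sum_absDiff_pred_le h3 h4

end ScaleCode

namespace ScaleCode

variable {X F : Type*} [MetricSpace X] [MeasurableSpace X] [Fintype F] [Nonempty F]
  [MeasurableSpace F] [MeasurableSingletonClass F] {c : X → X → ℝ≥0∞} (S : ScaleCode X F c)

lemma gap_le_two (k : ℤ) (x x' : X) : S.gap k x x' ≤ 2 := by
  calc _ ≤ ∑ z, (S.N k x z + S.N k x' z) := Finset.sum_le_sum fun z _ => absDiff_le_add _ _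
    _ = 2 := by rw [Finset.sum_add_distrib, S.sum_N, S.sum_N, one_add_one_eq_two]

/-- The points that level `k` distinguishes from the base point while the levels above `k + c0`
do not. -/
def lastLevel (k : ℤ) : Set X :=
  {x | S.N k x ≠ S.N k S.x0 ∧ ∀ j > k + S.c0, S.N j x = S.N j S.x0}

lemma measurableSet_lastLevel (k : ℤ) : MeasurableSet (S.lastLevel k) := by
  have h : {x | S.N k x ≠ S.N k S.x0} = (⋂ z, {x | S.N k x z = S.N k S.x0 z})ᶜ := by
    ext x
    simp [funext_iff]
  refine MeasurableSet.inter ?_ (S.measurableSet_mass _)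
  change MeasurableSet {x | S.N k x ≠ S.N k S.x0}
  rw [h]
  exact (MeasurableSet.iInter fun z => S.measurable_N k z (measurableSet_singleton _)).compl

lemma tsum_lastLevel_le (P : Measure X) [IsProbabilityMeasure P] :
    ∑' k : ℕ, P (S.lastLevel k) ≤ S.c0 + 1 := by
  classical
  have : ∀ k : ℕ, P (S.lastLevel k) = ∫⁻ x, (S.lastLevel k).indicator 1 x ∂P := fun k => by
    rw [lintegral_indicator_one (S.measurableSet_lastLevel k)]
  simp_rw [this]
  rw [← lintegral_tsum (f := fun k : ℕ => (S.lastLevel k).indicator (1 : X → ℝ≥0∞))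
    fun k => (measurable_one.indicator (S.measurableSet_lastLevel k)).aemeasurable]
  have hle : ∀ x, ∑' k : ℕ, (S.lastLevel k).indicator (1 : X → ℝ≥0∞) x ≤ S.c0 + 1 := by
    intro x
    by_cases h : ∃ k : ℕ, x ∈ S.lastLevel k
    · have h0 : ∀ k ∉ Finset.Icc (Nat.find h) (Nat.find h + S.c0),
          (S.lastLevel k).indicator (1 : X → ℝ≥0∞) x = 0 := by
        intro k hk
        refine Set.indicator_of_notMem (fun hx => hk ?_) _
        rw [Finset.mem_Icc]
        refine ⟨Nat.find_min' h hx, ?_⟩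
        by_contra hlt
        exact hx.1 ((Nat.find_spec h).2 k (by omega))
      rw [tsum_eq_sum h0]
      refine (Finset.sum_le_sum (g := fun _ => (1 : ℝ≥0∞)) fun (k : ℕ) _ =>
        Set.indicator_le_self (S.lastLevel k) 1 x).trans (le_of_eq ?_)
      have : Nat.find h + S.c0 + 1 - Nat.find h = S.c0 + 1 := by omega
      rw [Finset.sum_const, Nat.card_Icc, this]
      simp
    · have h0 : ∀ k : ℕ, (S.lastLevel k).indicator (1 : X → ℝ≥0∞) x = 0 := fun k =>
        Set.indicator_of_notMem (fun hx => h ⟨k, hx⟩) _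
      simp [h0]
  calc _ ≤ ∫⁻ _, ((S.c0 : ℝ≥0∞) + 1) ∂P := lintegral_mono hle
    _ = _ := by simp

lemma hist_succ_eq {P : Measure X} {K : ℤ} {ω : Seeds F}
    (h : pick (S.pred P (K + 1) (S.start (K + 1) ω)) (ω (K + 1)) = S.Z (K + 1) ω) (i : ℕ) :
    S.hist P (K + 1) (i + 1) ω = S.hist P K i ω := by
  induction i with
  | zero =>
    simp only [hist, Nat.cast_zero, sub_zero]
    rw [h]
    ext j
    rcases eq_or_ne j (K + 1) with rfl | hj
    · simp [start]
    · rw [Function.update_of_ne hj, start, start]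
      have : K + 1 < j ↔ K < j := by omega
      simp only [this]
  | succ i ih =>
    have e : K + 1 - ((i + 1 : ℕ) : ℤ) = K - i := by push_cast; ring
    rw [hist, ih, e]
    rfl

lemma sum_absDiff_pred_start_le (P : Measure X) [IsProbabilityMeasure P] {K : ℤ}
    (hm : S.mass P K ≠ 0) (ω : Seeds F) :
    ∑ z, absDiff (S.pred P K (S.start K ω) z) (S.N K S.x0 z)
      ≤ (S.mass P K)⁻¹ * (2 * S.bound * P (S.lastLevel K)) := by
  set y := S.start K ω with hy
  have hM0 : S.M P K y ≠ 0 := fun h => hm (le_antisymm (h ▸ S.mass_le_M P K ω) zero_le)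
  have hM1 : S.M P K y ≠ ∞ := ne_top_of_le_ne_top S.bound_ne_top (S.M_start_le P K ω)
  have h1 : ∀ z, S.pred P K y z = (S.M P K y)⁻¹ * ∫⁻ x, S.W K y x * S.N K x z ∂P := by
    intro z
    rw [pred, M, ← lintegral_const_mul _ (S.measurable_W_right _ _), div_eq_mul_inv, mul_comm]
    congr 1
    refine lintegral_congr fun x => ?_
    rw [b_mul_W_update, mul_comm]
  have h2 : ∀ z, S.N K S.x0 z = (S.M P K y)⁻¹ * ∫⁻ x, S.W K y x * S.N K S.x0 z ∂P := by
    intro z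
    rw [lintegral_mul_const _ (S.measurable_W_right _ _), ← mul_assoc]
    change _ = (S.M P K y)⁻¹ * S.M P K y * _
    rw [ENNReal.inv_mul_cancel hM0 hM1, one_mul]
  have hmW : ∀ z, Measurable fun x => S.W K y x * S.N K x z := fun z =>
    (S.measurable_W_right _ _).mul (S.measurable_N K z)
  have hmW0 : ∀ z, Measurable fun x => S.W K y x * S.N K S.x0 z := fun z =>
    (S.measurable_W_right _ _).mul_const _
  have hterm : ∀ z, absDiff (S.pred P K y z) (S.N K S.x0 z) ≤
      (S.M P K y)⁻¹ * ∫⁻ x, absDiff (S.W K y x * S.N K x z) (S.W K y x * S.N K S.x0 z) ∂P := by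
    intro z
    calc _ = absDiff ((S.M P K y)⁻¹ * ∫⁻ x, S.W K y x * S.N K x z ∂P)
          ((S.M P K y)⁻¹ * ∫⁻ x, S.W K y x * S.N K S.x0 z ∂P) := by rw [← h1, ← h2]
      _ ≤ _ := (absDiff_mul_left_le _ _ _).trans (mul_le_mul_right (absDiff_lintegral_le (hmW z)
        (hmW0 z)) _)
  refine (Finset.sum_le_sum fun z _ => hterm z).trans ?_
  rw [← Finset.mul_sum, ← lintegral_finsetSum _ fun z _ => (hmW z).absDiff (hmW0 z)]
  refine mul_le_mul' (ENNReal.inv_le_inv.2 (S.mass_le_M P K ω)) ?_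
  calc _ ≤ ∫⁻ x, 2 * S.bound * (S.lastLevel K).indicator 1 x ∂P := by
        refine lintegral_mono fun x => ?_
        refine (Finset.sum_le_sum fun z _ => absDiff_mul_left_le _ _ _).trans ?_
        rw [← Finset.mul_sum]
        change S.W K y x * S.gap K x S.x0 ≤ _
        by_cases hx : x ∈ S.lastLevel K
        · rw [Set.indicator_of_mem hx, Pi.one_apply, mul_one, mul_comm]
          exact mul_le_mul' (S.gap_le_two _ _ _)
            (S.W_le_bound (fun j hj => S.N_start_ne_zero K ω hj) x)
        · by_cases hW : S.W K y x = 0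
          · simp [hW]
          · have h3 := S.base_of_consistent K x y fun j hj =>
              ⟨S.N_ne_zero_of_W_ne_zero hW hj, S.N_start_ne_zero K ω hj⟩
            have h4 : S.N K x = S.N K S.x0 := by
              by_contra hne
              exact hx ⟨hne, h3⟩
            simp [gap, h4, absDiff_self]
    _ = _ := by
        rw [lintegral_const_mul _ (measurable_one.indicator (S.measurableSet_lastLevel K)),
          lintegral_indicator_one (S.measurableSet_lastLevel K)]

lemma measure_unstable_le (P : Measure X) [IsProbabilityMeasure P] {K : ℤ}
    (hm : S.mass P K ≠ 0) :
    seeds F {ω | pick (S.pred P K (S.start K ω)) (ω K) ≠ S.Z K ω}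
      ≤ (S.mass P K)⁻¹ * (2 * S.bound * P (S.lastLevel K)) := by
  have hE : MeasurableSet {ω | pick (S.pred P K (S.start K ω)) (ω K) ≠ S.Z K ω} := by
    refine (measurableSet_eq_fun ?_ (S.measurable_Z K)).compl
    exact measurable_pick.comp (((S.measurable_pred P K).comp (S.measurable_start K)).prodMk
      (measurable_pi_apply K))
  rw [← lintegral_indicator_one hE, seeds, lintegral_resample _ K (measurable_one.indicator hE)]
  calc _ ≤ ∫⁻ ω : Seeds F, (S.mass P K)⁻¹ * (2 * S.bound * P (S.lastLevel K))
        ∂(Measure.infinitePi fun _ => trialsMeasure F) := by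
        refine lintegral_mono fun ω => ?_
        have h1 : S.M P K (S.start K ω) ≠ 0 :=
          fun h => hm (le_antisymm (h ▸ S.mass_le_M P K ω) zero_le)
        have h2 : S.M P K (S.start K ω) ≠ ∞ :=
          ne_top_of_le_ne_top S.bound_ne_top (S.M_start_le P K ω)
        refine le_trans (le_trans (le_of_eq ?_) (trialsMeasure_pick_ne (S.sum_pred h1 h2)
          (S.sum_N K S.x0))) (S.sum_absDiff_pred_start_le P hm ω)
        have hset : MeasurableSet {w | pick (S.pred P K (S.start K ω)) w ≠ pick (S.N K S.x0) w} :=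
          (measurableSet_eq_fun (measurable_pick_right _) (measurable_pick_right _)).compl
        rw [← lintegral_indicator_one hset]
        refine lintegral_congr fun w => ?_
        have e1 : S.start K (Function.update ω K w) = S.start K ω := S.start_update le_rfl _ _
        by_cases hw : pick (S.pred P K (S.start K ω)) w ≠ pick (S.N K S.x0) w
        · rw [Set.indicator_of_mem (a := w) hw, Set.indicator_of_mem]
          · rfl
          · simpa only [Set.mem_ofPred_eq, e1, Z, Function.update_self] using hw
        · rw [Set.indicator_of_notMem (a := w) hw, Set.indicator_of_notMem]
          simpa only [Set.mem_ofPred_eq, e1, Z, Function.update_self] using hw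
    _ = _ := by simp

lemma mass_mono (P : Measure X) {K K' : ℤ} (h : K ≤ K') : S.mass P K ≤ S.mass P K' :=
  measure_mono fun _ hx j hj => hx j (by omega)

lemma tendsto_mass (P : Measure X) [IsProbabilityMeasure P] :
    Filter.Tendsto (fun K : ℕ => S.mass P K) Filter.atTop (nhds 1) := by
  have hmono : Monotone fun K : ℕ => {x | ∀ j > (K : ℤ), S.N j x = S.N j S.x0} :=
    fun K K' h x hx j hj => hx j (by omega)
  have := tendsto_measure_iUnion_atTop (μ := P) hmono
  have hU : ⋃ K : ℕ, {x | ∀ j > (K : ℤ), S.N j x = S.N j S.x0} = Set.univ := by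
    refine Set.eq_univ_of_forall fun x => ?_
    obtain ⟨J, hJ⟩ := S.exists_base x
    exact Set.mem_iUnion.2 ⟨J.toNat, fun j hj => hJ j (by omega)⟩
  rw [hU, measure_univ] at this
  exact this

lemma exists_mass_ne_zero (P : Measure X) [IsProbabilityMeasure P] :
    ∃ K1 : ℕ, ∀ K : ℕ, K1 ≤ K → S.mass P K ≠ 0 := by
  have h := (S.tendsto_mass P).eventually (lt_mem_nhds (zero_lt_one))
  obtain ⟨K1, hK1⟩ := Filter.eventually_atTop.1 h
  exact ⟨K1, fun K hK => (hK1 K hK).ne'⟩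

/-- The symbol sequence `y` is the limit of the histories of `P` started at high levels. -/
def IsLimit (P : Measure X) (ω : Seeds F) (y : ℤ → F) : Prop :=
  ∃ K0 : ℕ, ∀ K : ℕ, K0 ≤ K → ∀ j : ℤ, -(K : ℤ) ≤ j → S.hist P K (2 * K + 1) ω j = y j

lemma ae_exists_isLimit (P : Measure X) [IsProbabilityMeasure P] :
    ∀ᵐ ω ∂(seeds F), ∃ y, S.IsLimit P ω y := by
  obtain ⟨K1, hK1⟩ := S.exists_mass_ne_zero P
  have hBC : seeds F {ω | ∃ᶠ n : ℕ in Filter.atTop,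
      pick (S.pred P (K1 + n : ℕ) (S.start (K1 + n : ℕ) ω)) (ω (K1 + n : ℕ))
        ≠ S.Z (K1 + n : ℕ) ω} = 0 := by
    refine measure_setOfPred_frequently_eq_zero (ne_top_of_le_ne_top ?_ (ENNReal.tsum_le_tsum fun n =>
      (S.measure_unstable_le P (hK1 (K1 + n) (by omega))).trans
        (mul_le_mul_left (ENNReal.inv_le_inv.2 (S.mass_mono P (K := K1) (by omega))) _)))
    rw [ENNReal.tsum_mul_left, ENNReal.tsum_mul_left]
    refine ENNReal.mul_ne_top (ENNReal.inv_ne_top.2 (hK1 K1 le_rfl))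
      (ENNReal.mul_ne_top (ENNReal.mul_ne_top (by simp) S.bound_ne_top) ?_)
    refine ne_top_of_le_ne_top ?_ ((ENNReal.tsum_comp_le_tsum_of_injective
      (f := fun n : ℕ => K1 + n) (add_right_injective K1)
      (fun k : ℕ => P (S.lastLevel k))).trans (S.tsum_lastLevel_le P))
    simp
  have hae : ∀ᵐ ω ∂(seeds F), ¬ ∃ᶠ n : ℕ in Filter.atTop,
      pick (S.pred P (K1 + n : ℕ) (S.start (K1 + n : ℕ) ω)) (ω (K1 + n : ℕ))
        ≠ S.Z (K1 + n : ℕ) ω := by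
    rw [ae_iff]
    simp only [not_not]
    exact hBC
  filter_upwards [hae] with ω hω
  rw [Filter.not_frequently] at hω
  obtain ⟨n0, hn0⟩ := Filter.eventually_atTop.1 hω
  have hst : ∀ K : ℕ, K1 + n0 ≤ K → ∀ i, S.hist P ((K + 1 : ℕ) : ℤ) (i + 1) ω = S.hist P K i ω := by
    intro K hK i
    have := hn0 (K + 1 - K1) (by omega)
    rw [show K1 + (K + 1 - K1) = K + 1 by omega] at this
    push_cast at this ⊢
    exact S.hist_succ_eq (not_not.1 this) i
  have hstep : ∀ K : ℕ, K1 + n0 ≤ K → ∀ j : ℤ, -(K : ℤ) ≤ j →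
      S.hist P ((K + 1 : ℕ) : ℤ) (2 * (K + 1) + 1) ω j = S.hist P K (2 * K + 1) ω j := by
    intro K hK j hj
    rw [show 2 * (K + 1) + 1 = (2 * K + 1) + 1 + 1 by ring, hst K hK, hist,
      Function.update_of_ne (by push_cast; omega)]
  have hle : ∀ K K' : ℕ, K1 + n0 ≤ K → K ≤ K' → ∀ j : ℤ, -(K : ℤ) ≤ j →
      S.hist P K' (2 * K' + 1) ω j = S.hist P K (2 * K + 1) ω j := by
    intro K K' hK hKK' j hj
    induction K', hKK' using Nat.le_induction with
    | base => rfl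
    | succ K' h ih => rw [hstep K' (by omega) j (by omega), ih]
  refine ⟨fun j => S.hist P (max (K1 + n0) j.natAbs : ℕ) (2 * max (K1 + n0) j.natAbs + 1) ω j,
    K1 + n0, fun K hK j hj => ?_⟩
  rcases le_total K (max (K1 + n0) j.natAbs) with h | h
  · exact (hle K _ hK h j hj).symm
  · exact hle _ K (le_max_left _ _) h j (by omega)

end ScaleCode

namespace ScaleCode

variable {X F : Type*} [MetricSpace X] [MeasurableSpace X] [Fintype F] [Nonempty F]
  [MeasurableSpace F] [MeasurableSingletonClass F] {c : X → X → ℝ≥0∞} (S : ScaleCode X F c)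

/-- The points that are compatible with the symbols above level `k`. -/
def Fits (k : ℤ) (y : ℤ → F) (x : X) : Prop := ∀ j > k, S.N j x (y j) ≠ 0

lemma loc_of_fits {k : ℤ} {y y' : ℤ → F} {x x' : X} (h : S.Fits k y x) (h' : S.Fits k y' x')
    (hy : ∀ j > k, y j = y' j) : dist x x' ≤ S.D k ∧ c x x' ≤ S.w k :=
  S.loc k x x' y fun j hj => ⟨h j hj, hy j hj ▸ h' j hj⟩

lemma post_le (P : Measure X) (k : ℤ) {f : X → ℝ≥0∞} (y : ℤ → F) {C : ℝ≥0∞}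
    (h : ∀ x, S.W k y x ≠ 0 → f x ≤ C) : S.post P k f y ≤ C * S.M P k y := by
  rw [M, ← lintegral_const_mul _ (S.measurable_W_right k y)]
  refine lintegral_mono fun x => ?_
  by_cases hx : S.W k y x = 0
  · simp [hx]
  · rw [mul_comm C]
    exact mul_le_mul_right (h x hx) _

lemma le_post (P : Measure X) (k : ℤ) {f : X → ℝ≥0∞} (y : ℤ → F) {C : ℝ≥0∞}
    (h : ∀ x, S.W k y x ≠ 0 → C ≤ f x) : C * S.M P k y ≤ S.post P k f y := by
  rw [M, ← lintegral_const_mul _ (S.measurable_W_right k y)]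
  refine lintegral_mono fun x => ?_
  by_cases hx : S.W k y x = 0
  · simp [hx]
  · rw [mul_comm C]
    exact mul_le_mul_right (h x hx) _

section Decode

variable [OpensMeasurableSpace X] [TopologicalSpace.SeparableSpace X] [Nonempty X]

lemma exists_decode (P : Measure X) (k : ℤ) (y : ℤ → F) :
    ∃ i, S.M P k y = 0 ∨
      S.post P k ((Metric.ball (TopologicalSpace.denseSeq X i) (S.D k)).indicator 1) y ≠ 0 := by
  by_contra! h
  apply (h 0).1
  have h0 : ∀ i, ∀ᵐ x ∂P, x ∈ Metric.ball (TopologicalSpace.denseSeq X i) (S.D k) →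
      S.W k y x = 0 := by
    intro i
    have := (h i).2
    rw [post, lintegral_eq_zero_iff ((S.measurable_W_right k y).fun_mul
      (measurable_one.indicator Metric.isOpen_ball.measurableSet))] at this
    filter_upwards [this] with x hx hxi
    simpa [hxi] using hx
  rw [M, lintegral_eq_zero_iff (S.measurable_W_right k y)]
  filter_upwards [ae_all_iff.2 h0] with x hx
  obtain ⟨i, hi⟩ := (TopologicalSpace.denseRange_denseSeq X).exists_dist_lt x (S.D_pos k)
  exact hx i hi

open Classical in
/-- A point close to the support of the posterior. -/
def decode (P : Measure X) (k : ℤ) (y : ℤ → F) : X :=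
  TopologicalSpace.denseSeq X (Nat.find (S.exists_decode P k y))

lemma measurable_decode (P : Measure X) [SFinite P] (k : ℤ) : Measurable (S.decode P k) := by
  classical
  refine (measurable_from_nat (f := TopologicalSpace.denseSeq X)).comp
    (measurable_find (S.exists_decode P k) fun i => ?_)
  refine (S.measurable_M P k (measurableSet_singleton 0)).union ?_
  exact (S.measurable_post P k (measurable_one.indicator Metric.isOpen_ball.measurableSet)
    (measurableSet_singleton 0)).compl

lemma exists_fits_decode {P : Measure X} {k : ℤ} {y : ℤ → F} (h : S.M P k y ≠ 0) :
    ∃ x, S.Fits k y x ∧ dist x (S.decode P k y) ≤ S.D k := by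
  classical
  have h1 := (Nat.find_spec (S.exists_decode P k y)).resolve_left h
  change S.post P k ((Metric.ball (S.decode P k y) (S.D k)).indicator 1) y ≠ 0 at h1
  by_contra! h2
  apply h1
  rw [post, ← lintegral_zero (μ := P)]
  refine lintegral_congr fun x => ?_
  by_cases hx : S.W k y x = 0
  · simp [hx]
  · rw [Set.indicator_of_notMem, mul_zero]
    rw [Metric.mem_ball, not_lt]
    exact (h2 x fun j hj => S.N_ne_zero_of_W_ne_zero hx hj).le

end Decode

lemma tendsto_D_neg : Filter.Tendsto (fun K : ℕ => S.D (-K - 1)) Filter.atTop (nhds 0) := by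
  refine S.tendsto_D.comp (Filter.tendsto_atBot.2 fun b => ?_)
  filter_upwards [Filter.eventually_ge_atTop b.natAbs] with K hK
  omega

/-- The point `a` is a limit of points compatible with more and more symbols of `y`. -/
def IsLimitPoint (y : ℤ → F) (a : X) : Prop :=
  ∃ x : ℕ → X, (∀ᶠ K : ℕ in Filter.atTop, S.Fits (-K - 1) y (x K)) ∧
    Filter.Tendsto x Filter.atTop (nhds a)

variable {S} in
lemma IsLimitPoint.eq {y : ℤ → F} {a a' : X} (h : S.IsLimitPoint y a) (h' : S.IsLimitPoint y a') :
    a = a' := by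
  obtain ⟨x, hx, hxa⟩ := h
  obtain ⟨x', hx', hxa'⟩ := h'
  refine tendsto_nhds_unique hxa (tendsto_of_tendsto_of_dist hxa' ?_)
  refine squeeze_zero' (Filter.Eventually.of_forall fun _ => dist_nonneg) ?_ S.tendsto_D_neg
  filter_upwards [hx, hx'] with K h h'
  exact (S.loc_of_fits h' h fun _ _ => rfl).1

section Output

variable [BorelSpace X] [TopologicalSpace.SeparableSpace X] [Nonempty X] [CompleteSpace X]

lemma hist_level (K : ℕ) : (K : ℤ) - (2 * K + 1 : ℕ) = -K - 1 := by push_cast; ring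

lemma exists_output (P : Measure X) [IsProbabilityMeasure P] :
    ∃ a : Seeds F → X, Measurable a ∧
      ∀ᵐ ω ∂(seeds F), ∃ y, S.IsLimit P ω y ∧ S.IsLimitPoint y (a ω) := by
  have key : ∀ ω y, S.IsLimit P ω y → ∃ x : ℕ → X,
      (∀ᶠ K : ℕ in Filter.atTop, S.Fits (-K - 1) y (x K)) ∧ ∃ l, Filter.Tendsto x Filter.atTop (nhds l) ∧
      Filter.Tendsto (fun K : ℕ => S.decode P (-K - 1) (S.hist P K (2 * K + 1) ω)) Filter.atTop
        (nhds l) := by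
    rintro ω y ⟨K0, hK0⟩
    obtain ⟨K1, hK1⟩ := S.exists_mass_ne_zero P
    have h1 : ∀ K : ℕ, ∃ x, max K0 K1 ≤ K → S.Fits (-K - 1) y x ∧
        dist x (S.decode P (-K - 1) (S.hist P K (2 * K + 1) ω)) ≤ S.D (-K - 1) := by
      intro K
      by_cases hK : max K0 K1 ≤ K
      · have hM := (S.M_hist (hK1 K ((le_max_right _ _).trans hK)) (2 * K + 1) ω).1
        rw [hist_level] at hM
        obtain ⟨x, hx, hd⟩ := S.exists_fits_decode hM
        refine ⟨x, fun _ => ⟨fun j hj => ?_, hd⟩⟩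
        rw [← hK0 K ((le_max_left _ _).trans hK) j (by omega)]
        exact hx j hj
      · exact ⟨Classical.arbitrary X, fun h => absurd h hK⟩
    choose x hx using h1
    have hfit : ∀ᶠ K : ℕ in Filter.atTop, S.Fits (-K - 1) y (x K) :=
      Filter.eventually_atTop.2 ⟨_, fun K hK => (hx K hK).1⟩
    have hc : CauchySeq fun m => x (m + max K0 K1) := by
      refine cauchySeq_of_le_tendsto_0' (fun m : ℕ => S.D (-(m + max K0 K1 : ℕ) - 1))
        (fun m m' h => ?_) ?_
      · refine (S.loc_of_fits (hx _ (by omega)).1 (fun j hj => ?_) fun _ _ => rfl).1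
        exact (hx (m' + max K0 K1) (by omega)).1 j (by push_cast at hj ⊢; omega)
      · exact S.tendsto_D_neg.comp (Filter.tendsto_add_atTop_nat _)
    obtain ⟨l, hl⟩ := cauchySeq_tendsto_of_complete hc
    have hl' : Filter.Tendsto x Filter.atTop (nhds l) := (Filter.tendsto_add_atTop_iff_nat _).1 hl
    refine ⟨x, hfit, l, hl', tendsto_of_tendsto_of_dist hl' ?_⟩
    refine squeeze_zero' (Filter.Eventually.of_forall fun _ => dist_nonneg) ?_ S.tendsto_D_neg
    exact Filter.eventually_atTop.2 ⟨_, fun K hK => (hx K hK).2⟩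
  obtain ⟨a, ha, hlim⟩ := measurable_limit_of_tendsto_metrizable_ae (μ := seeds F)
    (f := fun (K : ℕ) ω => S.decode P (-K - 1) (S.hist P K (2 * K + 1) ω)) (L := Filter.atTop)
    (fun K => ((S.measurable_decode P _).comp (S.measurable_hist P K _)).aemeasurable) (by
      filter_upwards [S.ae_exists_isLimit P] with ω ⟨y, hy⟩
      obtain ⟨x, -, l, -, hl⟩ := key ω y hy
      exact ⟨l, hl⟩)
  refine ⟨a, ha, ?_⟩
  filter_upwards [S.ae_exists_isLimit P, hlim] with ω ⟨y, hy⟩ hω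
  obtain ⟨x, hx, l, hl, hl'⟩ := key ω y hy
  exact ⟨y, hy, x, hx, tendsto_nhds_unique hl' hω ▸ hl⟩

end Output

/-- The posterior mean of `f`. -/
def mean (P : Measure X) (k : ℤ) (f : X → ℝ≥0∞) (y : ℤ → F) : ℝ≥0∞ := S.post P k f y / S.M P k y

lemma mean_le (P : Measure X) (k : ℤ) {f : X → ℝ≥0∞} {C : ℝ≥0∞} (h : ∀ x, f x ≤ C) (y : ℤ → F) :
    S.mean P k f y ≤ C :=
  ENNReal.div_le_of_le_mul (S.post_le P k y fun x _ => h x)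

lemma measurable_mean (P : Measure X) [SFinite P] (k : ℤ) {f : X → ℝ≥0∞} (hf : Measurable f) :
    Measurable (S.mean P k f) :=
  (S.measurable_post P k hf).div (S.measurable_M P k)

lemma lintegral_mean_succ {P : Measure X} [IsProbabilityMeasure P] {K : ℤ}
    (hm : S.mass P K ≠ 0) (i : ℕ) {f : X → ℝ≥0∞} (hf : Measurable f) {C : ℝ≥0∞}
    (h : ∀ x, f x ≤ C) :
    ∫⁻ ω, S.mean P (K - (i + 1 : ℕ)) f (S.hist P K (i + 1) ω) ∂(seeds F)
      = ∫⁻ ω, S.mean P (K - i) f (S.hist P K i ω) ∂(seeds F) := by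
  rw [S.lintegral_hist_succ hm i (S.measurable_mean P _ hf)]
  refine lintegral_congr fun ω => ?_
  obtain ⟨h0, h1⟩ := S.M_hist hm i ω
  have e : K - ((i + 1 : ℕ) : ℤ) = K - i - 1 := by push_cast; ring
  rw [e, mean, ← S.sum_b_mul_post P (K - i) hf, ENNReal.div_eq_inv_mul, Finset.mul_sum]
  refine Finset.sum_congr rfl fun z _ => ?_
  set y := Function.update (S.hist P K i ω) (K - i) z
  have hpost : S.M P (K - i - 1) y * S.mean P (K - i - 1) f y = S.post P (K - i - 1) f y := by
    by_cases h2 : S.M P (K - i - 1) y = 0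
    · have := S.post_le P (K - i - 1) y fun x _ => h x
      rw [h2, mul_zero] at this
      rw [h2, zero_mul, le_antisymm this zero_le]
    · exact ENNReal.mul_div_cancel h2 (S.M_update_ne_top z h1)
  rw [pred, ← hpost, ENNReal.div_eq_inv_mul]
  ring

lemma lintegral_mean {P : Measure X} [IsProbabilityMeasure P] {K : ℤ}
    (hm : S.mass P K ≠ 0) (i : ℕ) {f : X → ℝ≥0∞} (hf : Measurable f) {C : ℝ≥0∞}
    (h : ∀ x, f x ≤ C) :
    ∫⁻ ω, S.mean P (K - i) f (S.hist P K i ω) ∂(seeds F)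
      = ∫⁻ ω, S.mean P K f (S.start K ω) ∂(seeds F) := by
  induction i with
  | zero => simp [hist]
  | succ i ih => rw [S.lintegral_mean_succ hm i hf h, ih]

lemma tendsto_post_start (P : Measure X) [IsProbabilityMeasure P] {f : X → ℝ≥0∞}
    (hf : Measurable f) {C : ℝ≥0∞} (hC : C ≠ ∞) (h : ∀ x, f x ≤ C) (ω : Seeds F) :
    Filter.Tendsto (fun K : ℕ => S.post P K f (S.start K ω)) Filter.atTop
      (nhds (∫⁻ x, f x ∂P)) := by
  refine tendsto_lintegral_of_dominated_convergence (fun _ => S.bound * C)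
    (fun K => (S.measurable_W_right _ _).mul hf) (fun K => Filter.Eventually.of_forall fun x =>
      mul_le_mul' (S.W_le_bound (fun j hj => S.N_start_ne_zero K ω hj) x) (h x)) ?_
    (Filter.Eventually.of_forall fun x => ?_)
  · simpa using ENNReal.mul_ne_top S.bound_ne_top hC
  · obtain ⟨J, hJ⟩ := S.exists_base x
    refine tendsto_const_nhds.congr' ?_
    filter_upwards [Filter.eventually_ge_atTop J.natAbs] with K hK
    rw [S.W_eq_one (fun j hj => S.N_start_ne_zero K ω hj) (fun j hj => hJ j (by omega)), one_mul]

lemma tendsto_lintegral_mean_start (P : Measure X) [IsProbabilityMeasure P] {f : X → ℝ≥0∞}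
    (hf : Measurable f) {C : ℝ≥0∞} (hC : C ≠ ∞) (h : ∀ x, f x ≤ C) :
    Filter.Tendsto (fun K : ℕ => ∫⁻ ω, S.mean P K f (S.start K ω) ∂(seeds F)) Filter.atTop
      (nhds (∫⁻ x, f x ∂P)) := by
  have : ∫⁻ x, f x ∂P = ∫⁻ _ : Seeds F, ∫⁻ x, f x ∂P ∂(seeds F) := by simp
  rw [this]
  refine tendsto_lintegral_of_dominated_convergence (fun _ => C)
    (fun K => (S.measurable_mean P _ hf).comp (S.measurable_start _))
    (fun K => Filter.Eventually.of_forall fun ω => S.mean_le P _ h _) (by simpa using hC)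
    (Filter.Eventually.of_forall fun ω => ?_)
  have h1 := S.tendsto_post_start P hf hC h ω
  have h2 := S.tendsto_post_start P (measurable_const (a := (1 : ℝ≥0∞))) one_ne_top
    (fun _ => le_rfl) ω
  simp only [post_one, lintegral_const, measure_univ, mul_one] at h2
  have h3 := ENNReal.Tendsto.div h1 (Or.inr one_ne_zero) h2 (Or.inl one_ne_top)
  simpa [mean] using h3

lemma tendsto_mean {P : Measure X} [IsProbabilityMeasure P] {ω : Seeds F} {y : ℤ → F}
    (hy : S.IsLimit P ω y) {a : X} (ha : S.IsLimitPoint y a) {f : X → ℝ≥0∞} (hf : Continuous f) :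
    Filter.Tendsto (fun K : ℕ => S.mean P (-K - 1) f (S.hist P K (2 * K + 1) ω)) Filter.atTop
      (nhds (f a)) := by
  obtain ⟨x, hx, hxa⟩ := ha
  obtain ⟨K0, hK0⟩ := hy
  obtain ⟨K1, hK1⟩ := S.exists_mass_ne_zero P
  have hd : Filter.Tendsto (fun K : ℕ => S.D (-K - 1) + dist (x K) a) Filter.atTop (nhds 0) := by
    simpa using S.tendsto_D_neg.add (tendsto_iff_dist_tendsto_zero.1 hxa)
  have key : ∀ V ∈ nhds a, ∀ᶠ K : ℕ in Filter.atTop, S.M P (-K - 1) (S.hist P K (2 * K + 1) ω) ≠ 0 ∧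
      S.M P (-K - 1) (S.hist P K (2 * K + 1) ω) ≠ ∞ ∧
      ∀ x', S.W (-K - 1) (S.hist P K (2 * K + 1) ω) x' ≠ 0 → x' ∈ V := by
    intro V hV
    obtain ⟨δ, hδ, hball⟩ := Metric.mem_nhds_iff.1 hV
    filter_upwards [hd.eventually (gt_mem_nhds hδ), hx, Filter.eventually_ge_atTop K0,
      Filter.eventually_ge_atTop K1] with K h1 h2 h3 h4
    have hM := S.M_hist (hK1 K h4) (2 * K + 1) ω
    rw [hist_level] at hM
    refine ⟨hM.1, hM.2, fun x' hx' => hball ?_⟩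
    have h5 := (S.loc_of_fits (k := -K - 1) (fun j hj => S.N_ne_zero_of_W_ne_zero hx' hj) h2
      fun j hj => hK0 K h3 j (by omega)).1
    rw [Metric.mem_ball]
    linarith [dist_triangle x' (x K) a]
  rw [tendsto_order]
  constructor
  · intro b hb
    obtain ⟨b', hb, hb'⟩ := exists_between hb
    filter_upwards [key _ (hf.continuousAt.eventually (lt_mem_nhds hb'))] with K ⟨h1, h2, h3⟩
    refine hb.trans_le ((ENNReal.le_div_iff_mul_le (Or.inl h1) (Or.inl h2)).2 ?_)
    exact S.le_post P _ _ fun x hx => le_of_lt (h3 x hx)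
  · intro b hb
    obtain ⟨b', hb', hb⟩ := exists_between hb
    filter_upwards [key _ (hf.continuousAt.eventually (gt_mem_nhds hb'))] with K ⟨h1, h2, h3⟩
    refine lt_of_le_of_lt (ENNReal.div_le_of_le_mul ?_) hb
    exact S.post_le P _ _ fun x hx => le_of_lt (h3 x hx)

lemma map_output [BorelSpace X] {P : Measure X} [IsProbabilityMeasure P] {a : Seeds F → X}
    (ha : Measurable a) (h : ∀ᵐ ω ∂(seeds F), ∃ y, S.IsLimit P ω y ∧ S.IsLimitPoint y (a ω)) :
    (seeds F).map a = P := by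
  have := Measure.isProbabilityMeasure_map (μ := seeds F) ha.aemeasurable
  refine ext_of_forall_lintegral_eq_of_IsFiniteMeasure fun f => ?_
  have hf : Continuous fun x => (f x : ℝ≥0∞) := ENNReal.continuous_coe.comp f.continuous
  obtain ⟨C, hC⟩ : ∃ C : NNReal, ∀ x, f x ≤ C :=
    ⟨nndist f 0, fun x => by
      simpa using BoundedContinuousFunction.nndist_coe_le_nndist (f := f) (g := 0) x⟩
  have hC' : ∀ x, (f x : ℝ≥0∞) ≤ C := fun x => by exact_mod_cast hC x
  rw [lintegral_map hf.measurable ha]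
  refine tendsto_nhds_unique ?_ (S.tendsto_lintegral_mean_start P hf.measurable coe_ne_top hC')
  have h1 : Filter.Tendsto (fun K : ℕ => ∫⁻ ω, S.mean P (-K - 1) (fun x => f x)
      (S.hist P K (2 * K + 1) ω) ∂(seeds F)) Filter.atTop (nhds (∫⁻ ω, f (a ω) ∂(seeds F))) := by
    refine tendsto_lintegral_of_dominated_convergence (fun _ => (C : ℝ≥0∞))
      (fun K => (S.measurable_mean P _ hf.measurable).comp (S.measurable_hist P _ _))
      (fun K => Filter.Eventually.of_forall fun ω => S.mean_le P _ hC' _) (by simp) ?_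
    filter_upwards [h] with ω ⟨y, hy, hya⟩
    exact S.tendsto_mean hy hya hf
  refine h1.congr' ?_
  obtain ⟨K1, hK1⟩ := S.exists_mass_ne_zero P
  filter_upwards [Filter.eventually_ge_atTop K1] with K hK
  rw [← S.lintegral_mean (hK1 K hK) (2 * K + 1) hf.measurable hC', hist_level]

lemma hist_apply_of_lt (P : Measure X) (K : ℤ) (i m : ℕ) (ω : Seeds F) {j : ℤ} (hj : K - i < j) :
    S.hist P K (i + m) ω j = S.hist P K i ω j := by
  induction m with
  | zero => rfl
  | succ m ih => rw [← add_assoc, hist, Function.update_of_ne (by push_cast; omega), ih]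

lemma cost_le_sum {P Q : Measure X} (hc : Continuous fun z : X × X => c z.1 z.2)
    (hc0 : ∀ x, c x x = 0) {ω : Seeds F} {y y' : ℤ → F} {a a' : X} (hy : S.IsLimit P ω y)
    (ha : S.IsLimitPoint y a) (hy' : S.IsLimit Q ω y') (ha' : S.IsLimitPoint y' a') :
    ∀ᶠ K : ℕ in Filter.atTop, c a a' ≤ ∑ i ∈ Finset.range (2 * K + 1), S.w (K - i) *
      {ω | S.hist P K i ω = S.hist Q K i ω ∧
        S.hist P K (i + 1) ω ≠ S.hist Q K (i + 1) ω}.indicator 1 ω := by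
  by_cases h : y = y'
  · subst h
    rw [ha.eq ha', hc0]
    exact Filter.Eventually.of_forall fun _ => zero_le
  obtain ⟨j, hj⟩ := Function.ne_iff.1 h
  obtain ⟨K0, hK0⟩ := hy
  obtain ⟨K0', hK0'⟩ := hy'
  obtain ⟨x, hx, hxa⟩ := ha
  obtain ⟨x', hx', hxa'⟩ := ha'
  filter_upwards [Filter.eventually_ge_atTop K0, Filter.eventually_ge_atTop K0',
    Filter.eventually_ge_atTop j.natAbs] with K h1 h2 h3
  have hne : S.hist P K (2 * K + 1) ω ≠ S.hist Q K (2 * K + 1) ω := by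
    refine Function.ne_iff.2 ⟨j, ?_⟩
    rw [hK0 K h1 j (by omega), hK0' K h2 j (by omega)]
    exact hj
  obtain ⟨i, hi, hi0, hi1⟩ : ∃ i < 2 * K + 1, S.hist P K i ω = S.hist Q K i ω ∧
      S.hist P K (i + 1) ω ≠ S.hist Q K (i + 1) ω := by
    by_contra! hcon
    have : ∀ i ≤ 2 * K + 1, S.hist P K i ω = S.hist Q K i ω := by
      intro i
      induction i with
      | zero => exact fun _ => rfl
      | succ i ih => exact fun h => hcon i (by omega) (ih (by omega))
    exact hne (this _ le_rfl)
  refine le_trans ?_ (Finset.single_le_sum (fun _ _ => zero_le) (Finset.mem_range.2 hi))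
  rw [Set.indicator_of_mem (show ω ∈ {ω | S.hist P K i ω = S.hist Q K i ω ∧
        S.hist P K (i + 1) ω ≠ S.hist Q K (i + 1) ω} from ⟨hi0, hi1⟩), Pi.one_apply, mul_one]
  have hyy : ∀ l > (K : ℤ) - i, y l = y' l := by
    intro l hl
    obtain ⟨m, hm⟩ : ∃ m, 2 * K + 1 = i + m := ⟨2 * K + 1 - i, by omega⟩
    rw [← hK0 K h1 l (by omega), ← hK0' K h2 l (by omega), hm, S.hist_apply_of_lt P K i m ω hl,
      S.hist_apply_of_lt Q K i m ω hl, hi0]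
  refine le_of_tendsto ((hc.tendsto (a, a')).comp (hxa.prodMk_nhds hxa')) ?_
  filter_upwards [hx, hx', Filter.eventually_ge_atTop K] with L h4 h5 h6
  exact (S.loc_of_fits (k := K - i) (fun l hl => h4 l (by omega)) (fun l hl => h5 l (by omega))
    hyy).2

lemma lintegral_cost_le {P Q : Measure X} [IsProbabilityMeasure P] [IsProbabilityMeasure Q]
    (hc : Continuous fun z : X × X => c z.1 z.2) (hc0 : ∀ x, c x x = 0)
    {γ : Measure (X × X)} [SFinite γ] (hP : γ.map Prod.fst = P) (hQ : γ.map Prod.snd = Q)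
    {a a' : Seeds F → X} (ha : ∀ᵐ ω ∂(seeds F), ∃ y, S.IsLimit P ω y ∧ S.IsLimitPoint y (a ω))
    (ha' : ∀ᵐ ω ∂(seeds F), ∃ y, S.IsLimit Q ω y ∧ S.IsLimitPoint y (a' ω)) :
    ∫⁻ ω, c (a ω) (a' ω) ∂(seeds F)
      ≤ ∑' k : ℤ, S.w k * (∫⁻ z, S.totalGap k z.1 z.2 ∂γ + ∫⁻ z, S.totalGap (k + 1) z.1 z.2 ∂γ) := by
  set T := ∑' k : ℤ, S.w k * (∫⁻ z, S.totalGap k z.1 z.2 ∂γ + ∫⁻ z, S.totalGap (k + 1) z.1 z.2 ∂γ)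
  have hm : ∀ (K : ℕ) (i : ℕ), MeasurableSet {ω | S.hist P K i ω = S.hist Q K i ω ∧
        S.hist P K (i + 1) ω ≠ S.hist Q K (i + 1) ω} := fun K i =>
    (S.measurableSet_agree P Q K i).inter (S.measurableSet_agree P Q K (i + 1)).compl
  set A : ℕ → Seeds F → ℝ≥0∞ := fun K ω => ∑ i ∈ Finset.range (2 * K + 1), S.w (K - i) *
      {ω | S.hist P K i ω = S.hist Q K i ω ∧
        S.hist P K (i + 1) ω ≠ S.hist Q K (i + 1) ω}.indicator 1 ω with hA
  have hmA : ∀ K, Measurable (A K) := fun K => Finset.measurable_sum _ fun i _ =>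
    (measurable_one.indicator (hm K i)).const_mul _
  have h1 : ∫⁻ ω, c (a ω) (a' ω) ∂(seeds F) ≤ ∫⁻ ω, Filter.liminf (fun K => A K ω) Filter.atTop
      ∂(seeds F) := by
    refine lintegral_mono_ae ?_
    filter_upwards [ha, ha'] with ω ⟨y, hy, hya⟩ ⟨y', hy', hya'⟩
    exact Filter.le_liminf_of_le (by isBoundedDefault) (S.cost_le_sum hc hc0 hy hya hy' hya')
  refine h1.trans ((lintegral_liminf_le hmA).trans ?_)
  have hfac : Filter.Tendsto (fun K : ℕ => S.factor P Q K * T) Filter.atTop (nhds T) := by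
    have h2 : Filter.Tendsto (fun K : ℕ => S.factor P Q K) Filter.atTop (nhds 1) := by
      have := ((tendsto_inv_iff.2 (S.tendsto_mass P)).max
        (tendsto_inv_iff.2 (S.tendsto_mass Q)))
      simpa [factor] using this
    simpa using ENNReal.Tendsto.mul_const (b := T) h2 (Or.inl one_ne_zero)
  rw [← hfac.liminf_eq]
  refine Filter.liminf_le_liminf ?_
  obtain ⟨K1, hK1⟩ := S.exists_mass_ne_zero P
  obtain ⟨K2, hK2⟩ := S.exists_mass_ne_zero Q
  filter_upwards [Filter.eventually_ge_atTop K1, Filter.eventually_ge_atTop K2] with K h3 h4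
  rw [lintegral_finsetSum _ fun i _ => (measurable_one.indicator (hm K i)).const_mul _]
  calc _ ≤ ∑ i ∈ Finset.range (2 * K + 1), S.factor P Q K * (S.w (K - i) *
        (∫⁻ z, S.totalGap (K - i) z.1 z.2 ∂γ + ∫⁻ z, S.totalGap (K - i + 1) z.1 z.2 ∂γ)) := by
        refine Finset.sum_le_sum fun i _ => ?_
        rw [lintegral_const_mul _ (measurable_one.indicator (hm K i)),
          lintegral_indicator_one (hm K i), mul_left_comm]
        exact mul_le_mul_right (S.measure_split_le_totalGap hP hQ (hK1 K h3) (hK2 K h4) i) _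
    _ ≤ _ := by
        rw [← Finset.mul_sum]
        refine mul_le_mul_right ((ENNReal.sum_le_tsum _).trans
          (ENNReal.tsum_comp_le_tsum_of_injective (f := fun i : ℕ => (K : ℤ) - i)
            (fun i i' h => by simpa using h) _)) _

end ScaleCode

lemma exists_stdSpace_map_eq {Y : Type*} [MeasurableSpace Y] [StandardBorelSpace Y]
    (μ : Measure Y) [IsProbabilityMeasure μ] : ∃ g : ℝ → Y, Measurable g ∧ stdSpace.map g = μ := by
  have : Nonempty Y := by
    by_contra h
    rw [not_nonempty_iff] at h
    have h1 := measure_univ (μ := μ)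
    rw [Set.univ_eq_empty_iff.2 h, measure_empty] at h1
    exact zero_ne_one h1
  obtain ⟨f, hf, hmap⟩ := MeasureTheory.Measure.exists_measurable_map_eq μ
  refine ⟨fun u => f (Set.projIcc 0 1 zero_le_one u), hf.comp continuous_projIcc.measurable, ?_⟩
  have h1 : stdSpace = (volume : Measure unitInterval).map Subtype.val :=
    (map_comap_subtype_coe measurableSet_Icc volume).symm
  rw [h1, Measure.map_map (hf.fun_comp continuous_projIcc.measurable) measurable_subtype_coe, ← hmap]
  congr 1
  ext u
  simp [Set.projIcc_val]

/-- A mixture of multiscale codes couples all probability measures simultaneously. -/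
lemma exists_isCoupling {X F : Type*} [MetricSpace X] [MeasurableSpace X] [BorelSpace X]
    [TopologicalSpace.SeparableSpace X] [CompleteSpace X] [Nonempty X] [Fintype F] [Nonempty F]
    [MeasurableSpace F] [MeasurableSingletonClass F] {cost : X → X → ℝ}
    (hc : Continuous fun z : X × X => cost z.1 z.2) (hc0 : ∀ x, cost x x = 0) {m : ℕ} (hm : m ≠ 0)
    (S : Fin m → ScaleCode X F fun x y => ENNReal.ofReal (cost x y)) :
    ∃ f : ProbabilityMeasure X → ℝ → X,
      IsCoupling (fun P : ProbabilityMeasure X => (P : Measure X)) f ∧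
      ∀ (P Q : ProbabilityMeasure X) (γ : Measure (X × X)), IsProbabilityMeasure γ →
        γ.map Prod.fst = P → γ.map Prod.snd = Q →
        ∫⁻ u, ENNReal.ofReal (cost (f P u) (f Q u)) ∂stdSpace
          ≤ (m : ℝ≥0∞)⁻¹ * ∑ t, ∑' k : ℤ, (S t).w k *
            (∫⁻ z, (S t).totalGap k z.1 z.2 ∂γ + ∫⁻ z, (S t).totalGap (k + 1) z.1 z.2 ∂γ) := by
  have h (t : Fin m) (P : ProbabilityMeasure X) := (S t).exists_output (P : Measure X)
  choose a ha hlim using h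
  set μ : Measure (Fin m × ScaleCode.Seeds F) :=
    ∑ t, (m : ℝ≥0∞)⁻¹ • (ScaleCode.seeds F).map (Prod.mk t) with hμ
  have hm0 : (m : ℝ≥0∞) ≠ 0 := by exact_mod_cast hm
  have hlin : ∀ G : Fin m × ScaleCode.Seeds F → ℝ≥0∞, Measurable G →
      ∫⁻ p, G p ∂μ = (m : ℝ≥0∞)⁻¹ * ∑ t, ∫⁻ ω, G (t, ω) ∂(ScaleCode.seeds F) := by
    intro G hG
    rw [hμ, lintegral_finsetSum_measure, Finset.mul_sum]
    refine Finset.sum_congr rfl fun t _ => ?_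
    rw [lintegral_smul_measure, lintegral_map hG measurable_prodMk_left, smul_eq_mul]
  have : IsProbabilityMeasure μ := ⟨by
    rw [← lintegral_one, hlin _ measurable_const]
    simp [ENNReal.inv_mul_cancel hm0]⟩
  obtain ⟨g, hg, hgμ⟩ := exists_stdSpace_map_eq μ
  have hmeas : ∀ P, Measurable fun p : Fin m × ScaleCode.Seeds F => a p.1 P p.2 := fun P =>
    measurable_from_prod_countable_right fun t => ha t P
  refine ⟨fun P u => a (g u).1 P (g u).2, ⟨fun P => (hmeas P).comp hg, fun P => ?_⟩, ?_⟩
  · have h1 : stdSpace.map (fun u => a (g u).1 P (g u).2)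
        = μ.map fun p : Fin m × ScaleCode.Seeds F => a p.1 P p.2 := by
      rw [← hgμ, Measure.map_map (hmeas P) hg]
      rfl
    rw [h1]
    refine Measure.ext_of_lintegral _ fun G hG => ?_
    rw [lintegral_map hG (hmeas P), hlin _ (hG.fun_comp (hmeas P))]
    have h2 : ∀ t, ∫⁻ ω, G (a t P ω) ∂(ScaleCode.seeds F) = ∫⁻ x, G x ∂(P : Measure X) := by
      intro t
      rw [← lintegral_map hG (ha t P), (S t).map_output (ha t P) (hlim t P)]
    simp only [h2, Finset.sum_const, Finset.card_univ, Fintype.card_fin, nsmul_eq_mul]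
    rw [← mul_assoc, ENNReal.inv_mul_cancel hm0 (by simp), one_mul]
  · intro P Q γ _ hP hQ
    have hG : Measurable fun p : Fin m × ScaleCode.Seeds F =>
        ENNReal.ofReal (cost (a p.1 P p.2) (a p.1 Q p.2)) :=
      (hc.measurable.comp ((hmeas P).prodMk (hmeas Q))).ennreal_ofReal
    have h1 : ∫⁻ u, ENNReal.ofReal (cost (a (g u).1 P (g u).2) (a (g u).1 Q (g u).2)) ∂stdSpace
        = ∫⁻ p, ENNReal.ofReal (cost (a p.1 P p.2) (a p.1 Q p.2)) ∂μ := by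
      rw [← hgμ, lintegral_map hG hg]
    rw [h1, hlin _ hG]
    refine mul_le_mul_right (Finset.sum_le_sum fun t _ => ?_) _
    exact (S t).lintegral_cost_le (ENNReal.continuous_ofReal.comp hc) (by simp [hc0]) hP hQ
      (hlim t P) (hlim t Q)

section LpNorm

variable {p : ℝ≥0∞} {n : ℕ}

lemma lpNorm_eq_norm (hp : 1 ≤ p) (z : Fin n → ℝ) : _root_.lpNorm p z = ‖WithLp.toLp p z‖ := by
  have := Fact.mk hp
  unfold _root_.lpNorm
  split_ifs with h
  · subst h
    simp [PiLp.norm_eq_ciSup]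
  · rw [PiLp.norm_eq_sum (ENNReal.toReal_pos (by positivity) h)]
    simp

lemma lpNorm_nonneg (hp : 1 ≤ p) (z : Fin n → ℝ) : 0 ≤ _root_.lpNorm p z := by
  have := Fact.mk hp
  rw [lpNorm_eq_norm hp]
  positivity

lemma lpNorm_zero (hp : 1 ≤ p) : _root_.lpNorm p (0 : Fin n → ℝ) = 0 := by
  have := Fact.mk hp
  rw [lpNorm_eq_norm hp]
  simp

lemma lpNorm_add_le (hp : 1 ≤ p) (z w : Fin n → ℝ) :
    _root_.lpNorm p (z + w) ≤ _root_.lpNorm p z + _root_.lpNorm p w := by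
  have := Fact.mk hp
  simp only [lpNorm_eq_norm hp, WithLp.toLp_add]
  exact norm_add_le _ _

lemma lpNorm_smul (hp : 1 ≤ p) (a : ℝ) (z : Fin n → ℝ) :
    _root_.lpNorm p (a • z) = |a| * _root_.lpNorm p z := by
  have := Fact.mk hp
  simp only [lpNorm_eq_norm hp, WithLp.toLp_smul]
  rw [norm_smul, Real.norm_eq_abs]

lemma lpNorm_neg (hp : 1 ≤ p) (z : Fin n → ℝ) : _root_.lpNorm p (-z) = _root_.lpNorm p z := by
  have := lpNorm_smul hp (-1) z
  simpa using this

lemma lpNorm_sub_comm (hp : 1 ≤ p) (z w : Fin n → ℝ) :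
    _root_.lpNorm p (z - w) = _root_.lpNorm p (w - z) := by
  rw [← lpNorm_neg hp, neg_sub]

lemma lpNorm_sub_le (hp : 1 ≤ p) (z w : Fin n → ℝ) :
    _root_.lpNorm p (z - w) ≤ _root_.lpNorm p z + _root_.lpNorm p w := by
  rw [sub_eq_add_neg, ← lpNorm_neg hp w]
  exact lpNorm_add_le hp _ _

lemma abs_le_lpNorm (hp : 1 ≤ p) (z : Fin n → ℝ) (i : Fin n) : |z i| ≤ _root_.lpNorm p z := by
  have := Fact.mk hp
  rw [lpNorm_eq_norm hp]
  exact PiLp.norm_apply_le (WithLp.toLp p z) i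

lemma lpNorm_mono (hp : 1 ≤ p) {z w : Fin n → ℝ} (h : ∀ i, |z i| ≤ |w i|) :
    _root_.lpNorm p z ≤ _root_.lpNorm p w := by
  unfold _root_.lpNorm
  split_ifs with ht
  · exact ciSup_mono (Set.finite_range _).bddAbove h
  · have h0 : 0 < p.toReal := ENNReal.toReal_pos (by positivity) ht
    refine Real.rpow_le_rpow (by positivity) (Finset.sum_le_sum fun i _ => ?_) (by positivity)
    exact Real.rpow_le_rpow (abs_nonneg _) (h i) h0.le

lemma lpNorm_single (hp : 1 ≤ p) (i : Fin n) (a : ℝ) : _root_.lpNorm p (Pi.single i a) = |a| := by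
  have := Fact.mk hp
  rw [lpNorm_eq_norm hp]
  simp

lemma lpNorm_le_sum (hp : 1 ≤ p) (z : Fin n → ℝ) : _root_.lpNorm p z ≤ ∑ i, |z i| := by
  have h : ∀ s : Finset (Fin n),
      _root_.lpNorm p (∑ i ∈ s, Pi.single i (z i)) ≤ ∑ i ∈ s, |z i| := by
    intro s
    induction s using Finset.induction_on with
    | empty => simp [lpNorm_zero hp]
    | insert i s hi ih =>
      rw [Finset.sum_insert hi, Finset.sum_insert hi]
      refine (lpNorm_add_le hp _ _).trans (add_le_add (lpNorm_single hp _ _).le ih)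
  simpa [Finset.univ_sum_single] using h Finset.univ

lemma continuous_lpNorm (hp : 1 ≤ p) : Continuous (_root_.lpNorm p : (Fin n → ℝ) → ℝ) := by
  have := Fact.mk hp
  have h : (_root_.lpNorm p : (Fin n → ℝ) → ℝ) = fun z => ‖WithLp.toLp p z‖ :=
    funext fun z => lpNorm_eq_norm hp z
  rw [h]
  exact (PiLp.continuous_toLp p _).norm

lemma lpNorm_eq_rpow (hp : p ≠ ∞) (z : Fin n → ℝ) :
    _root_.lpNorm p z = (∑ i, |z i| ^ p.toReal) ^ (1 / p.toReal) := by
  simp [_root_.lpNorm, hp]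

end LpNorm

/-- The unit ball of the `ℓ_p` norm. -/
def lpBall (p : ℝ≥0∞) (n : ℕ) : Set (Fin n → ℝ) := {z | _root_.lpNorm p z ≤ 1}

section LpBall

variable {p : ℝ≥0∞} {n : ℕ}

lemma measurableSet_lpBall (hp : 1 ≤ p) : MeasurableSet (lpBall p n) :=
  (isClosed_le (continuous_lpNorm hp) continuous_const).measurableSet

lemma unitBallVolume_pos (p : ℝ≥0∞) (m : ℕ) : 0 < unitBallVolume p m := by
  unfold unitBallVolume
  have h1 : 0 < Real.Gamma (1 + (p⁻¹).toReal) := Real.Gamma_pos_of_pos (by positivity)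
  have h2 : 0 < Real.Gamma (1 + m * (p⁻¹).toReal) := Real.Gamma_pos_of_pos (by positivity)
  positivity

lemma volume_lpBall_two : volume (lpBall 2 n) = ENNReal.ofReal (unitBallVolume 2 n) := by
  rcases Nat.eq_zero_or_pos n with rfl | hn
  · have h : lpBall 2 0 = Set.univ := by
      ext z
      simp [lpBall, lpNorm_eq_rpow]
    rw [h]
    simp [unitBallVolume, volume_pi]
  have : Nonempty (Fin n) := ⟨⟨0, hn⟩⟩
  have h := MeasureTheory.volume_sum_rpow_le (Fin n) (one_le_two : (1 : ℝ) ≤ 2) 1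
  have hs : lpBall 2 n = {x : Fin n → ℝ | (∑ i, |x i| ^ (2 : ℝ)) ^ (1 / (2 : ℝ)) ≤ 1} := by
    ext z
    simp [lpBall, lpNorm_eq_rpow]
  rw [hs, h]
  simp only [ofReal_one, one_pow, one_mul, Fintype.card_fin, unitBallVolume, ENNReal.toReal_inv,
    mul_pow]
  congr 3
  · rw [add_comm, one_div]; simp
  · rw [add_comm, div_eq_mul_inv]; simp

lemma volume_lpBall_two_ne_zero : volume (lpBall 2 n) ≠ 0 := by
  rw [volume_lpBall_two]
  simpa using unitBallVolume_pos 2 n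

lemma volume_lpBall_two_ne_top : volume (lpBall 2 n) ≠ ∞ := by
  rw [volume_lpBall_two]
  exact ofReal_ne_top

end LpBall

section NormComparison

variable {p r : ℝ≥0∞} {n : ℕ}

lemma sum_abs_rpow_eq_lpNorm_rpow (hp1 : 1 ≤ p) (hp : p ≠ ∞) (z : Fin n → ℝ) :
    ∑ i, |z i| ^ p.toReal = _root_.lpNorm p z ^ p.toReal := by
  have h0 : 0 < p.toReal := ENNReal.toReal_pos (by positivity) hp
  rw [lpNorm_eq_rpow hp, ← Real.rpow_mul (by positivity), one_div_mul_cancel h0.ne', Real.rpow_one]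

lemma lpNorm_le_of_sum_le (hp1 : 1 ≤ p) (hp : p ≠ ∞) (z : Fin n → ℝ) {s : ℝ} (hs : 0 ≤ s)
    (h : ∑ i, |z i| ^ p.toReal ≤ s ^ p.toReal) : _root_.lpNorm p z ≤ s := by
  have h0 : 0 < p.toReal := ENNReal.toReal_pos (by positivity) hp
  rw [sum_abs_rpow_eq_lpNorm_rpow hp1 hp] at h
  exact (Real.rpow_le_rpow_iff (lpNorm_nonneg hp1 z) hs h0).1 h

lemma lpNorm_top_le (z : Fin n → ℝ) {s : ℝ} (hs : 0 ≤ s) (h : ∀ i, |z i| ≤ s) :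
    _root_.lpNorm ∞ z ≤ s := by
  simp only [_root_.lpNorm, if_true]
  exact Real.iSup_le h hs

lemma lpNorm_anti (hp : 1 ≤ p) (hpr : p ≤ r) (z : Fin n → ℝ) :
    _root_.lpNorm r z ≤ _root_.lpNorm p z := by
  rcases eq_or_ne r ∞ with rfl | hr
  · exact lpNorm_top_le z (lpNorm_nonneg hp z) (abs_le_lpNorm hp z)
  have hpt : p ≠ ∞ := ne_top_of_le_ne_top hr hpr
  have hpr' : p.toReal ≤ r.toReal := ENNReal.toReal_mono hr hpr
  have hp0 : 0 < p.toReal := ENNReal.toReal_pos (by positivity) hpt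
  refine lpNorm_le_of_sum_le (hp.trans hpr) hr z (lpNorm_nonneg hp z) ?_
  have e : ∀ x : ℝ, 0 ≤ x → x ^ r.toReal = x ^ p.toReal * x ^ (r.toReal - p.toReal) := by
    intro x hx
    rw [← Real.rpow_add_of_nonneg hx hp0.le (by linarith)]
    congr 1
    ring
  rw [e _ (lpNorm_nonneg hp z), ← sum_abs_rpow_eq_lpNorm_rpow hp hpt, Finset.sum_mul]
  refine Finset.sum_le_sum fun i _ => ?_
  rw [e _ (abs_nonneg _)]
  exact mul_le_mul_of_nonneg_left
    (Real.rpow_le_rpow (abs_nonneg _) (abs_le_lpNorm hp z i) (by linarith)) (by positivity)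

lemma lpNorm_le_rpow_mul (hp : 1 ≤ p) (hpr : p ≤ r) (z : Fin n → ℝ) :
    _root_.lpNorm p z ≤ (n : ℝ) ^ ((p⁻¹).toReal - (r⁻¹).toReal) * _root_.lpNorm r z := by
  rcases eq_or_ne p ∞ with rfl | hpt
  · obtain rfl : r = ∞ := top_le_iff.1 hpr
    simp
  have hp0 : 0 < p.toReal := ENNReal.toReal_pos (by positivity) hpt
  have hn0 := lpNorm_nonneg (hp.trans hpr) z
  refine lpNorm_le_of_sum_le hp hpt z (by positivity) ?_
  rw [Real.mul_rpow (by positivity) hn0, ← Real.rpow_mul (by positivity)]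
  rcases eq_or_ne r ∞ with rfl | hr
  · have h : ∀ i ∈ Finset.univ, |z i| ^ p.toReal ≤ _root_.lpNorm ∞ z ^ p.toReal := fun i _ =>
      Real.rpow_le_rpow (abs_nonneg _) (abs_le_lpNorm le_top z i) hp0.le
    have := Finset.sum_le_sum h
    simpa [ENNReal.toReal_inv, hp0.ne'] using this
  · have hpr' : p.toReal ≤ r.toReal := ENNReal.toReal_mono hr hpr
    have hr0 : 0 < r.toReal := hp0.trans_le hpr'
    have h := Real.rpow_sum_le_const_mul_sum_rpow (Finset.univ : Finset (Fin n))
      (fun i => |z i| ^ p.toReal) (p := r.toReal / p.toReal) (by rwa [one_le_div hp0])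
    have e : ∀ i, |(|z i| ^ p.toReal)| ^ (r.toReal / p.toReal) = |z i| ^ r.toReal := by
      intro i
      rw [abs_of_nonneg (by positivity), ← Real.rpow_mul (abs_nonneg _), mul_div_cancel₀ _ hp0.ne']
    simp only [e] at h
    rw [sum_abs_rpow_eq_lpNorm_rpow (hp.trans hpr) hr] at h
    have h2 := Real.rpow_le_rpow (by positivity) h (z := p.toReal / r.toReal) (by positivity)
    rw [← Real.rpow_mul (by positivity), div_mul_div_cancel₀ hp0.ne', div_self hr0.ne',
      Real.rpow_one, Real.mul_rpow (by positivity) (by positivity), ← Real.rpow_mul hn0,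
      mul_div_cancel₀ _ hr0.ne', ← Real.rpow_mul (by positivity)] at h2
    refine le_trans (le_of_eq ?_) (h2.trans (le_of_eq ?_))
    · exact Finset.sum_congr rfl fun i _ => (abs_of_nonneg (by positivity)).symm
    · congr 2
      · simp
      · rw [ENNReal.toReal_inv, ENNReal.toReal_inv]
        field_simp

end NormComparison

section BallTranslation

lemma mem_lpBall_two_iff {n : ℕ} (z : Fin n → ℝ) : z ∈ lpBall 2 n ↔ ∑ i, z i ^ 2 ≤ 1 := by
  have h := sum_abs_rpow_eq_lpNorm_rpow (p := 2) one_le_two (by simp) z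
  have h0 := lpNorm_nonneg (p := 2) one_le_two z
  simp only [ENNReal.toReal_ofNat, Real.rpow_ofNat, sq_abs] at h
  rw [h, lpBall, Set.mem_ofPred_eq, sq_le_one_iff₀ h0]

lemma mem_lpBall_two_iff_norm {n : ℕ} (z : Fin n → ℝ) :
    z ∈ lpBall 2 n ↔ ‖(WithLp.toLp 2 z : EuclideanSpace ℝ (Fin n))‖ ≤ 1 := by
  rw [lpBall, Set.mem_ofPred_eq, lpNorm_eq_norm one_le_two]

lemma volume_symmDiff_interval_le {a s : ℝ} (ha : 0 ≤ a) :
    volume (symmDiff {x : ℝ | x ^ 2 ≤ s} {x : ℝ | (x - a) ^ 2 ≤ s}) ≤ ENNReal.ofReal (2 * a) := by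
  have hsub : symmDiff {x : ℝ | x ^ 2 ≤ s} {x : ℝ | (x - a) ^ 2 ≤ s} ⊆
      Set.Icc (-√s) (a - √s) ∪ Set.Icc (√s) (a + √s) := by
    intro x hx
    rcases lt_or_ge s 0 with hs | hs
    · rcases hx with ⟨h, -⟩ | ⟨h, -⟩ <;> simp only [Set.mem_ofPred_eq] at h <;> nlinarith
    have habs : ∀ x : ℝ, |x| ≤ √s ↔ x ^ 2 ≤ s := fun x => by
      rw [Real.le_sqrt (abs_nonneg x) hs, sq_abs]
    simp only [Set.mem_symmDiff, Set.mem_ofPred_eq, ← habs, abs_le, not_and_or,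
      not_le, Set.mem_union, Set.mem_Icc] at hx ⊢
    rcases hx with ⟨⟨h1, h2⟩, h3 | h3⟩ | ⟨⟨h1, h2⟩, h3 | h3⟩
    · left; constructor <;> linarith
    · right; constructor <;> linarith
    · left; constructor <;> linarith
    · right; constructor <;> linarith
  refine (measure_mono hsub).trans ((measure_union_le _ _).trans ?_)
  rw [Real.volume_Icc, Real.volume_Icc, ← ENNReal.ofReal_add (by linarith) (by linarith)]
  exact ENNReal.ofReal_le_ofReal (by linarith)

lemma volume_symmDiff_lpBall_two_single_le (m : ℕ) {a : ℝ} (ha : 0 ≤ a) :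
    volume (symmDiff (lpBall 2 (m + 1)) {z | z - Pi.single 0 a ∈ lpBall 2 (m + 1)}) ≤
      ENNReal.ofReal (2 * a * unitBallVolume 2 m) := by
  set T : Set (ℝ × (Fin m → ℝ)) :=
    symmDiff {w | w.1 ^ 2 + ∑ i, w.2 i ^ 2 ≤ 1} {w | (w.1 - a) ^ 2 + ∑ i, w.2 i ^ 2 ≤ 1} with hT
  have hTm : MeasurableSet T := by
    refine MeasurableSet.symmDiff ?_ ?_ <;>
    · refine measurableSet_le ?_ measurable_const
      fun_prop
  have hpre : symmDiff (lpBall 2 (m + 1)) {z | z - Pi.single 0 a ∈ lpBall 2 (m + 1)} =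
      MeasurableEquiv.piFinSuccAbove (fun _ : Fin (m + 1) => ℝ) 0 ⁻¹' T := by
    ext z
    simp [hT, Set.mem_symmDiff, mem_lpBall_two_iff, Fin.sum_univ_succ, Fin.tail]
  rw [hpre, (volume_preserving_piFinSuccAbove (fun _ : Fin (m + 1) => ℝ) 0).measure_preimage
    hTm.nullMeasurableSet, Measure.volume_eq_prod, Measure.prod_apply_symm hTm]
  have hb : ∀ y : Fin m → ℝ, volume ((fun x => (x, y)) ⁻¹' T) ≤
      (lpBall 2 m).indicator (fun _ => ENNReal.ofReal (2 * a)) y := by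
    intro y
    have he : (fun x => (x, y)) ⁻¹' T =
        symmDiff {x : ℝ | x ^ 2 ≤ 1 - ∑ i, y i ^ 2} {x : ℝ | (x - a) ^ 2 ≤ 1 - ∑ i, y i ^ 2} := by
      ext x
      simp [hT, Set.mem_symmDiff, le_sub_iff_add_le]
    by_cases hy : y ∈ lpBall 2 m
    · rw [Set.indicator_of_mem hy, he]
      exact volume_symmDiff_interval_le ha
    · rw [Set.indicator_of_notMem hy, he]
      rw [mem_lpBall_two_iff, not_le] at hy
      have h1 : ∀ x : ℝ, ¬ x ^ 2 ≤ 1 - ∑ i, y i ^ 2 := fun x hx => by nlinarith [sq_nonneg x]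
      simp [h1]
  refine (lintegral_mono hb).trans ?_
  rw [lintegral_indicator (measurableSet_lpBall one_le_two), setLIntegral_const, volume_lpBall_two,
    ← ENNReal.ofReal_mul (by linarith)]

lemma volume_symmDiff_lpBall_two_le (m : ℕ) (u : Fin (m + 1) → ℝ) :
    volume (symmDiff (lpBall 2 (m + 1)) {z | z - u ∈ lpBall 2 (m + 1)}) ≤
      ENNReal.ofReal (2 * _root_.lpNorm 2 u * unitBallVolume 2 m) := by
  let w : EuclideanSpace ℝ (Fin (m + 1)) := WithLp.toLp 2 u
  let s (v : EuclideanSpace ℝ (Fin (m + 1))) : Set (EuclideanSpace ℝ (Fin (m + 1))) :=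
    symmDiff {z | ‖z‖ ≤ 1} {z | ‖z - v‖ ≤ 1}
  have hs : ∀ v, MeasurableSet (s v) := fun v => by
    refine MeasurableSet.symmDiff ?_ ?_ <;>
    · refine measurableSet_le ?_ measurable_const
      fun_prop
  have hvol : ∀ v : Fin (m + 1) → ℝ,
      volume (symmDiff (lpBall 2 (m + 1)) {z | z - v ∈ lpBall 2 (m + 1)}) =
        volume (s (WithLp.toLp 2 v)) := by
    intro v
    rw [← (PiLp.volume_preserving_toLp (Fin (m + 1))).measure_preimage (hs _).nullMeasurableSet]
    congr 1
    ext z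
    simp [s, Set.mem_symmDiff, mem_lpBall_two_iff_norm]
  have hnorm : _root_.lpNorm 2 u = ‖w‖ := lpNorm_eq_norm one_le_two u
  let w' : EuclideanSpace ℝ (Fin (m + 1)) := WithLp.toLp 2 (Pi.single 0 ‖w‖)
  have hw' : ‖w‖ = ‖w'‖ := by
    rw [← lpNorm_eq_norm one_le_two (Pi.single 0 ‖w‖), lpNorm_single one_le_two, abs_of_nonneg (norm_nonneg w)]
  let e := (ℝ ∙ (w - w'))ᗮ.reflection
  have hew : e w = w' := Submodule.reflection_sub hw'
  have hrot : volume (s w) = volume (s w') := by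
    rw [← e.measurePreserving.measure_preimage (hs w').nullMeasurableSet]
    congr 1
    ext z
    simp only [s, Set.mem_symmDiff, Set.mem_preimage, Set.mem_ofPred_eq, e.norm_map, ← hew,
      ← map_sub]
  rw [hvol, show WithLp.toLp 2 u = w from rfl, hrot, ← hvol, hnorm]
  exact volume_symmDiff_lpBall_two_single_le m (norm_nonneg w)

end BallTranslation

section SoftThreshold

/-- Soft thresholding at level `ε`: moves `x` towards `0` by at most `ε`. -/
def softThreshold (ε x : ℝ) : ℝ := x - max (-ε) (min x ε)

lemma softThreshold_eq_zero {ε x : ℝ} (h : |x| ≤ ε) : softThreshold ε x = 0 := by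
  obtain ⟨h1, h2⟩ := abs_le.1 h
  simp [softThreshold, h1, h2]

lemma abs_softThreshold_sub_self_le {ε : ℝ} (hε : 0 ≤ ε) (x : ℝ) :
    |softThreshold ε x - x| ≤ ε := by
  rw [softThreshold, sub_sub_cancel_left, abs_neg, abs_le]
  exact ⟨le_max_left _ _, max_le (by linarith) (min_le_right _ _)⟩

lemma abs_softThreshold_sub_le (ε x y : ℝ) :
    |softThreshold ε x - softThreshold ε y| ≤ |x - y| := by
  wlog h : y ≤ x generalizing x y
  · rw [abs_sub_comm, abs_sub_comm x]
    exact this y x (le_of_not_ge h)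
  rw [abs_of_nonneg (sub_nonneg.2 h), abs_le]
  simp only [softThreshold, max_def, min_def]
  constructor <;> split_ifs <;> linarith

lemma continuous_softThreshold (ε : ℝ) : Continuous (softThreshold ε) := by
  unfold softThreshold
  fun_prop

end SoftThreshold

section BallCode

variable {m L : ℕ} {δ : ℝ}

/-- The symbol of a point: coordinatewise, the index modulo `L` of its cell of side `δ`. -/
def gridCode (δ : ℝ) (L : ℕ) {m : ℕ} (w : Fin m → ℝ) : Fin m → ZMod L := fun i => ⌊w i / δ⌋

lemma measurableSet_gridCode_eq (z : Fin m → ZMod L) :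
    MeasurableSet {w : Fin m → ℝ | gridCode δ L w = z} := by
  have h : {w : Fin m → ℝ | gridCode δ L w = z} =
      ⋂ i, (fun w : Fin m → ℝ => ⌊w i / δ⌋) ⁻¹' {k : ℤ | (k : ZMod L) = z i} := by
    ext w
    simp [gridCode, funext_iff]
  rw [h]
  refine MeasurableSet.iInter fun i => ?_
  have : Measurable fun w : Fin m → ℝ => ⌊w i / δ⌋ := by fun_prop
  exact this (.of_discrete)

/-- The law of the symbol of a uniform random point of the Euclidean unit ball centred at `y`. -/
def ballCode (δ : ℝ) (L : ℕ) {m : ℕ} (y : Fin m → ℝ) (z : Fin m → ZMod L) : ℝ≥0∞ :=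
  (volume (lpBall 2 m))⁻¹ * volume ({w | w - y ∈ lpBall 2 m} ∩ {w | gridCode δ L w = z})

lemma measurable_ballCode (z : Fin m → ZMod L) : Measurable fun y => ballCode δ L y z := by
  refine Measurable.const_mul ?_ _
  have hT : MeasurableSet {a : (Fin m → ℝ) × (Fin m → ℝ) |
      a.2 - a.1 ∈ lpBall 2 m ∧ gridCode δ L a.2 = z} :=
    ((measurable_snd.sub measurable_fst) (measurableSet_lpBall one_le_two)).inter
      (measurable_snd (measurableSet_gridCode_eq z))
  exact measurable_measure_prodMk_left hT

lemma measurableSet_sub_mem_lpBall (y : Fin m → ℝ) :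
    MeasurableSet {w | w - y ∈ lpBall 2 m} :=
  (measurable_id.sub_const y) (measurableSet_lpBall one_le_two)

lemma volume_sub_mem_lpBall (y : Fin m → ℝ) :
    volume {w | w - y ∈ lpBall 2 m} = volume (lpBall 2 m) :=
  (measurePreserving_sub_right volume y).measure_preimage
    (measurableSet_lpBall one_le_two).nullMeasurableSet

lemma sum_volume_inter_gridCode [NeZero L] {T : Set (Fin m → ℝ)} (hT : MeasurableSet T) :
    ∑ z, volume (T ∩ {w | gridCode δ L w = z}) = volume T := by
  rw [← measure_biUnion_finset]
  · congr 1
    ext w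
    simp
  · intro a _ b _ hab
    refine Set.disjoint_left.2 fun w hwa hwb => hab ?_
    exact hwa.2.symm.trans hwb.2
  · exact fun z _ => hT.inter (measurableSet_gridCode_eq z)

lemma sum_ballCode [NeZero L] (y : Fin m → ℝ) : ∑ z, ballCode δ L y z = 1 := by
  simp only [ballCode]
  rw [← Finset.mul_sum, sum_volume_inter_gridCode (measurableSet_sub_mem_lpBall y),
    volume_sub_mem_lpBall,
    ENNReal.inv_mul_cancel volume_lpBall_two_ne_zero volume_lpBall_two_ne_top]

lemma exists_of_ballCode_ne_zero {y : Fin m → ℝ} {z : Fin m → ZMod L} (h : ballCode δ L y z ≠ 0) :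
    ∃ v ∈ lpBall 2 m, gridCode δ L (y + v) = z := by
  have h2 : volume ({w | w - y ∈ lpBall 2 m} ∩ {w | gridCode δ L w = z}) ≠ 0 :=
    right_ne_zero_of_mul h
  obtain ⟨w, hw1, hw2⟩ := nonempty_of_measure_ne_zero h2
  exact ⟨w - y, hw1, by simpa using hw2⟩

lemma absDiff_mul_left {c : ℝ≥0∞} (hc : c ≠ ∞) (a b : ℝ≥0∞) :
    absDiff (c * a) (c * b) = c * absDiff a b := by
  rw [absDiff, absDiff, ← ENNReal.mul_sub fun _ _ => hc, ← ENNReal.mul_sub fun _ _ => hc, mul_add]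

lemma absDiff_measure_le {Ω : Type*} [MeasurableSpace Ω] (μ : Measure Ω) {s t : Set Ω}
    (hs : MeasurableSet s) (ht : MeasurableSet t) : absDiff (μ s) (μ t) ≤ μ (symmDiff s t) := by
  rw [Set.symmDiff_def, measure_union (Set.disjoint_left.2 fun x h1 h2 => h2.2 h1.1) (ht.diff hs)]
  exact add_le_add le_measure_sdiff le_measure_sdiff

lemma sum_absDiff_ballCode_le [NeZero L] (y y' : Fin (m + 1) → ℝ) :
    ∑ z, absDiff (ballCode δ L y z) (ballCode δ L y' z) ≤
      ENNReal.ofReal (2 * (unitBallVolume 2 m / unitBallVolume 2 (m + 1)) *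
        _root_.lpNorm 2 (y - y')) := by
  set V := volume (lpBall 2 (m + 1)) with hV
  have hV0 : V⁻¹ ≠ ∞ := by simpa using volume_lpBall_two_ne_zero
  set A : Set (Fin (m + 1) → ℝ) := {w | w - y ∈ lpBall 2 (m + 1)}
  set A' : Set (Fin (m + 1) → ℝ) := {w | w - y' ∈ lpBall 2 (m + 1)}
  have hA : MeasurableSet A := measurableSet_sub_mem_lpBall y
  have hA' : MeasurableSet A' := measurableSet_sub_mem_lpBall y'
  have h1 : ∀ z, absDiff (ballCode δ L y z) (ballCode δ L y' z) ≤
      V⁻¹ * volume (symmDiff A A' ∩ {w | gridCode δ L w = z}) := by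
    intro z
    have hz := measurableSet_gridCode_eq (δ := δ) z
    rw [ballCode, ballCode, absDiff_mul_left hV0]
    gcongr
    refine (absDiff_measure_le volume (hA.inter hz) (hA'.inter hz)).trans (measure_mono ?_)
    rintro w (⟨⟨a, b⟩, c⟩ | ⟨⟨a, b⟩, c⟩)
    · exact ⟨Or.inl ⟨a, fun h => c ⟨h, b⟩⟩, b⟩
    · exact ⟨Or.inr ⟨a, fun h => c ⟨h, b⟩⟩, b⟩
  have h2 : volume (symmDiff A A') ≤
      ENNReal.ofReal (2 * _root_.lpNorm 2 (y' - y) * unitBallVolume 2 m) := by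
    refine le_trans (le_of_eq ?_) (volume_symmDiff_lpBall_two_le m (y' - y))
    rw [← (measurePreserving_sub_right volume y).measure_preimage
      (((measurableSet_lpBall one_le_two).symmDiff
        (measurableSet_sub_mem_lpBall (y' - y))).nullMeasurableSet)]
    congr 1
    ext w
    simp [A, A', Set.mem_symmDiff]
  calc _ ≤ ∑ z, V⁻¹ * volume (symmDiff A A' ∩ {w | gridCode δ L w = z}) :=
        Finset.sum_le_sum fun z _ => h1 z
    _ = V⁻¹ * volume (symmDiff A A') := by
        rw [← Finset.mul_sum, sum_volume_inter_gridCode (hA.symmDiff hA')]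
    _ ≤ V⁻¹ * ENNReal.ofReal (2 * _root_.lpNorm 2 (y' - y) * unitBallVolume 2 m) := by gcongr
    _ = _ := by
        rw [hV, volume_lpBall_two, ← ENNReal.ofReal_inv_of_pos (unitBallVolume_pos _ _),
          ← ENNReal.ofReal_mul (inv_nonneg.2 (unitBallVolume_pos _ _).le),
          lpNorm_sub_comm one_le_two]
        congr 1
        field_simp

end BallCode

section Consistency

variable {m L : ℕ} {ε δ : ℝ}

/-- Coordinatewise soft thresholding of `x` rescaled to unit scale `R`. -/
def rescale (ε R : ℝ) {m : ℕ} (x : Fin m → ℝ) : Fin m → ℝ := fun i => softThreshold ε (x i / R)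

lemma continuous_rescale (ε R : ℝ) : Continuous (rescale ε R : (Fin m → ℝ) → Fin m → ℝ) :=
  by
  have := continuous_softThreshold ε
  unfold rescale
  fun_prop

lemma rescale_eq_zero {R : ℝ} (hR : 0 < R) {x : Fin m → ℝ} (h : ∀ i, |x i| ≤ ε * R) :
    rescale ε R x = 0 := by
  ext i
  refine softThreshold_eq_zero ?_
  rw [abs_div, abs_of_pos hR, div_le_iff₀ hR]
  exact h i

lemma lpNorm_rescale_sub_le {R : ℝ} (hR : 0 < R) (x x' : Fin m → ℝ) :
    _root_.lpNorm 2 (rescale ε R x - rescale ε R x') ≤ _root_.lpNorm 2 (x - x') / R := by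
  rw [div_eq_inv_mul, ← abs_of_pos (inv_pos.2 hR), ← lpNorm_smul one_le_two]
  refine lpNorm_mono one_le_two fun i => (abs_softThreshold_sub_le ε _ _).trans (le_of_eq ?_)
  simp only [Pi.smul_apply, Pi.sub_apply, smul_eq_mul]
  congr 1
  field_simp

lemma lpNorm_le_card_mul (z : Fin m → ℝ) {s : ℝ} (h : ∀ i, |z i| ≤ s) :
    _root_.lpNorm 2 z ≤ m * s := by
  refine (lpNorm_le_sum one_le_two z).trans ((Finset.sum_le_sum fun i _ => h i).trans ?_)
  simp

lemma exists_shift_of_ballCode_ne_zero (hε : 0 ≤ ε) (hδ : 0 < δ) {R : ℝ} (hR : 0 < R)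
    {x x' : Fin m → ℝ} {z : Fin m → ZMod L}
    (h : ballCode δ L (rescale ε R x) z ≠ 0) (h' : ballCode δ L (rescale ε R x') z ≠ 0) :
    ∃ κ : Fin m → ℤ, _root_.lpNorm 2 (x - x' - (R * (L * δ)) • fun i => (κ i : ℝ)) ≤
      (2 + m * (δ + 2 * ε)) * R := by
  obtain ⟨v, hv, hvz⟩ := exists_of_ballCode_ne_zero h
  obtain ⟨v', hv', hvz'⟩ := exists_of_ballCode_ne_zero h'
  set a : Fin m → ℝ := fun i => (rescale ε R x + v) i / δ with ha
  set b : Fin m → ℝ := fun i => (rescale ε R x' + v') i / δ with hb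
  have hk : ∀ i, ∃ k : ℤ, ⌊a i⌋ - ⌊b i⌋ = L * k := by
    intro i
    have : ((⌊b i⌋ : ℤ) : ZMod L) = (⌊a i⌋ : ℤ) := by
      have := congrFun (hvz'.trans hvz.symm) i
      exact this
    exact (ZMod.intCast_eq_intCast_iff_dvd_sub _ _ L).1 this
  choose κ hκ using hk
  refine ⟨κ, ?_⟩
  set e : Fin m → ℝ := fun i => R * (rescale ε R x' i - x' i / R) - R * (rescale ε R x i - x i / R)
    + R * δ * (a i - b i - L * κ i) with he
  have hx : x - x' - (R * (L * δ)) • (fun i => (κ i : ℝ)) = e + R • (v' - v) := by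
    ext i
    simp only [he, ha, hb, Pi.sub_apply, Pi.smul_apply, Pi.add_apply, smul_eq_mul]
    field_simp
    ring
  have hei : ∀ i, |e i| ≤ R * (δ + 2 * ε) := by
    intro i
    have h1 := abs_le.1 (abs_softThreshold_sub_self_le hε (x i / R))
    have h2 := abs_le.1 (abs_softThreshold_sub_self_le hε (x' i / R))
    have h3 : (⌊a i⌋ : ℝ) - ⌊b i⌋ = L * κ i := by exact_mod_cast hκ i
    have h4 := Int.floor_le (a i)
    have h5 := Int.lt_floor_add_one (a i)
    have h6 := Int.floor_le (b i)
    have h7 := Int.lt_floor_add_one (b i)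
    have h8 : -1 ≤ a i - b i - L * κ i := by linarith
    have h9 : a i - b i - L * κ i ≤ 1 := by linarith
    have e1 : e i = R * ((rescale ε R x' i - x' i / R) - (rescale ε R x i - x i / R)
      + δ * (a i - b i - L * κ i)) := by simp only [he]; ring
    rw [e1, abs_mul, abs_of_pos hR]
    refine mul_le_mul_of_nonneg_left ?_ hR.le
    rw [abs_le]
    simp only [rescale]
    constructor <;> nlinarith
  rw [hx]
  have h1 := lpNorm_le_card_mul e hei
  have h2 : _root_.lpNorm 2 (R • (v' - v)) ≤ R * 2 := by
    rw [lpNorm_smul one_le_two, abs_of_pos hR]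
    refine mul_le_mul_of_nonneg_left ((lpNorm_sub_le one_le_two _ _).trans ?_) hR.le
    have h3 : _root_.lpNorm 2 v ≤ 1 := hv
    have h4 : _root_.lpNorm 2 v' ≤ 1 := hv'
    linarith
  refine (lpNorm_add_le one_le_two _ _).trans ?_
  linarith

/-- If two points are close modulo a lattice at every scale above `k`, and the lattices are
coarse enough, then the points are close at every scale above `k`. -/
lemma lpNorm_sub_le_of_shift {R : ℤ → ℝ} {lam D P : ℝ} (hR : ∀ k, 0 < R k) (hlam : 1 < lam)
    (hRs : ∀ k, R (k + 1) = lam * R k) (hD : 0 < D) (hP : D * (lam + 1) < P)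
    {x x' : Fin m → ℝ} {k : ℤ}
    (h : ∀ j > k, ∃ κ : Fin m → ℤ,
      _root_.lpNorm 2 (x - x' - (R j * P) • fun i => (κ i : ℝ)) ≤ D * R j) :
    ∀ j > k, _root_.lpNorm 2 (x - x') ≤ D * R j := by
  have step : ∀ j > k, _root_.lpNorm 2 (x - x') ≤ D * R (j + 1) →
      _root_.lpNorm 2 (x - x') ≤ D * R j := by
    intro j hj hj1
    obtain ⟨κ, hκ⟩ := h j hj
    have hz : (fun i => (κ i : ℝ)) = 0 := by
      by_contra hne
      obtain ⟨i, hi⟩ := Function.ne_iff.1 hne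
      have h1 : (1 : ℝ) ≤ |(κ i : ℝ)| := by
        have : κ i ≠ 0 := by simpa using hi
        exact_mod_cast Int.one_le_abs this
      have h2 := abs_le_lpNorm (p := 2) one_le_two ((R j * P) • fun i => (κ i : ℝ)) i
      have h3 := lpNorm_sub_le (p := 2) one_le_two (x - x')
        (x - x' - (R j * P) • fun i => (κ i : ℝ))
      rw [show x - x' - (x - x' - (R j * P) • fun i => (κ i : ℝ)) =
        (R j * P) • fun i => (κ i : ℝ) from sub_sub_self _ _] at h3
      have hP0 : 0 < P := lt_trans (by positivity) hP
      have h4 : R j * P ≤ |((R j * P) • fun i => (κ i : ℝ)) i| := by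
        simp only [Pi.smul_apply, smul_eq_mul, abs_mul, abs_of_pos (hR j), abs_of_pos hP0]
        nlinarith [mul_pos (hR j) hP0]
      rw [hRs] at hj1
      nlinarith [hR j]
    rw [hz] at hκ
    simpa using hκ
  have steps : ∀ i : ℕ, ∀ j > k, _root_.lpNorm 2 (x - x') ≤ D * R (j + i) →
      _root_.lpNorm 2 (x - x') ≤ D * R j := by
    intro i
    induction i with
    | zero => intro j _ hj; simpa using hj
    | succ i ih =>
      intro j hj hji
      refine ih j hj (step (j + i) (by lia) ?_)
      rw [add_assoc]
      exact_mod_cast hji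
  intro j hj
  have hpow : ∀ i : ℕ, R (j + i) = lam ^ i * R j := by
    intro i
    induction i with
    | zero => simp
    | succ i ih =>
      rw [Nat.cast_succ, ← add_assoc, hRs, ih]
      ring
  obtain ⟨i, hi⟩ := pow_unbounded_of_one_lt (_root_.lpNorm 2 (x - x') / (D * R j)) hlam
  refine steps i j hj ?_
  rw [div_lt_iff₀ (by have := hR j; positivity)] at hi
  rw [hpow]
  linarith

end Consistency

section EuclideanScaleCode

/-- A geometric sequence of scales. -/
structure IsScale (lam : ℝ) (R : ℤ → ℝ) : Prop where
  pos : ∀ k, 0 < R k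
  one_lt : 1 < lam
  succ : ∀ k, R (k + 1) = lam * R k
  tendsto_atBot : Filter.Tendsto R Filter.atBot (nhds 0)
  tendsto_atTop : Filter.Tendsto R Filter.atTop Filter.atTop

lemma IsScale.add_nat {lam : ℝ} {R : ℤ → ℝ} (h : IsScale lam R) (k : ℤ) (i : ℕ) :
    R (k + i) = lam ^ i * R k := by
  induction i with
  | zero => simp
  | succ i ih =>
    rw [Nat.cast_succ, ← add_assoc, h.succ, ih]
    ring

lemma IsScale.mono {lam : ℝ} {R : ℤ → ℝ} (h : IsScale lam R) : Monotone R :=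
  monotone_int_of_le_succ fun k => by
    rw [h.succ]
    nlinarith [h.pos k, h.one_lt]

variable {n L : ℕ} {ε δ lam q : ℝ} {R : ℤ → ℝ}

lemma lpNorm_sub_le_of_consistent (hε : 0 < ε) (hδ : 0 < δ) (hR : IsScale lam R)
    (hL : (2 + n * (δ + 2 * ε)) * (lam + 1) < L * δ) {k : ℤ} {x x' : Fin n → ℝ}
    {y : ℤ → Fin n → ZMod L}
    (h : ∀ j > k, ballCode δ L (rescale ε (R j) x) (y j) ≠ 0 ∧
      ballCode δ L (rescale ε (R j) x') (y j) ≠ 0) :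
    _root_.lpNorm 2 (x - x') ≤ (2 + n * (δ + 2 * ε)) * R (k + 1) :=
  lpNorm_sub_le_of_shift hR.pos hR.one_lt hR.succ (by positivity) hL
    (fun j hj => exists_shift_of_ballCode_ne_zero hε.le hδ (hR.pos j) (h j hj).1 (h j hj).2)
    _ (by lia)

/-- The multiscale code of Euclidean space given by uniform random points of balls, recorded up
to a periodic grid. -/
def euclideanScaleCode [NeZero L] (q : ℝ) (hq : 0 < q) (hε : 0 < ε) (hδ : 0 < δ)
    (hR : IsScale lam R) (hL : (2 + n * (δ + 2 * ε)) * (lam + 1) < L * δ) :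
    ScaleCode (Fin n → ℝ) (Fin n → ZMod L)
      fun x y => ENNReal.ofReal (_root_.lpNorm 2 (x - y) ^ q) where
  N k x z := ballCode δ L (rescale ε (R k) x) z
  x0 := 0
  β := Finset.univ.inf fun z : Fin n → ZMod L =>
    if ballCode δ L (0 : Fin n → ℝ) z = 0 then ∞ else ballCode δ L (0 : Fin n → ℝ) z
  c0 := (pow_unbounded_of_one_lt ((2 + n * (δ + 2 * ε)) / ε) hR.one_lt).choose
  D k := (2 + n * (δ + 2 * ε)) * R (k + 1)
  w k := ENNReal.ofReal (((2 + n * (δ + 2 * ε)) * R (k + 1)) ^ q)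
  measurable_N k z := (measurable_ballCode z).comp (continuous_rescale ε (R k)).measurable
  sum_N k x := sum_ballCode _
  β_ne_zero := by
    rw [← pos_iff_ne_zero, Finset.lt_inf_iff (by simp)]
    intro z _
    split_ifs with h
    · simp
    · exact pos_iff_ne_zero.2 h
  β_le k z hz := by
    rw [rescale_eq_zero (hR.pos k) (fun i => by simpa using (mul_pos hε (hR.pos k)).le)] at hz ⊢
    refine (Finset.inf_le (Finset.mem_univ z)).trans ?_
    rw [if_neg hz]
  exists_base x := by
    obtain ⟨J, hJ⟩ := Filter.eventually_atTop.1
      (hR.tendsto_atTop.eventually_ge_atTop (_root_.lpNorm 2 x / ε))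
    refine ⟨J, fun j hj => ?_⟩
    have h0 := (div_le_iff₀' hε).1 (hJ j hj)
    rw [rescale_eq_zero (hR.pos j) fun i => (abs_le_lpNorm one_le_two x i).trans h0,
      rescale_eq_zero (hR.pos j) fun i => by simpa using (mul_pos hε (hR.pos j)).le]
  base_of_consistent K x y h j hj := by
    have h1 := lpNorm_sub_le_of_consistent hε hδ hR hL h
    rw [sub_zero] at h1
    have hc := (pow_unbounded_of_one_lt ((2 + n * (δ + 2 * ε)) / ε) hR.one_lt).choose_spec
    set c0 := (pow_unbounded_of_one_lt ((2 + n * (δ + 2 * ε)) / ε) hR.one_lt).choose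
    rw [div_lt_iff₀ hε] at hc
    have h2 : R (K + 1 + c0) ≤ R j := hR.mono (by lia)
    rw [hR.add_nat] at h2
    have h3 : _root_.lpNorm 2 x ≤ ε * R j := by nlinarith [hR.pos (K + 1)]
    rw [rescale_eq_zero (hR.pos j) fun i => (abs_le_lpNorm one_le_two x i).trans h3,
      rescale_eq_zero (hR.pos j) fun i => by simpa using (mul_pos hε (hR.pos j)).le]
  loc k x x' y h := by
    have h1 := lpNorm_sub_le_of_consistent hε hδ hR hL h
    have h0 := lpNorm_nonneg (p := 2) one_le_two (x - x')
    refine ⟨(dist_pi_le_iff (h0.trans h1)).2 fun i => ?_, ?_⟩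
    · rw [Real.dist_eq]
      exact (abs_le_lpNorm one_le_two (x - x') i).trans h1
    · exact ENNReal.ofReal_le_ofReal (Real.rpow_le_rpow h0 h1 hq.le)
  D_pos k := by
    have := hR.pos (k + 1)
    positivity
  tendsto_D := by
    have h : Filter.Tendsto (fun k : ℤ => k + 1) Filter.atBot Filter.atBot :=
      Filter.tendsto_atBot_add_const_right _ _ Filter.tendsto_id
    simpa using (hR.tendsto_atBot.comp h).const_mul (2 + n * (δ + 2 * ε))

variable {m : ℕ}

lemma euclideanScaleCode_gap_le [NeZero L] (hq : 0 < q) (hε : 0 < ε) (hδ : 0 < δ)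
    (hR : IsScale lam R) (hL : (2 + (m + 1 : ℕ) * (δ + 2 * ε)) * (lam + 1) < L * δ) (k : ℤ)
    (x x' : Fin (m + 1) → ℝ) :
    (euclideanScaleCode q hq hε hδ hR hL).gap k x x' ≤
      ENNReal.ofReal (2 * (unitBallVolume 2 m / unitBallVolume 2 (m + 1)) *
        (_root_.lpNorm 2 (x - x') / R k)) := by
  refine (sum_absDiff_ballCode_le _ _).trans (ENNReal.ofReal_le_ofReal ?_)
  have h1 := unitBallVolume_pos 2 m
  have h2 := unitBallVolume_pos 2 (m + 1)
  exact mul_le_mul_of_nonneg_left (lpNorm_rescale_sub_le (hR.pos k) _ _) (by positivity)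

lemma euclideanScaleCode_totalGap_le [NeZero L] (hq : 0 < q) (hε : 0 < ε) (hδ : 0 < δ)
    (hR : IsScale lam R) (hL : (2 + (m + 1 : ℕ) * (δ + 2 * ε)) * (lam + 1) < L * δ) (k : ℤ)
    (x x' : Fin (m + 1) → ℝ) :
    (euclideanScaleCode q hq hε hδ hR hL).totalGap k x x' ≤
      ENNReal.ofReal (2 * min 1 (unitBallVolume 2 m / unitBallVolume 2 (m + 1) *
        (1 - lam⁻¹)⁻¹ * _root_.lpNorm 2 (x - x') / R k)) := by
  set ρ := unitBallVolume 2 m / unitBallVolume 2 (m + 1) with hρ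
  have hρ0 : 0 < ρ := div_pos (unitBallVolume_pos _ _) (unitBallVolume_pos _ _)
  set d := _root_.lpNorm 2 (x - x')
  have hd : 0 ≤ d := lpNorm_nonneg one_le_two _
  have hl := hR.one_lt
  have hli : lam⁻¹ < 1 := inv_lt_one_of_one_lt₀ hl
  have hli0 : 0 < lam⁻¹ := by positivity
  have hRk := hR.pos k
  rw [mul_min_of_nonneg _ _ (by norm_num), ENNReal.ofReal_min]
  refine min_le_min (by simp) ?_
  have h1 : ∀ j : ℕ, (euclideanScaleCode q hq hε hδ hR hL).gap (k + j) x x' ≤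
      ENNReal.ofReal (2 * ρ * (d / R k) * lam⁻¹ ^ j) := by
    intro j
    refine (euclideanScaleCode_gap_le hq hε hδ hR hL _ x x').trans (ENNReal.ofReal_le_ofReal ?_)
    rw [hR.add_nat, inv_pow]
    refine le_of_eq ?_
    change 2 * ρ * (d / (lam ^ j * R k)) = _
    field_simp
  refine (ENNReal.tsum_le_tsum h1).trans (le_of_eq ?_)
  have hs := summable_geometric_of_lt_one hli0.le hli
  rw [← ENNReal.ofReal_tsum_of_nonneg (fun j => by positivity) (hs.mul_left _), tsum_mul_left,
    tsum_geometric_of_lt_one hli0.le hli]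
  congr 1
  field_simp

end EuclideanScaleCode

section GeometricSums

/-- The scale `exp (s j)` raised to the power `q`, cut off at the value `v`. -/
def scaleTerm (q s v : ℝ) (j : ℤ) : ℝ := Real.exp (s * j) ^ q * min 1 (v / Real.exp (s * j))

lemma tsum_exp_neg_mul {b c : ℝ} (hb : 0 < b) (hc : 0 ≤ c) :
    ∑' i : ℕ, ENNReal.ofReal (c * Real.exp (-b) ^ i) = ENNReal.ofReal (c * (1 - Real.exp (-b))⁻¹) := by
  have h1 : Real.exp (-b) < 1 := by simpa using hb
  rw [← ENNReal.ofReal_tsum_of_nonneg (fun i => by positivity)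
    ((summable_geometric_of_lt_one (Real.exp_pos _).le h1).mul_left c), tsum_mul_left,
    tsum_geometric_of_lt_one (Real.exp_pos _).le h1]

lemma tsum_scaleTerm_le {q s v : ℝ} (hq0 : 0 < q) (hq1 : q < 1) (hs : 0 < s) (hv : 0 ≤ v) :
    ∑' j : ℤ, ENNReal.ofReal (scaleTerm q s v j) ≤
      ENNReal.ofReal (v ^ q * ((1 - Real.exp (-(s * q)))⁻¹ + (1 - Real.exp (-(s * (1 - q))))⁻¹)) := by
  rcases hv.eq_or_lt with rfl | hv
  · simp [scaleTerm]
  set J : ℤ := ⌊Real.log v / s⌋ + 1 with hJ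
  have hJ1 : s * (J - 1) ≤ Real.log v := by
    have := Int.floor_le (Real.log v / s)
    rw [le_div_iff₀ hs] at this
    rw [hJ]
    push_cast
    linarith
  have hJ2 : Real.log v ≤ s * J := by
    have := (Int.lt_floor_add_one (Real.log v / s)).le
    rw [div_le_iff₀ hs] at this
    rw [hJ]
    push_cast
    linarith
  have hvq : v ^ q = Real.exp (q * Real.log v) := by
    rw [Real.rpow_def_of_pos hv, mul_comm]
  have hv' : v = Real.exp (Real.log v) := (Real.exp_log hv).symm
  have hup : ∀ i : ℕ, scaleTerm q s v (i + J) ≤ v ^ q * Real.exp (-(s * (1 - q))) ^ i := by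
    intro i
    calc scaleTerm q s v (i + J)
        ≤ Real.exp (s * (i + J : ℤ)) ^ q * (v / Real.exp (s * (i + J : ℤ))) := by
          unfold scaleTerm
          gcongr
          exact min_le_right _ _
      _ = Real.exp (q * (s * (i + J : ℤ)) + (Real.log v - s * (i + J : ℤ))) := by
          rw [Real.exp_add, Real.exp_sub, Real.exp_log hv, ← Real.exp_mul, mul_comm q]
      _ ≤ Real.exp (q * Real.log v + i * (-(s * (1 - q)))) := by
          refine Real.exp_le_exp.2 ?_
          push_cast
          nlinarith
      _ = _ := by rw [Real.exp_add, Real.exp_nat_mul, hvq]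
  have hdown : ∀ i : ℕ, scaleTerm q s v (-(i + 1) + J) ≤ v ^ q * Real.exp (-(s * q)) ^ i := by
    intro i
    calc scaleTerm q s v (-(i + 1) + J)
        ≤ Real.exp (s * (-(i + 1) + J : ℤ)) ^ q * 1 := by
          unfold scaleTerm
          gcongr
          exact min_le_left _ _
      _ = Real.exp (q * (s * (-(i + 1) + J : ℤ))) := by
          rw [mul_one, ← Real.exp_mul, mul_comm q]
      _ ≤ Real.exp (q * Real.log v + i * (-(s * q))) := by
          refine Real.exp_le_exp.2 ?_
          push_cast
          nlinarith
      _ = _ := by rw [Real.exp_add, Real.exp_nat_mul, hvq]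
  have hsplit := ((ENNReal.summable (f := fun i : ℕ =>
      ENNReal.ofReal (scaleTerm q s v ((i : ℤ) + J)))).hasSum.of_nat_of_neg_add_one
    (f := fun j : ℤ => ENNReal.ofReal (scaleTerm q s v (j + J)))
    (ENNReal.summable (f := fun i : ℕ =>
      ENNReal.ofReal (scaleTerm q s v (-((i : ℤ) + 1) + J)))).hasSum).tsum_eq
  rw [← (Equiv.addRight J).tsum_eq]
  simp only [Equiv.coe_addRight]
  rw [hsplit]
  have h1 : 0 ≤ (1 - Real.exp (-(s * q)))⁻¹ := by
    have : Real.exp (-(s * q)) ≤ 1 := by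
      rw [Real.exp_le_one_iff]
      nlinarith
    exact inv_nonneg.2 (by linarith)
  have h2 : 0 ≤ (1 - Real.exp (-(s * (1 - q))))⁻¹ := by
    have : Real.exp (-(s * (1 - q))) ≤ 1 := by
      rw [Real.exp_le_one_iff]
      nlinarith
    exact inv_nonneg.2 (by linarith)
  rw [add_comm (1 - Real.exp (-(s * q)))⁻¹, mul_add, ENNReal.ofReal_add (by positivity) (by positivity),
    ← tsum_exp_neg_mul (mul_pos hs (by linarith)) (by positivity),
    ← tsum_exp_neg_mul (mul_pos hs hq0) (by positivity)]
  exact add_le_add (ENNReal.tsum_le_tsum fun i => ENNReal.ofReal_le_ofReal (hup i))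
    (ENNReal.tsum_le_tsum fun i => ENNReal.ofReal_le_ofReal (hdown i))

lemma sum_tsum_le_tsum {M : ℕ} (f : ℤ → ℝ≥0∞) :
    ∑ t : Fin M, ∑' k : ℤ, f (M * k + t) ≤ ∑' j, f j := by
  rw [← tsum_fintype (L := .unconditional _), ← ENNReal.tsum_prod]
  refine ENNReal.tsum_comp_le_tsum_of_injective (f := fun p : Fin M × ℤ => (M : ℤ) * p.2 + p.1) ?_ f
  rintro ⟨t, k⟩ ⟨t', k'⟩ h
  have ht := t.2
  have ht' := t'.2
  simp only at h
  have hk : k = k' := by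
    rcases lt_trichotomy k k' with hlt | h | hlt
    · nlinarith
    · exact h
    · nlinarith
  subst hk
  have : (t : ℤ) = t' := by linarith
  simpa [Fin.ext_iff] using this

lemma inv_one_sub_exp_neg_le {x : ℝ} (hx : 0 < x) : (1 - Real.exp (-x))⁻¹ ≤ 1 / x + 1 := by
  have h1 : Real.exp (-x) ≤ (1 + x)⁻¹ := by
    rw [Real.exp_neg]
    exact inv_anti₀ (by linarith) (by linarith [Real.add_one_le_exp x])
  have h2 : x / (1 + x) ≤ 1 - Real.exp (-x) := by
    have : x / (1 + x) = 1 - (1 + x)⁻¹ := by field_simp; ring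
    linarith
  calc _ ≤ (x / (1 + x))⁻¹ := inv_anti₀ (by positivity) h2
    _ = _ := by field_simp

end GeometricSums

section EuclideanCoupling

/-- The scales `exp (s (M k + t))`, for a fixed residue `t`. -/
def geomScale (s : ℝ) (M t : ℕ) (k : ℤ) : ℝ := Real.exp (s * ((M * k + t : ℤ) : ℝ))

lemma isScale_geomScale {s : ℝ} (hs : 0 < s) {M : ℕ} (hM : M ≠ 0) (t : ℕ) :
    IsScale (Real.exp (s * M)) (geomScale s M t) := by
  have hM0 : (0 : ℝ) < M := by positivity
  refine ⟨fun k => Real.exp_pos _, by simpa using mul_pos hs hM0, fun k => ?_, ?_, ?_⟩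
  · rw [geomScale, geomScale, ← Real.exp_add]
    congr 1
    push_cast
    ring
  · refine Real.tendsto_exp_atBot.comp ?_
    refine Filter.Tendsto.const_mul_atBot hs ?_
    push_cast
    exact Filter.tendsto_atBot_add_const_right _ _
      (Filter.Tendsto.const_mul_atBot hM0 (tendsto_intCast_atBot_iff.2 Filter.tendsto_id))
  · refine Real.tendsto_exp_atTop.comp ?_
    refine Filter.Tendsto.const_mul_atTop hs ?_
    push_cast
    exact Filter.tendsto_atTop_add_const_right _ _
      (Filter.Tendsto.const_mul_atTop hM0 tendsto_intCast_atTop_atTop)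

lemma sum_tsum_scale_le {q s v D : ℝ} (hq0 : 0 < q) (hq1 : q < 1) (hs : 0 < s) (hv : 0 ≤ v)
    (hD : 0 ≤ D) (M : ℕ) :
    ∑ t : Fin M, ∑' k : ℤ, ENNReal.ofReal ((D * geomScale s M t (k + 1)) ^ q) *
        (ENNReal.ofReal (2 * min 1 (v / geomScale s M t k)) +
          ENNReal.ofReal (2 * min 1 (v / geomScale s M t (k + 1)))) ≤
      ENNReal.ofReal (2 * D ^ q * (Real.exp (s * M * q) + 1) * (v ^ q *
        ((1 - Real.exp (-(s * q)))⁻¹ + (1 - Real.exp (-(s * (1 - q))))⁻¹))) := by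
  have hpos : ∀ (t : ℕ) (k : ℤ), 0 < geomScale s M t k := fun t k => Real.exp_pos _
  have e1 : ∀ (t : ℕ) (k : ℤ), ENNReal.ofReal ((D * geomScale s M t (k + 1)) ^ q) *
      ENNReal.ofReal (2 * min 1 (v / geomScale s M t (k + 1))) =
        ENNReal.ofReal (2 * D ^ q) * ENNReal.ofReal (scaleTerm q s v (M * (k + 1) + t)) := by
    intro t k
    have := hpos t (k + 1)
    rw [← ENNReal.ofReal_mul (by positivity), ← ENNReal.ofReal_mul (by positivity),
      Real.mul_rpow hD this.le]
    congr 1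
    simp only [geomScale, scaleTerm]
    ring
  have e2 : ∀ (t : ℕ) (k : ℤ), ENNReal.ofReal ((D * geomScale s M t (k + 1)) ^ q) *
      ENNReal.ofReal (2 * min 1 (v / geomScale s M t k)) =
        ENNReal.ofReal (2 * D ^ q * Real.exp (s * M * q)) *
          ENNReal.ofReal (scaleTerm q s v (M * k + t)) := by
    intro t k
    have h1 : geomScale s M t (k + 1) = Real.exp (s * M) * geomScale s M t k := by
      rw [geomScale, geomScale, ← Real.exp_add]
      congr 1
      push_cast
      ring
    have := hpos t k
    rw [h1, ← ENNReal.ofReal_mul (by positivity), ← ENNReal.ofReal_mul (by positivity),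
      Real.mul_rpow hD (by positivity), Real.mul_rpow (by positivity) (by positivity),
      ← Real.exp_mul]
    congr 1
    simp only [geomScale, scaleTerm]
    ring
  have hS := (sum_tsum_le_tsum (M := M) fun j => ENNReal.ofReal (scaleTerm q s v j)).trans
    (tsum_scaleTerm_le hq0 hq1 hs hv)
  have hshift : ∀ t : ℕ, ∑' k : ℤ, ENNReal.ofReal (scaleTerm q s v (M * (k + 1) + t)) =
      ∑' k : ℤ, ENNReal.ofReal (scaleTerm q s v (M * k + t)) := fun t =>
    (Equiv.addRight (1 : ℤ)).tsum_eq fun k : ℤ => ENNReal.ofReal (scaleTerm q s v (M * k + t))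
  have e3 : ∀ t : ℕ, ∑' k : ℤ, ENNReal.ofReal ((D * geomScale s M t (k + 1)) ^ q) *
        (ENNReal.ofReal (2 * min 1 (v / geomScale s M t k)) +
          ENNReal.ofReal (2 * min 1 (v / geomScale s M t (k + 1)))) =
      ENNReal.ofReal (2 * D ^ q * (Real.exp (s * M * q) + 1)) *
        ∑' k : ℤ, ENNReal.ofReal (scaleTerm q s v (M * k + t)) := by
    intro t
    simp_rw [mul_add (ENNReal.ofReal ((D * geomScale s M t (_ + 1)) ^ q)), e1, e2]
    rw [ENNReal.tsum_add, ENNReal.tsum_mul_left, ENNReal.tsum_mul_left, hshift, ← add_mul,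
      ← ENNReal.ofReal_add (by positivity) (by positivity), mul_add_one]
  simp only [e3]
  rw [← Finset.mul_sum,
    ENNReal.ofReal_mul (p := 2 * D ^ q * (Real.exp (s * M * q) + 1)) (by positivity)]
  exact mul_le_mul_right hS _

end EuclideanCoupling

section EuclideanCouplingBound

instance zmodVectorMeasurableSpace (n L : ℕ) : MeasurableSpace (Fin n → ZMod L) := ⊤

instance zmodVectorMeasurableSingletonClass (n L : ℕ) :
    MeasurableSingletonClass (Fin n → ZMod L) := ⟨fun _ => trivial⟩

lemma exists_coupling_lintegral_le {q s η : ℝ} (hq0 : 0 < q) (hq1 : q < 1) (hs : 0 < s)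
    (hη : 0 < η) {M : ℕ} (hM : M ≠ 0) (m : ℕ) :
    ∃ f : ProbabilityMeasure (Fin (m + 1) → ℝ) → ℝ → (Fin (m + 1) → ℝ),
      IsCoupling (fun P : ProbabilityMeasure (Fin (m + 1) → ℝ) => (P : Measure _)) f ∧
      ∀ (P Q : ProbabilityMeasure (Fin (m + 1) → ℝ))
        (γ : Measure ((Fin (m + 1) → ℝ) × (Fin (m + 1) → ℝ))), IsProbabilityMeasure γ →
        γ.map Prod.fst = P → γ.map Prod.snd = Q →
        ∫⁻ u, ENNReal.ofReal (_root_.lpNorm 2 (f P u - f Q u) ^ q) ∂stdSpace ≤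
          ∫⁻ z, (M : ℝ≥0∞)⁻¹ * ENNReal.ofReal (2 * (2 + η) ^ q * (Real.exp (s * M * q) + 1) *
            ((unitBallVolume 2 m / unitBallVolume 2 (m + 1) * (1 - (Real.exp (s * M))⁻¹)⁻¹ *
              _root_.lpNorm 2 (z.1 - z.2)) ^ q *
            ((1 - Real.exp (-(s * q)))⁻¹ + (1 - Real.exp (-(s * (1 - q))))⁻¹))) ∂γ := by
  set lam := Real.exp (s * M) with hlam
  set δ : ℝ := η / (3 * (m + 1 : ℕ)) with hδ
  have hδ0 : 0 < δ := by positivity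
  have hD : 2 + (m + 1 : ℕ) * (δ + 2 * δ) = 2 + η := by
    rw [hδ]
    field_simp
    ring
  obtain ⟨L, hL⟩ := exists_nat_gt ((2 + η) * (lam + 1) / δ)
  rw [div_lt_iff₀ hδ0, ← hD] at hL
  have : NeZero L := ⟨by
    rintro rfl
    have : 0 < (2 + (m + 1 : ℕ) * (δ + 2 * δ)) * (lam + 1) := by positivity
    simp only [Nat.cast_zero, zero_mul] at hL
    linarith⟩
  have hR := isScale_geomScale hs hM
  set S : Fin M → ScaleCode (Fin (m + 1) → ℝ) (Fin (m + 1) → ZMod L)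
    fun x y => ENNReal.ofReal (_root_.lpNorm 2 (x - y) ^ q) :=
    fun t => euclideanScaleCode q hq0 hδ0 hδ0 (hR t) hL with hS
  obtain ⟨f, hf, hcost⟩ := exists_isCoupling (X := Fin (m + 1) → ℝ) (F := Fin (m + 1) → ZMod L)
    (cost := fun x y => _root_.lpNorm 2 (x - y) ^ q)
    (((continuous_lpNorm one_le_two).comp (continuous_fst.sub continuous_snd)).rpow_const
      fun _ => Or.inr hq0.le)
    (fun x => by simp [lpNorm_zero one_le_two, hq0.ne']) hM S
  refine ⟨f, hf, fun P Q γ hγ hP hQ => (hcost P Q γ hγ hP hQ).trans ?_⟩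
  set v : (Fin (m + 1) → ℝ) × (Fin (m + 1) → ℝ) → ℝ := fun z =>
    unitBallVolume 2 m / unitBallVolume 2 (m + 1) * (1 - lam⁻¹)⁻¹ *
      _root_.lpNorm 2 (z.1 - z.2) with hv
  have hvm : Measurable v :=
    (((continuous_lpNorm one_le_two).comp
      (continuous_fst.sub continuous_snd)).measurable).const_mul _
  have hv0 : ∀ z, 0 ≤ v z := fun z => by
    have h1 := unitBallVolume_pos 2 m
    have h2 := unitBallVolume_pos 2 (m + 1)
    have h3 : lam⁻¹ < 1 := inv_lt_one_of_one_lt₀ (hR 0).one_lt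
    have h4 : 0 < (1 - lam⁻¹)⁻¹ := inv_pos.2 (by linarith)
    have h5 := lpNorm_nonneg one_le_two (z.1 - z.2)
    positivity
  have hgap : ∀ (t : Fin M) (k : ℤ) z, (S t).totalGap k z.1 z.2 ≤
      ENNReal.ofReal (2 * min 1 (v z / geomScale s M t k)) := fun t k z =>
    euclideanScaleCode_totalGap_le hq0 hδ0 hδ0 (hR t) hL k z.1 z.2
  have hm : ∀ (t : Fin M) (k : ℤ), Measurable fun z =>
      ENNReal.ofReal (2 * min 1 (v z / geomScale s M t k)) := fun t k =>
    ((measurable_const.min (hvm.div_const _)).const_mul 2).ennreal_ofReal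
  have hbound : ∀ (t : Fin M) (k : ℤ), (S t).w k *
      (∫⁻ z, (S t).totalGap k z.1 z.2 ∂γ + ∫⁻ z, (S t).totalGap (k + 1) z.1 z.2 ∂γ) ≤
      ∫⁻ z, ENNReal.ofReal (((2 + η) * geomScale s M t (k + 1)) ^ q) *
        (ENNReal.ofReal (2 * min 1 (v z / geomScale s M t k)) +
          ENNReal.ofReal (2 * min 1 (v z / geomScale s M t (k + 1)))) ∂γ := by
    intro t k
    rw [lintegral_const_mul _ ((hm t k).fun_add (hm t (k + 1))), lintegral_add_left (hm t k), ← hD]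
    exact mul_le_mul_right (add_le_add (lintegral_mono (hgap t k))
      (lintegral_mono (hgap t (k + 1)))) _
  have hm' : ∀ (t : Fin M) (k : ℤ), Measurable fun z =>
      ENNReal.ofReal (((2 + η) * geomScale s M t (k + 1)) ^ q) *
        (ENNReal.ofReal (2 * min 1 (v z / geomScale s M t k)) +
          ENNReal.ofReal (2 * min 1 (v z / geomScale s M t (k + 1)))) := fun t k =>
    ((hm t k).fun_add (hm t (k + 1))).const_mul _
  refine (mul_le_mul_right (Finset.sum_le_sum fun t _ =>
    ENNReal.tsum_le_tsum fun k => hbound t k) _).trans ?_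
  simp_rw [← lintegral_tsum fun k => (hm' _ k).aemeasurable]
  rw [← lintegral_finsetSum _ fun t _ => Measurable.tsum fun k => hm' t k,
    ← lintegral_const_mul _ (Finset.measurable_fun_sum _ fun t _ =>
      Measurable.tsum fun k => hm' t k)]
  exact lintegral_mono fun z => mul_le_mul_right
    (sum_tsum_scale_le hq0 hq1 hs (hv0 z) (by positivity) M) _

end EuclideanCouplingBound

section EuclideanConstant

lemma exp_le_and_le_exp : (5.259 : ℝ) ≤ Real.exp 1.66 ∧ Real.exp 1.66 ≤ 5.26 := by
  have h : Real.exp 1.66 = Real.exp (83 / 100) ^ 2 := by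
    rw [← Real.exp_nat_mul]
    norm_num
  have h1 := Real.sum_le_exp_of_nonneg (x := 83 / 100) (by norm_num) 9
  have h2 := Real.exp_bound' (x := 83 / 100) (by norm_num) (by norm_num) (n := 9) (by norm_num)
  simp only [Finset.sum_range_succ, Finset.sum_range_zero, Nat.factorial] at h1 h2
  norm_num at h1 h2
  rw [h]
  constructor
  · refine le_trans ?_ (pow_le_pow_left₀ (by norm_num) h1 2)
    norm_num
  · refine (pow_le_pow_left₀ (Real.exp_pos _).le h2 2).trans ?_
    norm_num

lemma coupling_constant_le {q ρ d : ℝ} (hq0 : 0 < q) (hq1 : q < 1) (hρ : 0 ≤ ρ) (hd : 0 ≤ d) :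
    (4000 : ℝ)⁻¹ * (2 * (2 + 0.0003) ^ q * (Real.exp (1.66 / (4000 * q) * 4000 * q) + 1) *
      ((ρ * (1 - (Real.exp (1.66 / (4000 * q) * 4000))⁻¹)⁻¹ * d) ^ q *
        ((1 - Real.exp (-(1.66 / (4000 * q) * q)))⁻¹ +
          (1 - Real.exp (-(1.66 / (4000 * q) * (1 - q))))⁻¹))) ≤
      7.55 / (1 - q) * (2.47 * ρ) ^ q * d ^ q := by
  have hq : 0 < 1 - q := by linarith
  obtain ⟨hl, hu⟩ := exp_le_and_le_exp
  have e1 : (1.66 : ℝ) / (4000 * q) * 4000 * q = 1.66 := by field_simp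
  have e2 : (1.66 : ℝ) ≤ 1.66 / (4000 * q) * 4000 := by
    have : (1.66 : ℝ) / (4000 * q) * 4000 = 1.66 / q := by field_simp
    rw [this, le_div_iff₀ hq0]
    linarith
  set E := Real.exp (1.66 / (4000 * q) * 4000) with hE
  have hE1 : 5.259 ≤ E := hl.trans (Real.exp_le_exp.2 e2)
  have hEinv : E⁻¹ ≤ (5.259 : ℝ)⁻¹ := inv_anti₀ (by norm_num) hE1
  have hE0 : 0 < 1 - E⁻¹ := by
    have : (5.259 : ℝ)⁻¹ < 1 := by norm_num
    linarith
  have h3 : (2 + 0.0003) * (1 - E⁻¹)⁻¹ ≤ (2.47 : ℝ) := by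
    rw [← div_eq_mul_inv, div_le_iff₀ hE0]
    have : (2 + 0.0003 : ℝ) ≤ 2.47 * (1 - (5.259 : ℝ)⁻¹) := by norm_num
    linarith
  have hbase : (2 + 0.0003 : ℝ) ^ q * (ρ * (1 - E⁻¹)⁻¹ * d) ^ q ≤ (2.47 * ρ) ^ q * d ^ q := by
    have h0 : 0 < (1 - E⁻¹)⁻¹ := inv_pos.2 hE0
    rw [← Real.mul_rpow (by norm_num) (by positivity), ← Real.mul_rpow (by positivity) hd]
    refine Real.rpow_le_rpow (by positivity) ?_ hq0.le
    calc (2 + 0.0003 : ℝ) * (ρ * (1 - E⁻¹)⁻¹ * d) = ((2 + 0.0003) * (1 - E⁻¹)⁻¹) * (ρ * d) := by ring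
      _ ≤ 2.47 * (ρ * d) := by gcongr
      _ = _ := by ring
  have hA := inv_one_sub_exp_neg_le (x := 1.66 / (4000 * q) * q) (by positivity)
  have hB := inv_one_sub_exp_neg_le (x := 1.66 / (4000 * q) * (1 - q)) (by positivity)
  set A := (1 - Real.exp (-(1.66 / (4000 * q) * q)))⁻¹
  set B := (1 - Real.exp (-(1.66 / (4000 * q) * (1 - q))))⁻¹
  have hAB : A + B ≤ (4000 / 1.66 + 2) / (1 - q) := by
    have : (1 : ℝ) / (1.66 / (4000 * q) * q) + 1 + (1 / (1.66 / (4000 * q) * (1 - q)) + 1) ≤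
        (4000 / 1.66 + 2) / (1 - q) := by
      rw [le_div_iff₀ hq]
      field_simp
      nlinarith
    linarith
  have hA0 : 0 ≤ A + B := by
    have : ∀ x : ℝ, 0 < x → 0 ≤ (1 - Real.exp (-x))⁻¹ := fun x hx => by
      have : Real.exp (-x) ≤ 1 := by simpa using hx.le
      exact inv_nonneg.2 (by linarith)
    exact add_nonneg (this _ (by positivity)) (this _ (by positivity))
  rw [e1]
  calc _ = (4000⁻¹ * (2 * (Real.exp 1.66 + 1)) * (A + B)) *
        ((2 + 0.0003 : ℝ) ^ q * (ρ * (1 - E⁻¹)⁻¹ * d) ^ q) := by ring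
    _ ≤ 7.55 / (1 - q) * ((2.47 * ρ) ^ q * d ^ q) := by
        have h5 : (4000 : ℝ)⁻¹ * (2 * (Real.exp 1.66 + 1)) * (A + B) ≤ 7.55 / (1 - q) := by
          calc (4000 : ℝ)⁻¹ * (2 * (Real.exp 1.66 + 1)) * (A + B)
              ≤ (4000 : ℝ)⁻¹ * (2 * (5.26 + 1)) * ((4000 / 1.66 + 2) / (1 - q)) := by gcongr
            _ = ((4000 : ℝ)⁻¹ * (2 * (5.26 + 1)) * (4000 / 1.66 + 2)) / (1 - q) := by ring
            _ ≤ _ := by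
              gcongr
              norm_num
        have h6 : 0 ≤ 7.55 / (1 - q) := by positivity
        have h7 : 0 ≤ (2 + 0.0003 : ℝ) ^ q * (ρ * (1 - E⁻¹)⁻¹ * d) ^ q := by
          have h0 : 0 < (1 - E⁻¹)⁻¹ := inv_pos.2 hE0
          positivity
        exact mul_le_mul h5 hbase h7 h6
    _ = _ := by ring

lemma exists_coupling_euclidean {q : ℝ} (hq0 : 0 < q) (hq1 : q < 1) (m : ℕ) :
    ∃ f : ProbabilityMeasure (Fin (m + 1) → ℝ) → ℝ → (Fin (m + 1) → ℝ),
      IsCoupling (fun P : ProbabilityMeasure (Fin (m + 1) → ℝ) => (P : Measure _)) f ∧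
      ∀ (P Q : ProbabilityMeasure (Fin (m + 1) → ℝ))
        (γ : Measure ((Fin (m + 1) → ℝ) × (Fin (m + 1) → ℝ))), IsProbabilityMeasure γ →
        γ.map Prod.fst = P → γ.map Prod.snd = Q →
        ∫⁻ u, ENNReal.ofReal (_root_.lpNorm 2 (f P u - f Q u) ^ q) ∂stdSpace ≤
          ENNReal.ofReal (7.55 / (1 - q) *
            (2.47 * (unitBallVolume 2 m / unitBallVolume 2 (m + 1))) ^ q) *
          ∫⁻ z, ENNReal.ofReal (_root_.lpNorm 2 (z.1 - z.2) ^ q) ∂γ := by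
  obtain ⟨f, hf, h⟩ := exists_coupling_lintegral_le hq0 hq1 (s := 1.66 / (4000 * q))
    (by positivity) (η := 0.0003) (by norm_num) (M := 4000) (by norm_num) m
  refine ⟨f, hf, fun P Q γ hγ hP hQ => (h P Q γ hγ hP hQ).trans ?_⟩
  have h1 := unitBallVolume_pos 2 m
  have h2 := unitBallVolume_pos 2 (m + 1)
  have hq : 0 < 1 - q := by linarith
  rw [← lintegral_const_mul' _ _ ofReal_ne_top]
  refine lintegral_mono fun z => ?_
  have h4 : ((4000 : ℕ) : ℝ≥0∞)⁻¹ = ENNReal.ofReal (4000 : ℝ)⁻¹ := by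
    rw [ENNReal.ofReal_inv_of_pos (by norm_num)]
    norm_num
  rw [h4, ← ENNReal.ofReal_mul (by norm_num), ← ENNReal.ofReal_mul (by positivity)]
  refine ENNReal.ofReal_le_ofReal ?_
  have := coupling_constant_le hq0 hq1
    (ρ := unitBallVolume 2 m / unitBallVolume 2 (m + 1)) (by positivity)
    (lpNorm_nonneg one_le_two (z.1 - z.2))
  exact_mod_cast this

end EuclideanConstant

section CostComparison

lemma couplingRatio_le {X A : Type*} [MeasurableSpace X] {c : X → X → ℝ} {P : A → Measure X}
    {f : A → ℝ → X} {r : ℝ≥0∞} (hr : 1 ≤ r) (hr' : r ≠ ∞)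
    (h : ∀ a b (γ : Measure (X × X)), IsProbabilityMeasure γ → γ.map Prod.fst = P a →
      γ.map Prod.snd = P b → ∫⁻ u, ENNReal.ofReal (c (f a u) (f b u)) ∂stdSpace ≤
        r * ∫⁻ z, ENNReal.ofReal (c z.1 z.2) ∂γ) :
    couplingRatio c P f ≤ r := by
  refine sInf_le ⟨hr, fun a b => ?_⟩
  have h0 : r ≠ 0 := (zero_lt_one.trans_le hr).ne'
  rw [← ENNReal.div_le_iff' h0 hr']
  refine le_iInf₂ fun γ hγ => ?_
  rw [ENNReal.div_le_iff' h0 hr']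
  exact h a b γ hγ.1 hγ.2.1 hγ.2.2

lemma optRatio_le_of_cost_le {X A : Type*} [MeasurableSpace X] {c c' : X → X → ℝ}
    {P : A → Measure X} {f : A → ℝ → X} {K a b : ℝ} (hf : IsCoupling P f) (ha : 0 ≤ a)
    (hb : 0 ≤ b) (hr : 1 ≤ a * b * K) (hac : ∀ x y, c x y ≤ a * c' x y)
    (hbc : ∀ x y, c' x y ≤ b * c x y)
    (h : ∀ i j (γ : Measure (X × X)), IsProbabilityMeasure γ → γ.map Prod.fst = P i →
      γ.map Prod.snd = P j → ∫⁻ u, ENNReal.ofReal (c' (f i u) (f j u)) ∂stdSpace ≤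
        ENNReal.ofReal K * ∫⁻ z, ENNReal.ofReal (c' z.1 z.2) ∂γ) :
    optRatio c P ≤ ENNReal.ofReal (a * b * K) := by
  refine (iInf₂_le f hf).trans (couplingRatio_le (by simpa using hr) ofReal_ne_top ?_)
  intro i j γ hγ h1 h2
  have e1 : ∫⁻ u, ENNReal.ofReal (c (f i u) (f j u)) ∂stdSpace ≤
      ENNReal.ofReal a * ∫⁻ u, ENNReal.ofReal (c' (f i u) (f j u)) ∂stdSpace := by
    rw [← lintegral_const_mul' _ _ ofReal_ne_top]
    refine lintegral_mono fun u => ?_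
    rw [← ENNReal.ofReal_mul ha]
    exact ENNReal.ofReal_le_ofReal (hac _ _)
  have e2 : ∫⁻ z, ENNReal.ofReal (c' z.1 z.2) ∂γ ≤
      ENNReal.ofReal b * ∫⁻ z, ENNReal.ofReal (c z.1 z.2) ∂γ := by
    rw [← lintegral_const_mul' _ _ ofReal_ne_top]
    refine lintegral_mono fun u => ?_
    rw [← ENNReal.ofReal_mul hb]
    exact ENNReal.ofReal_le_ofReal (hbc _ _)
  refine e1.trans ((mul_le_mul_right ((h i j γ hγ h1 h2).trans
    (mul_le_mul_right e2 _)) _).trans (le_of_eq ?_))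
  rw [ENNReal.ofReal_mul (by positivity), ENNReal.ofReal_mul ha]
  ring

lemma lpNorm_rpow_le {p r : ℝ≥0∞} {q : ℝ} (hq : 0 < q) (hp : 1 ≤ p) (hpr : p ≤ r) {n : ℕ}
    (z : Fin n → ℝ) :
    _root_.lpNorm p z ^ q ≤ (n : ℝ) ^ (q * ((p⁻¹).toReal - (r⁻¹).toReal)) *
      _root_.lpNorm r z ^ q := by
  have h0 := lpNorm_nonneg (hp.trans hpr) z
  rw [mul_comm q, Real.rpow_mul (by positivity), ← Real.mul_rpow (by positivity) h0]
  exact Real.rpow_le_rpow (lpNorm_nonneg hp z) (lpNorm_le_rpow_mul hp hpr z) hq.le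

/-- A coupling that is good for the Euclidean norm is also good for the other `ℓ_p` norms, up to
the distortion between the norms. -/
lemma lpOptRatio_le {p : ℝ≥0∞} {q : ℝ} (hp : 1 ≤ p) (hq0 : 0 < q) (hq1 : q < 1) (m : ℕ)
    (hρ : 1 / 2 ≤ unitBallVolume 2 m / unitBallVolume 2 (m + 1)) :
    lpOptRatio (m + 1) p q ≤ ENNReal.ofReal (((m + 1 : ℕ) : ℝ) ^ (q * |(p⁻¹).toReal - 1 / 2|) *
      (7.55 / (1 - q) * (2.47 * (unitBallVolume 2 m / unitBallVolume 2 (m + 1))) ^ q)) := by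
  obtain ⟨f, hf, h⟩ := exists_coupling_euclidean hq0 hq1 m
  set ρ := unitBallVolume 2 m / unitBallVolume 2 (m + 1)
  have hK : 1 ≤ 7.55 / (1 - q) * (2.47 * ρ) ^ q := by
    have h1 : (1 : ℝ) ≤ 7.55 / (1 - q) := by
      rw [le_div_iff₀ (by linarith)]
      linarith
    have h2 : 1 ≤ (2.47 * ρ) ^ q := Real.one_le_rpow (by linarith) hq0.le
    exact one_le_mul_of_one_le_of_one_le h1 h2
  have hN : ∀ x : ℝ, 0 ≤ x → 1 ≤ ((m + 1 : ℕ) : ℝ) ^ x := fun x hx =>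
    Real.one_le_rpow (by exact_mod_cast Nat.succ_pos m) hx
  have h2i : (((2 : ℝ≥0∞)⁻¹).toReal) = 1 / 2 := by simp
  rcases le_total p 2 with hp2 | hp2
  · have hle : (1 / 2 : ℝ) ≤ (p⁻¹).toReal := by
      rw [← h2i]
      exact ENNReal.toReal_mono (by simpa using (zero_lt_one.trans_le hp).ne')
        (ENNReal.inv_le_inv.2 hp2)
    rw [abs_of_nonneg (by linarith)]
    have := optRatio_le_of_cost_le (c := fun x y => _root_.lpNorm p (x - y) ^ q)
      (c' := fun x y => _root_.lpNorm 2 (x - y) ^ q)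
      (a := ((m + 1 : ℕ) : ℝ) ^ (q * ((p⁻¹).toReal - 1 / 2))) (b := 1) hf (by positivity)
      zero_le_one
      (by rw [mul_one]; exact one_le_mul_of_one_le_of_one_le
            (hN _ (mul_nonneg hq0.le (by linarith))) hK)
      (fun x y => by rw [← h2i]; exact lpNorm_rpow_le hq0 hp hp2 (x - y))
      (fun x y => by
        rw [one_mul]
        exact Real.rpow_le_rpow (lpNorm_nonneg one_le_two _) (lpNorm_anti hp hp2 _) hq0.le) h
    rwa [mul_one] at this
  · have hle : (p⁻¹).toReal ≤ 1 / 2 := by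
      rw [← h2i]
      exact ENNReal.toReal_mono (by simp) (ENNReal.inv_le_inv.2 hp2)
    rw [abs_of_nonpos (by linarith), neg_sub]
    have := optRatio_le_of_cost_le (c := fun x y => _root_.lpNorm p (x - y) ^ q)
      (c' := fun x y => _root_.lpNorm 2 (x - y) ^ q)
      (a := 1) (b := ((m + 1 : ℕ) : ℝ) ^ (q * (1 / 2 - (p⁻¹).toReal))) hf zero_le_one
      (by positivity)
      (by rw [one_mul]; exact one_le_mul_of_one_le_of_one_le
            (hN _ (mul_nonneg hq0.le (by linarith))) hK)
      (fun x y => by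
        rw [one_mul]
        exact Real.rpow_le_rpow (lpNorm_nonneg hp _) (lpNorm_anti one_le_two hp2 _) hq0.le)
      (fun x y => by rw [← h2i]; exact lpNorm_rpow_le hq0 one_le_two hp2 (x - y)) h
    rwa [one_mul] at this

end CostComparison

section GammaInequalities

/-- The error of the trapezoidal rule for `1 / x` on `[y, y + 1]`. -/
def trapezoidError (y : ℝ) : ℝ := (1 / y + 1 / (y + 1)) / 2 - (Real.log (y + 1) - Real.log y)

lemma hasDerivAt_one_div {y : ℝ} (hy : y ≠ 0) : HasDerivAt (fun x : ℝ => 1 / x) (-(1 / y ^ 2)) y := by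
  simpa using hasDerivAt_inv hy

lemma trapezoidError_anti {y z : ℝ} (hy : 0 < y) (hyz : y ≤ z) :
    trapezoidError z ≤ trapezoidError y := by
  have hd : ∀ x : ℝ, 0 < x → HasDerivAt trapezoidError
      ((-(1 / x ^ 2) + -(1 / (x + 1) ^ 2)) / 2 - (1 / (x + 1) - x⁻¹)) x := by
    intro x hx
    have h1 := (hasDerivAt_one_div (y := x + 1) (by positivity)).comp_add_const x 1
    have h2 : HasDerivAt (fun x : ℝ => Real.log (x + 1)) (1 / (x + 1)) x :=
      ((hasDerivAt_id x).add_const 1).log (by positivity)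
    exact (((hasDerivAt_one_div hx.ne').add h1).div_const 2).sub (h2.sub (Real.hasDerivAt_log hx.ne'))
  have hanti : AntitoneOn trapezoidError (Set.Ici y) := by
    refine antitoneOn_of_deriv_nonpos (convex_Ici y)
      (fun x hx => (hd x (hy.trans_le hx)).continuousAt.continuousWithinAt)
      (fun x hx => (hd x (hy.trans_le (interior_subset hx))).differentiableAt.differentiableWithinAt)
      fun x hx => ?_
    have hx : 0 < x := hy.trans_le (interior_subset hx)
    rw [(hd x hx).deriv]
    have : (-(1 / x ^ 2) + -(1 / (x + 1) ^ 2)) / 2 - (1 / (x + 1) - x⁻¹) =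
        -(1 / 2) * (1 / x - 1 / (x + 1)) ^ 2 := by
      field_simp
      ring
    rw [this]
    nlinarith [sq_nonneg (1 / x - 1 / (x + 1))]
  exact hanti Set.self_mem_Ici hyz hyz

/-- The logarithmic derivative, in `s`, of one factor of the product formula for
`Γ(1 + (m+1)s) / (Γ(1 + s) Γ(1 + ms))`. -/
def gammaRatioTerm (m s k : ℝ) : ℝ := 1 / (k + s) + m / (k + m * s) - (m + 1) / (k + (m + 1) * s)

/-- A sequence whose increments are bounded by `gammaRatioTerm`. -/
def gammaRatioTail (m s k : ℝ) : ℝ :=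
  gammaRatioTerm m s k / 2 -
    (Real.log (k + s) + m * Real.log (k + m * s) - (m + 1) * Real.log (k + (m + 1) * s))

lemma gammaRatioTail_sub_le {m s k : ℝ} (hm : 0 ≤ m) (hs : 0 < s) (hk : 0 < k) :
    gammaRatioTail m s k - gammaRatioTail m s (k + 1) ≤ gammaRatioTerm m s k := by
  have h1 := trapezoidError_anti (y := k + s) (z := k + (m + 1) * s) (by positivity)
    (by nlinarith)
  have h2 := mul_le_mul_of_nonneg_left (trapezoidError_anti (y := k + m * s)
    (z := k + (m + 1) * s) (by positivity) (by nlinarith)) hm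
  unfold trapezoidError at h1 h2
  unfold gammaRatioTail gammaRatioTerm
  have e1 : k + 1 + s = k + s + 1 := by ring
  have e2 : k + 1 + m * s = k + m * s + 1 := by ring
  have e3 : k + 1 + (m + 1) * s = k + (m + 1) * s + 1 := by ring
  rw [e1, e2, e3, div_eq_mul_one_div m, div_eq_mul_one_div m, div_eq_mul_one_div (m + 1),
    div_eq_mul_one_div (m + 1)]
  linarith

lemma gammaRatioTail_le {m s k : ℝ} (hm : 0 ≤ m) (hs : 0 < s) (hs1 : s ≤ 1) (hk : 0 < k) :
    gammaRatioTail m s k ≤ (m + 1 + (m + 1) ^ 2) / k := by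
  have h1 : gammaRatioTerm m s k ≤ 2 * ((m + 1) / k) := by
    have e1 : 1 / (k + s) ≤ 1 / k := one_div_le_one_div_of_le hk (by linarith)
    have e2 : m / (k + m * s) ≤ m / k := div_le_div_of_nonneg_left hm hk (by nlinarith)
    have e3 : 0 ≤ (m + 1) / (k + (m + 1) * s) := by positivity
    have e4 : 0 ≤ (m + 1) / k := by positivity
    unfold gammaRatioTerm
    have e5 : (m + 1) / k = m / k + 1 / k := add_div _ _ _
    linarith
  have h2 : Real.log k ≤ Real.log (k + s) := Real.log_le_log hk (by linarith)
  have h3 : m * Real.log k ≤ m * Real.log (k + m * s) :=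
    mul_le_mul_of_nonneg_left (Real.log_le_log hk (by nlinarith)) hm
  have h4 : (m + 1) * Real.log (k + (m + 1) * s) ≤ (m + 1) * (Real.log k + (m + 1) / k) := by
    refine mul_le_mul_of_nonneg_left ?_ (by positivity)
    have e1 : k + (m + 1) * s = k * (1 + (m + 1) * s / k) := by field_simp
    rw [e1, Real.log_mul hk.ne' (by positivity)]
    have e2 := Real.log_le_sub_one_of_pos (x := 1 + (m + 1) * s / k) (by positivity)
    have e3 : (m + 1) * s / k ≤ (m + 1) / k := by
      gcongr
      nlinarith
    linarith
  unfold gammaRatioTail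
  rw [add_div, sq, mul_div_assoc]
  linarith

lemma gammaRatio_polynomial {y s : ℝ} (hy : 1 ≤ y) (hs : 1 / 2 ≤ s) :
    s / (y + s - 1) ≤ 2 * (s / y) / (s / y + 2) + (1 / y - 1 / (y + s)) +
      (1 / y ^ 2 - 1 / (y + s) ^ 2) / 2 := by
  obtain ⟨u, hu, rfl⟩ : ∃ u, 0 ≤ u ∧ y = u + 1 := ⟨y - 1, by linarith, by ring⟩
  obtain ⟨v, hv, rfl⟩ : ∃ v, 0 ≤ v ∧ s = v + 1 / 2 := ⟨s - 1 / 2, by linarith, by ring⟩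
  rw [← sub_nonneg, show u + 1 + (v + 1 / 2) - 1 = u + v + 1 / 2 by ring]
  have : 2 * ((v + 1 / 2) / (u + 1)) / ((v + 1 / 2) / (u + 1) + 2) +
      (1 / (u + 1) - 1 / (u + 1 + (v + 1 / 2))) +
      (1 / (u + 1) ^ 2 - 1 / (u + 1 + (v + 1 / 2)) ^ 2) / 2 -
      (v + 1 / 2) / (u + v + 1 / 2) =
      (v + 1 / 2) * ((1 / 8 + 63 / 4 * v + 35 / 2 * v ^ 2 + 5 * v ^ 3) +
        (11 / 2 + 83 / 2 * v + 32 * v ^ 2 + 6 * v ^ 3) * u +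
        (41 / 4 + 75 / 2 * v + 19 * v ^ 2 + 2 * v ^ 3) * u ^ 2 +
        (6 + 14 * v + 4 * v ^ 2) * u ^ 3 + (1 + 2 * v) * u ^ 4) /
      (2 * (u + 1) ^ 2 * (u + 1 + (v + 1 / 2)) ^ 2 * (2 * (u + 1) + (v + 1 / 2)) *
        (u + v + 1 / 2)) := by
    field_simp
    ring
  rw [this]
  positivity

lemma log_le_gammaRatioTail {m s : ℝ} (hm : 0 ≤ m) (hs : 1 / 2 ≤ s) :
    Real.log (m + 1) ≤ gammaRatioTail m s 1 := by
  have hs0 : 0 < s := by linarith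
  set B : ℝ → ℝ := fun x => x * Real.log (1 + x * s) - x / (1 + x * s) / 2 with hB
  set B' : ℝ → ℝ := fun x => Real.log (1 + x * s) + x * s / (1 + x * s) - 1 / (1 + x * s) ^ 2 / 2
    with hB'
  have hBd : ∀ x : ℝ, 0 ≤ x → HasDerivAt B (B' x) x := by
    intro x hx
    have hpos : 0 < 1 + x * s := by positivity
    have h1 : HasDerivAt (fun x : ℝ => 1 + x * s) s x := by
      simpa using ((hasDerivAt_id x).mul_const s).const_add 1
    have h2 := ((hasDerivAt_id x).mul (h1.log hpos.ne')).sub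
      (((hasDerivAt_id x).div h1 hpos.ne').div_const 2)
    refine h2.congr_deriv ?_
    simp only [hB', id]
    field_simp
    ring
  have hΦd : ∀ x : ℝ, 0 ≤ x → HasDerivAt (fun x => B (x + 1) - B x - Real.log (x + 1))
      (B' (x + 1) - B' x - 1 / (x + 1)) x := fun x hx =>
    (((hBd (x + 1) (by positivity)).comp_add_const x 1).sub (hBd x hx)).sub
      (((hasDerivAt_id x).add_const 1).log (by positivity))
  have hmono : MonotoneOn (fun x => B (x + 1) - B x - Real.log (x + 1)) (Set.Ici 0) := by
    refine monotoneOn_of_deriv_nonneg (convex_Ici 0)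
      (fun x hx => (hΦd x hx).continuousAt.continuousWithinAt)
      (fun x hx => (hΦd x (interior_subset hx)).differentiableAt.differentiableWithinAt)
      fun x hx => ?_
    have hx : 0 ≤ x := interior_subset hx
    rw [(hΦd x hx).deriv]
    have hy : 0 < 1 + x * s := by positivity
    have h1 := gammaRatio_polynomial (y := 1 + x * s) (by nlinarith) hs
    have h2 := Real.le_log_one_add_of_nonneg (x := s / (1 + x * s)) (by positivity)
    have h3 : Real.log (1 + s / (1 + x * s)) =
        Real.log (1 + (x + 1) * s) - Real.log (1 + x * s) := by
      rw [← Real.log_div (by positivity) hy.ne']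
      congr 1
      field_simp
      ring
    have h4 : s / (1 + x * s + s - 1) = 1 / (x + 1) := by
      rw [div_eq_div_iff (by nlinarith) (by positivity)]
      ring
    have h5 : (x + 1) * s / (1 + (x + 1) * s) = 1 - 1 / (1 + x * s + s) := by
      rw [eq_sub_iff_add_eq, show 1 + x * s + s = 1 + (x + 1) * s by ring, ← add_div,
        div_eq_one_iff_eq (by positivity)]
      ring
    have h6 : x * s / (1 + x * s) = 1 - 1 / (1 + x * s) := by
      field_simp
      ring
    have h7 : 1 + (x + 1) * s = 1 + x * s + s := by ring
    simp only [hB']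
    rw [h5, h6]
    rw [h4] at h1
    rw [h3] at h2
    rw [h7] at h2 ⊢
    linarith
  have h := hmono Set.self_mem_Ici hm hm
  simp only [hB] at h
  norm_num at h
  unfold gammaRatioTail gammaRatioTerm
  norm_num
  rw [sub_add] at h
  have e : (1 + s)⁻¹ / 2 = 1 / (1 + s) / 2 := by rw [one_div]
  linarith

end GammaInequalities

section GammaRatio

open Filter in
/-- The quotient `n ^ (-s) Γ(1 + ns) / (Γ(1 + s) Γ(1 + (n-1)s))` increases beyond `s = 1/2`. -/
lemma log_gammaRatio_mono (m : ℕ) {s : ℝ} (hs : 1 / 2 < s) (hs1 : s ≤ 1) :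
    (s - 1 / 2) * Real.log (m + 1) +
      (Real.log (Real.Gamma (1 + (m + 1) * (1 / 2))) - Real.log (Real.Gamma (1 + 1 / 2)) -
        Real.log (Real.Gamma (1 + m * (1 / 2)))) ≤
      Real.log (Real.Gamma (1 + (m + 1) * s)) - Real.log (Real.Gamma (1 + s)) -
        Real.log (Real.Gamma (1 + m * s)) := by
  set F : ℝ → ℕ → ℝ := fun x N =>
    Real.BohrMollerup.logGammaSeq (1 + (m + 1) * x) N - Real.BohrMollerup.logGammaSeq (1 + x) N -
      Real.BohrMollerup.logGammaSeq (1 + m * x) N with hF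
  have hlim : ∀ x : ℝ, 0 < x → Tendsto (F x) atTop (nhds
      (Real.log (Real.Gamma (1 + (m + 1) * x)) - Real.log (Real.Gamma (1 + x)) -
        Real.log (Real.Gamma (1 + m * x)))) := fun x hx =>
    ((Real.BohrMollerup.tendsto_log_gamma (by positivity)).sub
      (Real.BohrMollerup.tendsto_log_gamma (by positivity))).sub
      (Real.BohrMollerup.tendsto_log_gamma (by positivity))
  have hFeq : ∀ N : ℕ, ∀ x : ℝ, F x N = -Real.log N - Real.log N.factorial +
      ∑ j ∈ Finset.range (N + 1), (Real.log ((j + 1 : ℕ) + x) + Real.log ((j + 1 : ℕ) + m * x) -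
        Real.log ((j + 1 : ℕ) + (m + 1) * x)) := by
    intro N x
    have e : ∀ (a : ℝ) (j : ℕ), 1 + a + j = (j + 1 : ℕ) + a := fun a j => by push_cast; ring
    simp only [hF, Real.BohrMollerup.logGammaSeq, e, Finset.sum_sub_distrib, Finset.sum_add_distrib]
    ring
  have hderiv : ∀ N : ℕ, ∀ x : ℝ, 0 < x → HasDerivAt (fun x => F x N)
      (∑ j ∈ Finset.range (N + 1), gammaRatioTerm m x (j + 1 : ℕ)) x := by
    intro N x hx
    rw [funext (hFeq N)]
    refine (HasDerivAt.fun_sum fun j _ => ?_).const_add _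
    have h : ∀ a : ℝ, 0 ≤ a → HasDerivAt (fun x : ℝ => Real.log ((j + 1 : ℕ) + a * x))
        (a / ((j + 1 : ℕ) + a * x)) x := fun a ha => by
      have h1 : HasDerivAt (fun x : ℝ => ((j + 1 : ℕ) : ℝ) + a * x) a x := by
        simpa using ((hasDerivAt_id x).const_mul a).const_add ((j + 1 : ℕ) : ℝ)
      exact h1.log (by positivity)
    have h1 := h 1 zero_le_one
    simp only [one_mul] at h1
    exact (h1.add (h m (by positivity))).sub (h (m + 1) (by positivity))
  have hlow : ∀ N : ℕ, ∀ x : ℝ, 1 / 2 ≤ x → x ≤ 1 →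
      Real.log (m + 1) - (m + 1 + (m + 1) ^ 2) / (N + 2 : ℕ) ≤
        ∑ j ∈ Finset.range (N + 1), gammaRatioTerm m x (j + 1 : ℕ) := by
    intro N x hx hx1
    have hm : (0 : ℝ) ≤ m := by positivity
    have h1 : ∑ j ∈ Finset.range (N + 1),
        (gammaRatioTail m x (j + 1 : ℕ) - gammaRatioTail m x (j + 1 + 1 : ℕ)) ≤
        ∑ j ∈ Finset.range (N + 1), gammaRatioTerm m x (j + 1 : ℕ) := by
      refine Finset.sum_le_sum fun j _ => ?_
      have := gammaRatioTail_sub_le hm (s := x) (by linarith) (k := (j + 1 : ℕ)) (by positivity)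
      rwa [Nat.cast_succ (j + 1)]
    rw [Finset.sum_range_sub' fun j : ℕ => gammaRatioTail m x (j + 1 : ℕ)] at h1
    have h2 := log_le_gammaRatioTail hm hx
    have h3 := gammaRatioTail_le hm (s := x) (by linarith) hx1 (k := (N + 2 : ℕ)) (by positivity)
    have h4 : gammaRatioTail m x (0 + 1 : ℕ) = gammaRatioTail m x 1 := by norm_num
    rw [h4] at h1
    linarith
  have hmain : ∀ N : ℕ, (s - 1 / 2) * (Real.log (m + 1) - (m + 1 + (m + 1) ^ 2) / (N + 2 : ℕ)) +
      F (1 / 2) N ≤ F s N := by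
    intro N
    obtain ⟨c, hc, hc'⟩ := exists_hasDerivAt_eq_slope (fun x => F x N) _ hs
      (fun x hx => (hderiv N x (by linarith [hx.1])).continuousAt.continuousWithinAt)
      (fun x hx => hderiv N x (by linarith [hx.1]))
    have h1 := hlow N c hc.1.le (hc.2.le.trans hs1)
    rw [hc', le_div_iff₀ (by linarith)] at h1
    linarith
  have hzero : Tendsto (fun N : ℕ => ((m : ℝ) + 1 + (m + 1) ^ 2) / (N + 2 : ℕ)) atTop (nhds 0) :=
    (tendsto_const_div_atTop_nhds_zero_nat _).comp (tendsto_add_atTop_nat 2)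
  have hl := ((hzero.const_sub (Real.log (m + 1))).const_mul (s - 1 / 2)).add
    (hlim (1 / 2) (by norm_num))
  rw [sub_zero] at hl
  exact le_of_tendsto_of_tendsto' hl (hlim s (by linarith)) hmain

/-- The quotient of volumes `V_{m,p} / V_{m+1,p}`, in terms of `s = 1/p`. -/
def volumeQuotient (m : ℕ) (s : ℝ) : ℝ :=
  Real.Gamma (1 + (m + 1) * s) / (2 * Real.Gamma (1 + s) * Real.Gamma (1 + m * s))

lemma Gamma_one_add_pos {x : ℝ} (hx : 0 ≤ x) : 0 < Real.Gamma (1 + x) :=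
  Real.Gamma_pos_of_pos (by linarith)

lemma volumeQuotient_pos (m : ℕ) {s : ℝ} (hs : 0 ≤ s) : 0 < volumeQuotient m s := by
  have h1 := Gamma_one_add_pos hs
  have h2 := Gamma_one_add_pos (x := m * s) (by positivity)
  have h3 := Gamma_one_add_pos (x := (m + 1) * s) (by positivity)
  unfold volumeQuotient
  positivity

lemma unitBallVolume_div (p : ℝ≥0∞) (m : ℕ) :
    unitBallVolume p m / unitBallVolume p (m + 1) = volumeQuotient m (p⁻¹).toReal := by
  have hs : 0 ≤ (p⁻¹).toReal := toReal_nonneg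
  have h1 := (Gamma_one_add_pos hs).ne'
  have h2 := (Gamma_one_add_pos (x := m * (p⁻¹).toReal) (by positivity)).ne'
  have h3 := (Gamma_one_add_pos (x := (m + 1) * (p⁻¹).toReal) (by positivity)).ne'
  unfold unitBallVolume volumeQuotient
  push_cast
  field_simp
  ring

lemma half_le_volumeQuotient (m : ℕ) {s : ℝ} (hs : 0 ≤ s) : 1 / 2 ≤ volumeQuotient m s := by
  rcases hs.eq_or_lt with rfl | hs
  · simp [volumeQuotient]
  have h1 := Gamma_one_add_pos hs.le
  have h2 := Gamma_one_add_pos (x := m * s) (by positivity)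
  have h3 := Gamma_one_add_pos (x := (m + 1) * s) (by positivity)
  have hconv : ∀ θ : ℝ, 0 ≤ θ → θ ≤ 1 → Real.log (Real.Gamma (1 + θ * ((m + 1) * s))) ≤
      θ * Real.log (Real.Gamma (1 + (m + 1) * s)) := by
    intro θ h0 h1
    have := Real.convexOn_log_Gamma.2 (x := 1) (y := 1 + (m + 1) * s) (Set.mem_Ioi.2 one_pos)
      (Set.mem_Ioi.2 (by positivity)) (sub_nonneg.2 h1) h0 (sub_add_cancel 1 θ)
    simp only [smul_eq_mul, Function.comp_apply, Real.Gamma_one, Real.log_one, mul_zero,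
      zero_add] at this
    rwa [show (1 - θ) * 1 + θ * (1 + (m + 1) * s) = 1 + θ * ((m + 1) * s) by ring] at this
  have hm : (0 : ℝ) < m + 1 := by positivity
  have e1 := hconv (1 / (m + 1)) (by positivity) (by rw [div_le_one hm]; linarith)
  have e2 := hconv (m / (m + 1)) (by positivity) (by rw [div_le_one hm]; linarith)
  rw [show 1 / ((m : ℝ) + 1) * ((m + 1) * s) = s by field_simp] at e1
  rw [show (m : ℝ) / ((m : ℝ) + 1) * ((m + 1) * s) = m * s by field_simp] at e2
  have e3 : Real.log (Real.Gamma (1 + s) * Real.Gamma (1 + m * s)) ≤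
      Real.log (Real.Gamma (1 + (m + 1) * s)) := by
    rw [Real.log_mul h1.ne' h2.ne']
    refine (add_le_add e1 e2).trans (le_of_eq ?_)
    field_simp
    ring
  have e4 := (Real.log_le_log_iff (by positivity) h3).1 e3
  rw [volumeQuotient, div_le_div_iff₀ two_pos (by positivity)]
  linarith

lemma volumeQuotient_one_half_le (m : ℕ) : volumeQuotient m (1 / 2) ≤ √((m : ℝ) + 1) / 2 := by
  have hG : Real.Gamma (1 + 1 / 2) = √Real.pi / 2 := by
    rw [add_comm, Real.Gamma_add_one (by norm_num), Real.Gamma_one_half_eq]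
    ring
  have h2 := Gamma_one_add_pos (x := (m : ℝ) * (1 / 2)) (by positivity)
  have hpi : 0 < √Real.pi := Real.sqrt_pos.2 Real.pi_pos
  rcases Nat.eq_zero_or_pos m with rfl | hm
  · norm_num [volumeQuotient]
    rw [show (3 / 2 : ℝ) = 1 + 1 / 2 by norm_num, hG]
    field_simp
    norm_num
  have hm : (1 : ℝ) ≤ m := by exact_mod_cast hm
  set x : ℝ := 1 + m * (1 / 2) with hx
  have hx0 : 0 < x := by positivity
  have h1 := Real.Gamma_mul_add_mul_le_rpow_Gamma_mul_rpow_Gamma hx0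
    (show 0 < x + 1 by positivity) (one_half_pos (α := ℝ)) one_half_pos (add_halves 1)
  rw [Real.Gamma_add_one hx0.ne', Real.mul_rpow hx0.le h2.le, mul_left_comm,
    ← Real.rpow_add h2, add_halves, Real.rpow_one, ← Real.sqrt_eq_rpow,
    show 1 / 2 * x + 1 / 2 * (x + 1) = 1 + (m + 1) * (1 / 2) by rw [hx]; ring] at h1
  have h3 : 2 * √x ≤ √((m : ℝ) + 1) * √Real.pi := by
    rw [← Real.sqrt_mul (by positivity), show (2 : ℝ) = √4 by
      rw [show (4 : ℝ) = 2 ^ 2 by norm_num, Real.sqrt_sq two_pos.le],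
      ← Real.sqrt_mul (by norm_num)]
    refine Real.sqrt_le_sqrt ?_
    rw [hx]
    nlinarith [Real.pi_gt_d2]
  rw [volumeQuotient, hG, ← hx, div_le_div_iff₀ (by positivity) two_pos]
  nlinarith

lemma rpow_mul_volumeQuotient_le (m : ℕ) {s : ℝ} (hs : 1 / 2 ≤ s) (hs1 : s ≤ 1) :
    ((m : ℝ) + 1) ^ (s - 1 / 2) * volumeQuotient m (1 / 2) ≤ volumeQuotient m s := by
  rcases hs.eq_or_lt with rfl | hs
  · simp
  have hs0 : 0 < s := by linarith
  have key := log_gammaRatio_mono m hs hs1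
  have hlog : ∀ x : ℝ, 0 < x → Real.log (volumeQuotient m x) =
      Real.log (Real.Gamma (1 + (m + 1) * x)) - Real.log (Real.Gamma (1 + x)) -
        Real.log (Real.Gamma (1 + m * x)) - Real.log 2 := fun x hx => by
    have h1 := (Gamma_one_add_pos hx.le).ne'
    have h2 := (Gamma_one_add_pos (x := m * x) (by positivity)).ne'
    have h3 := (Gamma_one_add_pos (x := (m + 1) * x) (by positivity)).ne'
    rw [volumeQuotient, Real.log_div h3 (by positivity), Real.log_mul (by positivity) h2,
      Real.log_mul two_ne_zero h1]
    ring
  have h0 := volumeQuotient_pos m (s := 1 / 2) (by norm_num)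
  rw [← Real.log_le_log_iff (by positivity) (volumeQuotient_pos m hs0.le),
    Real.log_mul (by positivity) h0.ne', Real.log_rpow (by positivity), hlog s hs0,
    hlog (1 / 2) (by norm_num)]
  linarith

end GammaRatio

lemma rpow_abs_mul_volumeQuotient_le (m : ℕ) {p : ℝ≥0∞} (hp : 1 ≤ p) :
    ((m : ℝ) + 1) ^ |(p⁻¹).toReal - 1 / 2| * volumeQuotient m (1 / 2) ≤
      ((m : ℝ) + 1) ^ ((if 2 < p then (1 : ℝ) else 0) * (1 - (p⁻¹).toReal)) *
        volumeQuotient m (p⁻¹).toReal := by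
  have h2i : (((2 : ℝ≥0∞)⁻¹).toReal) = 1 / 2 := by simp
  have hN : (0 : ℝ) < m + 1 := by positivity
  set s := (p⁻¹).toReal with hs
  have hs0 : 0 ≤ s := toReal_nonneg
  split_ifs with h
  · have hle : s ≤ 1 / 2 := by
      rw [← h2i]
      exact ENNReal.toReal_mono (by simp) (ENNReal.inv_le_inv.2 h.le)
    rw [abs_of_nonpos (by linarith), one_mul]
    calc _ ≤ ((m : ℝ) + 1) ^ (-(s - 1 / 2)) * (√((m : ℝ) + 1) / 2) := by
          gcongr
          exact volumeQuotient_one_half_le m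
      _ = ((m : ℝ) + 1) ^ (1 - s) * (1 / 2) := by
          rw [Real.sqrt_eq_rpow, ← mul_div_assoc, ← Real.rpow_add hN, mul_one_div]
          congr 2
          ring
      _ ≤ _ := by
          gcongr
          exact half_le_volumeQuotient m hs0
  · have hp2 : p ≤ 2 := not_lt.1 h
    have hp0 : p ≠ 0 := (zero_lt_one.trans_le hp).ne'
    have hle : 1 / 2 ≤ s := by
      rw [← h2i]
      exact ENNReal.toReal_mono (by simpa using hp0) (ENNReal.inv_le_inv.2 hp2)
    have hs1 : s ≤ 1 := by
      have := ENNReal.toReal_mono one_ne_top (ENNReal.inv_le_one.2 hp)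
      rwa [toReal_one] at this
    rw [abs_of_nonneg (by linarith), zero_mul, Real.rpow_zero, one_mul]
    exact rpow_mul_volumeQuotient_le m hle hs1

lemma rpow_abs_mul_volumeQuotient_le_rpow_max (m : ℕ) (s : ℝ) :
    ((m : ℝ) + 1) ^ |s - 1 / 2| * volumeQuotient m (1 / 2) ≤
      ((m : ℝ) + 1) ^ max s (1 - s) / 2 := by
  have hN : (0 : ℝ) < m + 1 := by positivity
  calc _ ≤ ((m : ℝ) + 1) ^ |s - 1 / 2| * (√((m : ℝ) + 1) / 2) := by
        gcongr
        exact volumeQuotient_one_half_le m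
    _ = _ := by
      rw [Real.sqrt_eq_rpow, ← mul_div_assoc, ← Real.rpow_add hN]
      congr 2
      rcases le_total s (1 / 2) with h | h
      · rw [abs_of_nonpos (by linarith), max_eq_right (by linarith)]
        ring
      · rw [abs_of_nonneg (by linarith), max_eq_left (by linarith)]
        ring

/-- snowflake `ℓ_p` costs on `ℝⁿ`, upper bound. For `n ≥ 1`,
`p ∈ [1,∞]`, `0 < q < 1`, and `c(x,y) = ‖x − y‖_p^q`,
`r*_c(P(ℝⁿ)) < (7.56/(1−q)) (2.47 n^{1{p>2}(1−1/p)} V_{n−1,p}/V_{n,p})^q` and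
consequently `r*_c(P(ℝⁿ)) < (10.55/(1−q)) n^{q max{1/p, 1−1/p}}`. -/
theorem lp_snowflake_optRatio_lt (n : ℕ) (hn : 1 ≤ n) (p : ℝ≥0∞) (hp : 1 ≤ p)
    (q : ℝ) (hq0 : 0 < q) (hq1 : q < 1) :
    lpOptRatio n p q
        < ENNReal.ofReal ((7.56 / (1 - q)) *
            (2.47 * (n : ℝ) ^ ((if 2 < p then (1 : ℝ) else 0) * (1 - (p⁻¹).toReal)) *
              (unitBallVolume p (n - 1) / unitBallVolume p n)) ^ q) ∧
      lpOptRatio n p q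
        < ENNReal.ofReal ((10.55 / (1 - q)) *
            (n : ℝ) ^ (q * max (p⁻¹).toReal (1 - (p⁻¹).toReal))) := by
  obtain ⟨m, rfl⟩ : ∃ m, n = m + 1 := ⟨n - 1, by omega⟩
  have hρ0 := volumeQuotient_pos m (s := 1 / 2) (by norm_num)
  have h2i : (((2 : ℝ≥0∞)⁻¹).toReal) = 1 / 2 := by simp
  have hbound := lpOptRatio_le hp hq0 hq1 m
    (by rw [unitBallVolume_div, h2i]; exact half_le_volumeQuotient m (by norm_num))
  rw [unitBallVolume_div, h2i] at hbound
  rw [Nat.add_sub_cancel, unitBallVolume_div]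
  have hq : 0 < 1 - q := by linarith
  set s := (p⁻¹).toReal with hs
  have hs0 : 0 ≤ s := toReal_nonneg
  have hvs := volumeQuotient_pos m hs0
  push_cast at hbound ⊢
  have hN : (0 : ℝ) < m + 1 := by positivity
  set ρ := volumeQuotient m (1 / 2) with hρ
  have heq : ((m : ℝ) + 1) ^ (q * |s - 1 / 2|) * (7.55 / (1 - q) * (2.47 * ρ) ^ q) =
      7.55 / (1 - q) * (2.47 * (((m : ℝ) + 1) ^ |s - 1 / 2| * ρ)) ^ q := by
    rw [mul_left_comm (2.47 : ℝ), Real.mul_rpow (x := ((m : ℝ) + 1) ^ |s - 1 / 2|) (by positivity)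
      (by positivity), ← Real.rpow_mul hN.le, mul_comm q]
    ring
  rw [heq] at hbound
  constructor
  · refine hbound.trans_lt ?_
    rw [ENNReal.ofReal_lt_ofReal_iff (by positivity), mul_assoc (2.47 : ℝ)]
    refine mul_lt_mul_of_lt_of_le_of_pos_of_nonneg ?_ ?_ ?_ ?_
    · gcongr
      norm_num
    · exact Real.rpow_le_rpow (by positivity) (mul_le_mul_of_nonneg_left
        (rpow_abs_mul_volumeQuotient_le m hp) (by norm_num)) hq0.le
    · positivity
    · positivity
  · refine hbound.trans_lt ?_
    rw [ENNReal.ofReal_lt_ofReal_iff (by positivity), mul_comm q, Real.rpow_mul hN.le]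
    set T := ((m : ℝ) + 1) ^ max s (1 - s) with hT
    have hT0 : 0 < T := by positivity
    have h1 : (2.47 * (((m : ℝ) + 1) ^ |s - 1 / 2| * ρ)) ^ q ≤ 1.235 * T ^ q := by
      calc _ ≤ (1.235 * T) ^ q := by
            refine Real.rpow_le_rpow (by positivity) ?_ hq0.le
            linarith [rpow_abs_mul_volumeQuotient_le_rpow_max m s]
        _ = 1.235 ^ q * T ^ q := Real.mul_rpow (by norm_num) hT0.le
        _ ≤ _ := by
            gcongr
            exact Real.rpow_le_self_of_one_le (by norm_num) hq1.le
    calc 7.55 / (1 - q) * (2.47 * (((m : ℝ) + 1) ^ |s - 1 / 2| * ρ)) ^ q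
        ≤ 7.55 / (1 - q) * (1.235 * T ^ q) := by gcongr
      _ = (7.55 * 1.235) / (1 - q) * T ^ q := by ring
      _ < 10.55 / (1 - q) * T ^ q := by
          gcongr
          norm_num

end
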